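/- arXiv:1701.08115 — 3 statements merged into one kernel-verified Lean document; each statement's English description precedes it below -/
import Mathlib

section
/- Let k ≥ 3 and s ≥ 5k² be integers with s not divisible by k. For all α > 0 and γ > 0 there exists n₀ such that for all n ≥ n₀: every k-graph H on n vertices with δ_{k−1}(H) ≥ (1/2 + 1/(2s) + γ)n has a C_s^k-tiling covering at least (1 − α)n vertices. -/
set_option autoImplicit false

open Finset

section Defs

variable {V : Type} [Fintype V] [DecidableEq V]

/-- `E` is the edge set of a `k`-uniform hypergraph on `V`. -/
def IsKGraph (k : ℕ) (E : Finset (Finset V)) : Prop := ∀ e ∈ E, e.card = k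

/-- The degree of a vertex set `S`: the number of edges containing `S`. -/
def degS (E : Finset (Finset V)) (S : Finset V) : ℕ := (E.filter fun e => S ⊆ e).card

/-- `C` is the (cyclically ordered) vertex list of a copy of a tight cycle:
the vertices are distinct and every `k` cyclically consecutive vertices form an edge. -/
def IsTightCycleList (k : ℕ) (E : Finset (Finset V)) (C : List V) : Prop :=
  C.Nodup ∧ ∀ i < C.length, (((C ++ C).drop i).take k).toFinset ∈ E

/-- `H` has a `C_s^k`-covering: every vertex lies in a copy of the tight cycle on `s` vertices. -/
def HasCsCovering (k s : ℕ) (E : Finset (Finset V)) : Prop :=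
  ∀ v : V, ∃ C : List V, C.length = s ∧ IsTightCycleList k E C ∧ v ∈ C

/-- `H` contains a copy of `C_s^k`. -/
def HasCsCopy (k s : ℕ) (E : Finset (Finset V)) : Prop :=
  ∃ C : List V, C.length = s ∧ IsTightCycleList k E C

/-- `A` is the vertex set of a copy of `C_s^k` in `H`. -/
def SpansCs (k s : ℕ) (E : Finset (Finset V)) (A : Finset V) : Prop :=
  ∃ C : List V, C.length = s ∧ IsTightCycleList k E C ∧ C.toFinset = A

/-- a `C_s^k`-tiling: a set of pairwise disjoint vertex sets of copies of `C_s^k`. -/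
def IsCsTiling (k s : ℕ) (E : Finset (Finset V)) (T : Finset (Finset V)) : Prop :=
  (T : Set (Finset V)).PairwiseDisjoint id ∧ ∀ A ∈ T, SpansCs k s E A

/-- a perfect `C_s^k`-tiling of the induced subgraph on `U`. -/
def HasPerfectCsTilingOn (k s : ℕ) (E : Finset (Finset V)) (U : Finset V) : Prop :=
  ∃ T : Finset (Finset V), IsCsTiling k s E T ∧ T.biUnion id = U

/-- a perfect `C_s^k`-tiling of `H`. -/
def HasPerfectCsTiling (k s : ℕ) (E : Finset (Finset V)) : Prop :=
  HasPerfectCsTilingOn k s E Finset.univ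

/-- the pair `(k,s)` is admissible if `gcd k s = 1` or `k / gcd k s` is even. -/
def AdmissiblePair (k s : ℕ) : Prop := Nat.gcd k s = 1 ∨ Even (k / Nat.gcd k s)

/-- The `k`-graph `H₀^k(A,B)`: edges are the `k`-subsets `e` of `A ∪ B`
with `|e ∩ A| ≢ k (mod 2)`. -/
def H0edges (k : ℕ) (A B : Finset V) : Finset (Finset V) :=
  ((A ∪ B).powersetCard k).filter fun e => ¬ (e ∩ A).card % 2 = k % 2

/-- `P` is (the vertex list of) a tight path: distinct vertices, every `k`
consecutive vertices form an edge. -/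
def IsTightPath (k : ℕ) (E : Finset (Finset V)) (P : List V) : Prop :=
  P.Nodup ∧ ∀ i, i + k ≤ P.length → ((P.drop i).take k).toFinset ∈ E

/-- `P = v₁ ⋯ v_ℓ` has start of type `σ` w.r.t. classes `Vc`: `v_i ∈ V_{σ(i)}`
for `1 ≤ i ≤ k-1` (0-indexed below). -/
def hasStartType (k : ℕ) (Vc : Fin k → Finset V) (P : List V) (σ : Equiv.Perm (Fin k)) : Prop :=
  k ≤ P.length + 1 ∧ ∀ j : Fin k, (j : ℕ) + 1 < k → ∀ v ∈ P[(j : ℕ)]?, v ∈ Vc (σ j)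

/-- `P = v₁ ⋯ v_ℓ` has end of type `σ` w.r.t. classes `Vc`: `v_{ℓ-k+i} ∈ V_{σ(i)}`
for `2 ≤ i ≤ k` (0-indexed below). -/
def hasEndType (k : ℕ) (Vc : Fin k → Finset V) (P : List V) (σ : Equiv.Perm (Fin k)) : Prop :=
  k ≤ P.length + 1 ∧ ∀ j : Fin k, (j : ℕ) ≠ 0 →
    ∀ v ∈ P[(P.length + (j : ℕ) - k)]?, v ∈ Vc (σ j)

/-- `Vc` are the classes of a complete `(k,k)`-graph in `H`: nonempty, pairwise disjoint,
and every transversal is an edge. -/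
def IsCompletePartite (k : ℕ) (E : Finset (Finset V)) (Vc : Fin k → Finset V) : Prop :=
  (∀ i, (Vc i).Nonempty) ∧ (∀ i j, i ≠ j → Disjoint (Vc i) (Vc j)) ∧
  ∀ g : Fin k → V, (∀ i, g i ∈ Vc i) → Finset.image g Finset.univ ∈ E

/-- the cyclic permutation `τ = (1 2 ⋯ k)` (0-indexed: `j ↦ j + 1 mod k`). -/
def cyc (k : ℕ) : Equiv.Perm (Fin k) := finRotate k

/-- `W` is a `G`-gadget for the complete `(k,k)`-graph with classes `Vc` avoiding `S`. -/
def IsGadget (k : ℕ) (E : Finset (Finset V)) (Vc : Fin k → Finset V)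
    (G : SimpleGraph (Fin k)) (S : Finset V) (W : Fin k → Fin k → Finset V) : Prop :=
  (∀ i j, G.Adj i j → W i j = W j i) ∧
  (∀ i j, G.Adj i j →
    (W i j).card = 2 * k - 1 ∧
    (W i j \ Finset.univ.biUnion Vc).card = 1 ∧
    Disjoint (W i j) S ∧
    (∀ i' : Fin k, (W i j ∩ Vc i').card = if i' = i ∨ i' = j then 1 else 2) ∧
    (∀ σ : Equiv.Perm (Fin k), (∃ z : Fin k, (z : ℕ) = 0 ∧ (σ z = i ∨ σ z = j)) →
      ∃ Q : List V, IsTightPath k E Q ∧ Q.toFinset = W i j ∧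
        hasStartType k Vc Q (σ * cyc k) ∧ hasEndType k Vc Q (Equiv.swap i j * σ))) ∧
  (∀ i j i' j', G.Adj i j → G.Adj i' j' → ({i, j} : Finset (Fin k)) ≠ {i', j'} →
    Disjoint (W i j) (W i' j'))

open Classical in
/-- the set of vertices `w_{ij}`, `ij ∈ E(G)`, of a gadget `W`. -/
noncomputable def gadgetVerts (k : ℕ) (Vc : Fin k → Finset V)
    (G : SimpleGraph (Fin k)) (W : Fin k → Fin k → Finset V) : Finset V :=
  (Finset.univ.filter fun p : Fin k × Fin k => G.Adj p.1 p.2).biUnion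
    fun p => W p.1 p.2 \ Finset.univ.biUnion Vc

/-- the graph on `[k]` consisting of the paths given by the lists in `L`. -/
def pathsGraph (k : ℕ) (L : List (List (Fin k))) : SimpleGraph (Fin k) :=
  SimpleGraph.fromEdgeSet {e | ∃ l ∈ L, ∃ p ∈ l.zip l.tail, e = s(p.1, p.2)}

/-- `G` is a vertex-disjoint union of paths. -/
def IsUnionOfPaths (k : ℕ) (G : SimpleGraph (Fin k)) : Prop :=
  ∃ L : List (List (Fin k)), (∀ l ∈ L, l.Nodup) ∧
    L.Pairwise (fun l₁ l₂ => ∀ a ∈ l₁, ∀ b ∈ l₂, a ≠ b) ∧ G = pathsGraph k L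

/-- `m(σ)` (1-indexed), read off from the normalized cycle decomposition `L` of `σ`:
the last element of the last cycle, or `1` if `L` is empty. -/
def mOf (k : ℕ) (L : List (List (Fin k))) : ℕ :=
  ((L.getLast?.bind List.getLast?).map (fun x => (x : ℕ) + 1)).getD 1

/-- `L` is the normalized cycle decomposition of `σ`: disjoint cycles of length ≥ 2,
each cycle listed ending with its minimal element, the cycles ordered by increasing
last elements. -/
def IsNormCycleDecomp (k : ℕ) (σ : Equiv.Perm (Fin k)) (L : List (List (Fin k))) : Prop :=
  (∀ l ∈ L, 2 ≤ l.length ∧ l.Nodup) ∧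
  L.Pairwise (fun l₁ l₂ => ∀ a ∈ l₁, ∀ b ∈ l₂, a ≠ b) ∧
  σ = (L.map List.formPerm).prod ∧
  (∀ l ∈ L, ∀ a ∈ l.getLast?, ∀ b ∈ l, a ≤ b) ∧
  L.Pairwise (fun l₁ l₂ => ∀ a ∈ l₁.getLast?, ∀ b ∈ l₂.getLast?, a < b)

/-- `H` is `(μ, θ)`-dense. -/
def IsDense (k : ℕ) (μ θ : ℝ) (E : Finset (Finset V)) : Prop :=
  ∃ 𝒮 : Finset (Finset V), (∀ S ∈ 𝒮, S.card = k - 1) ∧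
    (𝒮.card : ℝ) ≤ θ * ((Fintype.card V).choose (k - 1)) ∧
    ∀ S : Finset V, S.card = k - 1 → S ∉ 𝒮 →
      μ * ((Fintype.card V : ℝ) - k + 1) ≤ (degS E S : ℝ)

/-- `H` is strongly `(μ, θ)`-dense. -/
def IsStronglyDense (k : ℕ) (μ θ : ℝ) (E : Finset (Finset V)) : Prop :=
  IsDense k μ θ E ∧ ∀ e ∈ E, ∀ X ⊆ e, X.card = k - 1 →
    μ * ((Fintype.card V : ℝ) - k + 1) ≤ (degS E X : ℝ)

/-- the vertex set of `F(K,G)` inside the ambient type: all core vertices, plus one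
pendant vertex for each edge of `G`. -/
def FsVertexSet (k : ℕ) (a : Fin k → ℕ) (G : SimpleGraph (Fin k)) :
    Set ((Σ i : Fin k, Fin (a i)) ⊕ Sym2 (Fin k)) :=
  Set.range Sum.inl ∪ Sum.inr '' G.edgeSet

/-- the edges of `F(K,G)`, where `K = K^k(a)`: all transversals of the classes, plus,
for each edge `ij` of `G`, all `k`-sets consisting of the pendant vertex `w_{ij}` and one
vertex from each class other than `i` (resp. other than `j`). -/
def FKGedges (k : ℕ) (a : Fin k → ℕ) (G : SimpleGraph (Fin k)) :
    Set (Finset ((Σ i : Fin k, Fin (a i)) ⊕ Sym2 (Fin k))) :=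
  {e | (∃ g : ∀ i, Fin (a i), e = Finset.univ.image fun i => Sum.inl ⟨i, g i⟩) ∨
    (∃ i j, G.Adj i j ∧ ∃ g : ∀ i', Fin (a i'),
      e = insert (Sum.inr s(i, j)) ((Finset.univ.erase i).image fun i' => Sum.inl ⟨i', g i'⟩))}

/-- `F(K^k(a), G)` contains a spanning copy of the tight cycle `C_s^k`. -/
def FsHasSpanningCs (k s : ℕ) (a : Fin k → ℕ) (G : SimpleGraph (Fin k)) : Prop :=
  ∃ C : List ((Σ i : Fin k, Fin (a i)) ⊕ Sym2 (Fin k)),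
    C.Nodup ∧ C.length = s ∧ (↑C.toFinset : Set _) = FsVertexSet k a G ∧
    ∀ i < C.length, (((C ++ C).drop i).take k).toFinset ∈ FKGedges k a G

/-- `A` is the vertex set of a copy of `K^k(t)` in `H`. -/
def SpansEsCopy (k t : ℕ) (E : Finset (Finset V)) (A : Finset V) : Prop :=
  ∃ f : Fin k × Fin t → V, Function.Injective f ∧ Finset.univ.image f = A ∧
    ∀ g : Fin k → Fin t, (Finset.univ.image fun i => f (i, g i)) ∈ E

/-- `A` is the vertex set of a copy of `F_s = F(K^k(a), G)` in `H`. -/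
def SpansFsCopy (k : ℕ) (a : Fin k → ℕ) (G : SimpleGraph (Fin k))
    (E : Finset (Finset V)) (A : Finset V) : Prop :=
  ∃ f : ((Σ i : Fin k, Fin (a i)) ⊕ Sym2 (Fin k)) → V,
    Set.InjOn f (FsVertexSet k a G) ∧ f '' FsVertexSet k a G = ↑A ∧
    ∀ e ∈ FKGedges k a G, e.image f ∈ E

/-- `(TF, TE)` is an `{F_s, E_s}`-tiling of `H`, given as the families of vertex sets of
the copies of `F_s` and of `E_s = K^k(max_i a_i)`. -/
def IsFETiling (k : ℕ) (a : Fin k → ℕ) (G : SimpleGraph (Fin k))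
    (E : Finset (Finset V)) (TF TE : Finset (Finset V)) : Prop :=
  ((↑(TF ∪ TE) : Set (Finset V)).PairwiseDisjoint id) ∧
  (∀ A ∈ TF, SpansFsCopy k a G E A) ∧
  (∀ A ∈ TE, SpansEsCopy k (Finset.univ.sup a) E A)

/-- `φ(𝒯) = (n - s(|ℱ_𝒯| + (3/5)|ℰ_𝒯|))/n`. -/
noncomputable def phiTiling (s : ℕ) (TF TE : Finset (Finset V)) : ℝ :=
  ((Fintype.card V : ℝ) - s * ((TF.card : ℝ) + (3 / 5) * (TE.card : ℝ))) / (Fintype.card V : ℝ)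

/-- `φ(H)`: the minimum of `φ(𝒯)` over all `{F_s, E_s}`-tilings of `H`. -/
noncomputable def phiMin (k s : ℕ) (a : Fin k → ℕ) (G : SimpleGraph (Fin k))
    (E : Finset (Finset V)) : ℝ :=
  sInf {x | ∃ TF TE : Finset (Finset V), IsFETiling k a G E TF TE ∧ x = phiTiling s TF TE}

/-- `Φ(n, μ, θ)`: the maximum of `φ(H)` over all `(μ,θ)`-dense `k`-graphs `H` on `n` vertices. -/
noncomputable def PhiMax (k s : ℕ) (a : Fin k → ℕ) (G : SimpleGraph (Fin k))
    (n : ℕ) (μ θ : ℝ) : ℝ :=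
  sSup {x | ∃ E : Finset (Finset (Fin n)), IsKGraph k E ∧ IsDense k μ θ E ∧
    x = phiMin k s a G E}

end Defs

theorem exists_two_chains {ι : Type*} (r : ι → ι → Prop) (hsymm : ∀ a b, r a b → r b a)
    (htri : ∀ a b c, a ≠ b → b ≠ c → a ≠ c → r a b ∨ r b c ∨ r a c) :
    ∀ l : List ι, l.Nodup → ∃ p q : List ι, p.IsChain r ∧ q.IsChain r ∧ (p ++ q).Perm l := by
  intro l
  induction l with
  | nil => intro _; exact ⟨[], [], by simp, by simp, by simp⟩
  | cons x l ih =>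
    intro hl
    obtain ⟨hx, hl⟩ := List.nodup_cons.1 hl
    obtain ⟨p, q, hp, hq, hpq⟩ := ih hl
    have hxpq : x ∉ p ++ q := fun h => hx (hpq.subset h)
    have hnd : (p ++ q).Nodup := hpq.nodup_iff.2 hl
    cases p with
    | nil => exact ⟨[x], q, by simp, hq, by simpa using hpq⟩
    | cons a p =>
      cases q with
      | nil => exact ⟨[x], a :: p, by simp, hp, by simpa using hpq⟩
      | cons b q =>
        have hab : a ≠ b := by
          rintro rfl
          simp at hnd
        have hxa : x ≠ a := by rintro rfl; simp at hxpq
        have hxb : x ≠ b := by rintro rfl; simp at hxpq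
        by_cases h1 : r x a
        · exact ⟨x :: a :: p, b :: q, by simp [h1, hp], hq, by simpa using hpq⟩
        by_cases h2 : r x b
        · refine ⟨a :: p, x :: b :: q, hp, by simp [h2, hq], ?_⟩
          exact List.perm_middle.trans (by simpa using hpq)
        have h3 : r a b := by
          rcases htri x a b hxa hab hxb with h | h | h <;> tauto
        refine ⟨[x], (a :: p).reverse ++ (b :: q), by simp, ?_, ?_⟩
        · refine List.IsChain.append ?_ hq ?_
          · rw [List.isChain_reverse]
            exact hp.imp fun u v h => hsymm _ _ h
          · intro u hu v hv
            simp at hu hv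
            subst hu; subst hv; exact h3
        · simp only [List.singleton_append, List.perm_cons]
          exact ((List.reverse_perm _).append_right _).trans hpq

theorem exists_ordering (k : ℕ) (r : Fin k → Fin k → Prop) (hsymm : ∀ a b, r a b → r b a)
    (htri : ∀ a b c, a ≠ b → b ≠ c → a ≠ c → r a b ∨ r b c ∨ r a c) :
    ∃ (u : Equiv.Perm (Fin k)) (i₀ : ℕ), ∀ (i : ℕ) (h : i + 1 < k), i ≠ i₀ →
      r (u ⟨i, by omega⟩) (u ⟨i + 1, h⟩) := by
  obtain ⟨p, q, hp, hq, hpq⟩ := exists_two_chains r hsymm htri (List.finRange k)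
    (List.nodup_finRange k)
  have hlen : (p ++ q).length = k := by simpa using hpq.length_eq
  have hnd : (p ++ q).Nodup := hpq.nodup_iff.2 (List.nodup_finRange k)
  let f : Fin k → Fin k := fun i => (p ++ q)[(i : ℕ)]'(by omega)
  have hf : Function.Injective f := by
    intro i j hij
    exact Fin.ext ((hnd.getElem_inj_iff).1 hij)
  refine ⟨Equiv.ofBijective f (Finite.injective_iff_bijective.1 hf), p.length - 1, ?_⟩
  intro i h hi
  simp only [Equiv.ofBijective_apply, f]
  rw [List.isChain_iff_getElem] at hp hq
  rw [List.length_append] at hlen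
  by_cases h1 : i + 1 < p.length
  · rw [List.getElem_append_left (by omega), List.getElem_append_left h1]
    exact hp i h1
  · have h2 : p.length ≤ i := by omega
    rw [List.getElem_append_right h2, List.getElem_append_right (by omega)]
    have := hq (i - p.length) (by omega)
    convert this using 2
    omega

section Walk
variable {W : Type} [DecidableEq W]

/-- Two consecutive rounds of a walk in `k` slots: every set obtained by replacing an initial
segment of the first round by the one of the second is an edge. -/
def RoundCompat (k : ℕ) (R : Finset (Finset W)) (π π' : Fin k → W) : Prop :=
  ∀ p : ℕ, (univ.image fun q : Fin k => if (q : ℕ) < p then π' q else π q) ∈ R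

theorem image_comp_perm {k : ℕ} (v : Fin k → W) (σ : Equiv.Perm (Fin k)) :
    univ.image (fun q => v (σ q)) = univ.image v := by
  ext x
  simp only [mem_image, mem_univ, true_and]
  constructor
  · rintro ⟨q, rfl⟩; exact ⟨_, rfl⟩
  · rintro ⟨q, rfl⟩; exact ⟨σ.symm q, by simp⟩

theorem image_update {k : ℕ} (v : Fin k → W) (hv : Function.Injective v)
    (σ : Equiv.Perm (Fin k)) (p : Fin k) (w : W) :
    univ.image (Function.update (fun q => v (σ q)) p w) =
      insert w ((univ.image v).erase (v (σ p))) := by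
  ext x
  simp only [mem_image, mem_univ, true_and, mem_insert, mem_erase]
  constructor
  · rintro ⟨q, rfl⟩
    by_cases h : q = p
    · subst h; simp
    · right
      rw [Function.update_of_ne h]
      exact ⟨fun h' => h (σ.injective (hv h')), _, rfl⟩
  · rintro (rfl | ⟨h, q, rfl⟩)
    · exact ⟨p, by simp⟩
    · refine ⟨σ.symm q, ?_⟩
      rw [Function.update_of_ne]
      · simp
      · rintro rfl; simp at h

theorem roundCompat_self {k : ℕ} {R : Finset (Finset W)} (v : Fin k → W)
    (he : univ.image v ∈ R) (σ : Equiv.Perm (Fin k)) :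
    RoundCompat k R (fun q => v (σ q)) (fun q => v (σ q)) := by
  intro p
  simpa [image_comp_perm] using he

theorem exists_gadget_round {k : ℕ} {R : Finset (Finset W)} (v : Fin k → W)
    (hv : Function.Injective v) (he : univ.image v ∈ R) (σ : Equiv.Perm (Fin k))
    (i j : Fin k) (hij : i ≠ j) (w : W)
    (hi : insert w ((univ.image v).erase (v i)) ∈ R)
    (hj : insert w ((univ.image v).erase (v j)) ∈ R) :
    ∃ g : Fin k → W, RoundCompat k R (fun q => v (σ q)) g ∧
      RoundCompat k R g (fun q => v ((Equiv.swap i j * σ) q)) ∧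
      ∀ y : W → ℝ, (∀ x, 0 ≤ y x) → ∑ q, y (g q) ≤ y w + ∑ q, y (v q) := by
  wlog hlt : σ.symm i < σ.symm j generalizing i j
  · have hne : σ.symm j ≠ σ.symm i := fun h => hij (σ.symm.injective h).symm
    have := this j i hij.symm hj hi (lt_of_le_of_ne (not_lt.1 hlt) hne)
    rwa [Equiv.swap_comm] at this
  set pi := σ.symm i with hpi
  set pj := σ.symm j with hpj
  have hσi : σ pi = i := by simp [hpi]
  have hσj : σ pj = j := by simp [hpj]
  set σ' := Equiv.swap i j * σ with hσ'
  have hσ'i : σ' pi = j := by simp [hσ', hσi]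
  have hσ'j : σ' pj = i := by simp [hσ', hσj]
  have hσ'o : ∀ q, q ≠ pi → q ≠ pj → σ' q = σ q := by
    intro q h1 h2
    simp only [hσ', Equiv.Perm.mul_apply]
    apply Equiv.swap_apply_of_ne_of_ne
    · rintro h; exact h1 (by rw [hpi, ← h]; simp)
    · rintro h; exact h2 (by rw [hpj, ← h]; simp)
  have hlt' : (pi : ℕ) < pj := hlt
  refine ⟨Function.update (fun q => v (σ' q)) pi w, ?_, ?_, ?_⟩
  · intro p
    by_cases h1 : p ≤ pi
    · convert he using 1
      rw [← image_comp_perm v σ]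
      congr 1
      funext q
      split_ifs with h
      · have hq1 : q ≠ pi := by rintro rfl; omega
        have hq2 : q ≠ pj := by rintro rfl; omega
        rw [Function.update_of_ne hq1, hσ'o q hq1 hq2]
      · rfl
    · by_cases h2 : p ≤ pj
      · convert hi using 1
        rw [← hσi, ← image_update v hv σ pi w]
        congr 1
        funext q
        by_cases hq1 : q = pi
        · subst hq1; simp; omega
        · rw [Function.update_of_ne hq1, Function.update_of_ne hq1]
          split_ifs with h
          · have hq2 : q ≠ pj := by rintro rfl; omega
            rw [hσ'o q hq1 hq2]
          · rfl
      · convert hj using 1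
        rw [← hσ'i, ← image_update v hv σ' pi w]
        congr 1
        funext q
        split_ifs with h
        · rfl
        · have hq1 : q ≠ pi := by rintro rfl; omega
          have hq2 : q ≠ pj := by rintro rfl; omega
          rw [Function.update_of_ne hq1, hσ'o q hq1 hq2]
  · intro p
    by_cases h1 : p ≤ pi
    · convert hj using 1
      rw [← hσ'i, ← image_update v hv σ' pi w]
      congr 1
      funext q
      split_ifs with h
      · have hq1 : q ≠ pi := by rintro rfl; omega
        rw [Function.update_of_ne hq1]
      · rfl
    · convert he using 1
      rw [← image_comp_perm v σ']
      congr 1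
      funext q
      split_ifs with h
      · rfl
      · have hq1 : q ≠ pi := by rintro rfl; omega
        rw [Function.update_of_ne hq1]
  · intro y hy
    have : ∑ q, y (v q) = ∑ q, y (v (σ' q)) := (Equiv.sum_comp σ' fun q => y (v q)).symm
    rw [this, ← Finset.add_sum_erase _ _ (mem_univ pi), ← Finset.add_sum_erase univ
      (fun q => y (v (σ' q))) (mem_univ pi)]
    have h2 : ∑ q ∈ univ.erase pi, y (Function.update (fun q => v (σ' q)) pi w q)
        = ∑ q ∈ univ.erase pi, y (v (σ' q)) := by
      apply sum_congr rfl
      intro q hq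
      rw [Function.update_of_ne (ne_of_mem_erase hq)]
    rw [h2]
    simp only [Function.update_self]
    have := hy (v (σ' pi))
    linarith

end Walk

/-- The transposition of `l` and `l + 1`, or the identity at the boundary of a segment of
length `h`. -/
def stepPerm (k h l : ℕ) : Equiv.Perm (Fin k) :=
  if hl : l + 1 < k ∧ ¬ h ∣ l + 1 then Equiv.swap ⟨l, by omega⟩ ⟨l + 1, hl.1⟩ else 1

/-- The composition of the first `l` step permutations. -/
def stepProd (k h : ℕ) : ℕ → Equiv.Perm (Fin k)
  | 0 => 1
  | l + 1 => stepPerm k h l * stepProd k h l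

theorem stepPerm_val (k h l : ℕ) (hl : l + 1 < k) (e : Fin k) :
    ((stepPerm k h l e : Fin k) : ℕ) =
      if h ∣ l + 1 then (e : ℕ) else if (e : ℕ) = l then l + 1 else
        if (e : ℕ) = l + 1 then l else e := by
  unfold stepPerm
  by_cases hd : h ∣ l + 1
  · simp [hd]
  · simp only [hl, hd, not_false_eq_true, and_self, dite_true, if_false, Equiv.swap_apply_def,
      Fin.ext_iff]
    split_ifs <;> rfl

theorem stepProd_val (k h : ℕ) (hh : 0 < h) (l : ℕ) (hl : l < k) (e : Fin k) :
    ((stepProd k h l e : Fin k) : ℕ) =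
      if l < e then (e : ℕ) else if h ∣ e then min l (e + h - 1) else e - 1 := by
  induction l with
  | zero =>
    simp only [stepProd, Equiv.Perm.one_apply]
    split_ifs with h1 h2
    · rfl
    · simp; omega
    · omega
  | succ l ih =>
    have ih := ih (by omega)
    simp only [stepProd, Equiv.Perm.mul_apply]
    rw [stepPerm_val k h l hl, ih]
    by_cases h1 : l + 1 < (e : ℕ)
    · have h2 : l < (e : ℕ) := by omega
      simp only [h1, h2, if_true]
      split_ifs <;> omega
    · by_cases h2 : (e : ℕ) = l + 1
      · simp only [h2, lt_add_iff_pos_right, zero_lt_one, if_true, lt_irrefl, if_false]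
        split_ifs <;> omega
      · have h3 : ¬ l < (e : ℕ) := by omega
        simp only [h1, h3, if_false]
        by_cases h4 : h ∣ (e : ℕ)
        · simp only [h4, if_true]
          obtain ⟨c, hc⟩ := h4
          by_cases h5 : l < e + h - 1
          · have h6 : ¬ h ∣ l + 1 := by
              rintro ⟨d, hd⟩
              have h7 : h * c < h * d := by omega
              have h8 : h * d < h * (c + 1) := by rw [mul_add, mul_one]; omega
              have := Nat.lt_of_mul_lt_mul_left h7
              have := Nat.lt_of_mul_lt_mul_left h8
              omega
            simp only [h6, if_false]
            split_ifs <;> omega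
          · by_cases h9 : l = e + h - 1
            · have : h ∣ l + 1 := ⟨c + 1, by rw [mul_add, mul_one]; omega⟩
              simp only [this, if_true]
              omega
            · split_ifs <;> omega
        · have h5 : (e : ℕ) ≠ 0 := fun h0 => h4 (h0 ▸ dvd_zero h)
          simp only [h4, if_false]
          split_ifs <;> omega

/-- There is a bijection `f` from indices to slots such that the step permutations turn the
arrangement given by `f` into its rotation by `r`. -/
theorem exists_rotation_arrangement (k r : ℕ) (hk : 0 < k) :
    ∃ f : Equiv.Perm (Fin k), ∀ i : Fin k,
      stepProd k (k / k.gcd r) (k - 1) (f.symm ⟨((f i : ℕ) + r) % k, Nat.mod_lt _ hk⟩) = i := by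
  set g := k.gcd r with hg
  set h := k / g with hh
  have hgpos : 0 < g := Nat.gcd_pos_of_pos_left _ hk
  have hgk : g * h = k := Nat.mul_div_cancel' (Nat.gcd_dvd_left k r)
  have hhpos : 0 < h := Nat.pos_of_mul_pos_left (by rw [hgk]; exact hk)
  have hhr : k ∣ h * r := by
    obtain ⟨r', hr'⟩ := Nat.gcd_dvd_right k r
    refine ⟨r', ?_⟩
    rw [← hg] at hr'
    rw [hr', ← hgk]; ring
  let F : Fin k → Fin k := fun i => ⟨((i : ℕ) / h + ((i : ℕ) % h) * r) % k, Nat.mod_lt _ hk⟩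
  have hF : Function.Injective F := by
    intro i j hij
    have h1 : (i : ℕ) / h + ((i : ℕ) % h) * r ≡ (j : ℕ) / h + ((j : ℕ) % h) * r [MOD k] := by
      exact Fin.ext_iff.1 hij
    have hlt : ∀ i : Fin k, (i : ℕ) / h < g := by
      intro i
      rw [Nat.div_lt_iff_lt_mul hhpos, hgk]; exact i.2
    have h2 : (i : ℕ) / h = (j : ℕ) / h := by
      have h3 := h1.of_dvd (Nat.gcd_dvd_left k r)
      have h4 : ∀ a b : ℕ, a + b * r ≡ a [MOD g] := by
        intro a b
        have : b * r ≡ 0 [MOD g] :=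
          (Nat.modEq_zero_iff_dvd).2 (Dvd.dvd.mul_left (Nat.gcd_dvd_right k r) b)
        simpa using (Nat.ModEq.refl a).add this
      exact (((h4 _ _).symm.trans h3).trans (h4 _ _)).eq_of_lt_of_lt (hlt i) (hlt j)
    have h5 : (i : ℕ) % h = (j : ℕ) % h := by
      rw [h2] at h1
      have h3 := Nat.ModEq.add_left_cancel' _ h1
      have h4 := Nat.ModEq.cancel_right_div_gcd hk h3
      exact h4.eq_of_lt_of_lt (Nat.mod_lt _ hhpos) (Nat.mod_lt _ hhpos)
    apply Fin.ext
    rw [← Nat.div_add_mod (i : ℕ) h, h2, h5, Nat.div_add_mod]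
  let f := Equiv.ofBijective F (Finite.injective_iff_bijective.1 hF)
  have hf : ∀ i, f i = F i := fun i => rfl
  refine ⟨f, fun i => ?_⟩
  have hgoal : ∀ e : Fin k, F e = ⟨((f i : ℕ) + r) % k, Nat.mod_lt _ hk⟩ →
      stepProd k h (k - 1) e = i →
      stepProd k h (k - 1) (f.symm ⟨((f i : ℕ) + r) % k, Nat.mod_lt _ hk⟩) = i := by
    intro e h1 h2
    rw [← h1, ← hf e, Equiv.symm_apply_apply, h2]
  have hi := i.2
  have hdm := Nat.div_add_mod (i : ℕ) h
  have hml := Nat.mod_lt (i : ℕ) hhpos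
  by_cases hd : h ∣ (i : ℕ) + 1
  · obtain ⟨c, hc⟩ := hd
    have hcpos : 0 < c := by
      rcases Nat.eq_zero_or_pos c with h0 | h0
      · subst h0; omega
      · exact h0
    obtain ⟨c, rfl⟩ : ∃ c', c = c' + 1 := ⟨c - 1, by omega⟩
    rw [mul_add, mul_one] at hc
    have hdiv : (i : ℕ) / h = c := by
      rw [Nat.div_eq_iff hhpos]
      constructor
      · rw [mul_comm]; omega
      · rw [mul_comm]; omega
    have hmod : (i : ℕ) % h = h - 1 := by
      rw [hdiv] at hdm; omega
    refine hgoal ⟨h * c, by omega⟩ ?_ ?_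
    · apply Fin.ext
      simp only [hf, F, hdiv, hmod, Nat.mul_div_cancel_left c hhpos, Nat.mul_mod_right, zero_mul,
        add_zero, Nat.mod_add_mod]
      obtain ⟨h', hh'⟩ : ∃ h', h = h' + 1 := ⟨h - 1, by omega⟩
      have h6 : c + (h - 1) * r + r = c + h * r := by rw [hh']; simp; ring
      rw [h6]
      obtain ⟨d, hd⟩ := hhr
      rw [hd, Nat.add_mul_mod_self_left]
    · apply Fin.ext
      rw [stepProd_val k h hhpos _ (by omega)]
      simp only [dvd_mul_right, if_true]
      split_ifs <;> omega
  · have h1 : (i : ℕ) % h + 1 < h := by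
      by_contra hcon
      apply hd
      refine ⟨(i : ℕ) / h + 1, ?_⟩
      rw [mul_add, mul_one]; omega
    have hlt : (i : ℕ) + 1 < k := by
      have : (i : ℕ) + 1 ≠ k := by
        intro h2; apply hd; rw [h2, ← hgk]; exact dvd_mul_left _ _
      omega
    have hdiv : ((i : ℕ) + 1) / h = (i : ℕ) / h := by
      rw [Nat.div_eq_iff hhpos]
      constructor
      · rw [mul_comm]; omega
      · rw [mul_comm]; omega
    have hmod : ((i : ℕ) + 1) % h = (i : ℕ) % h + 1 := by
      have h3 := Nat.div_add_mod ((i : ℕ) + 1) h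
      rw [hdiv] at h3; omega
    refine hgoal ⟨i + 1, hlt⟩ ?_ ?_
    · apply Fin.ext
      simp only [hf, F, hdiv, hmod, Nat.mod_add_mod]
      congr 1; ring
    · apply Fin.ext
      rw [stepProd_val k h hhpos _ (by omega)]
      simp only [hd, if_false]
      split_ifs <;> omega

section Walk
variable {W : Type} [DecidableEq W]

theorem window_mem_of_roundCompat {k : ℕ} (hk : 0 < k) {R : Finset (Finset W)}
    (π : ℕ → Fin k → W) (hπ : ∀ n, RoundCompat k R (π n) (π (n + 1))) (i : ℕ) :
    ((range k).image fun q => π ((i + q) / k) ⟨(i + q) % k, Nat.mod_lt _ hk⟩) ∈ R := by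
  convert hπ (i / k) (i % k) using 1
  have hdm := Nat.div_add_mod i k
  have hml := Nat.mod_lt i hk
  have key1 : ∀ q, i % k + q < k → (i + q) / k = i / k ∧ (i + q) % k = i % k + q := by
    intro q hq
    have : i + q = (i % k + q) + k * (i / k) := by omega
    rw [this, Nat.add_mul_div_left _ _ hk, Nat.add_mul_mod_self_left, Nat.div_eq_of_lt hq,
      Nat.mod_eq_of_lt hq]
    simp
  have key2 : ∀ q, q < k → k ≤ i % k + q →
      (i + q) / k = i / k + 1 ∧ (i + q) % k = i % k + q - k := by
    intro q hq hq'
    have : i + q = (i % k + q - k) + k * (i / k + 1) := by rw [mul_add]; omega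
    have hlt : i % k + q - k < k := by omega
    rw [this, Nat.add_mul_div_left _ _ hk, Nat.add_mul_mod_self_left, Nat.div_eq_of_lt hlt,
      Nat.mod_eq_of_lt hlt]
    simp
  ext x
  simp only [mem_image, mem_range, mem_univ, true_and]
  constructor
  · rintro ⟨q, hq, rfl⟩
    by_cases h : i % k + q < k
    · obtain ⟨h1, h2⟩ := key1 q h
      refine ⟨⟨i % k + q, h⟩, ?_⟩
      simp [h1, h2]
    · obtain ⟨h1, h2⟩ := key2 q hq (by omega)
      refine ⟨⟨i % k + q - k, by omega⟩, ?_⟩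
      have : i % k + q - k < i % k := by omega
      simp [h1, h2, this]
  · rintro ⟨q, rfl⟩
    by_cases h : (q : ℕ) < i % k
    · refine ⟨q + k - i % k, by omega, ?_⟩
      obtain ⟨h1, h2⟩ := key2 (q + k - i % k) (by omega) (by omega)
      simp only [h, if_true, h1]
      congr 1
      apply Fin.ext
      simp only [h2]; omega
    · have hq := q.2
      refine ⟨q - i % k, by omega, ?_⟩
      obtain ⟨h1, h2⟩ := key1 (q - i % k) (by omega)
      simp only [h, if_false, h1]
      congr 1
      apply Fin.ext
      simp only [h2]; omega

theorem sum_rounds {k : ℕ} (hk : 0 < k) (F : ℕ → Fin k → ℝ) (N : ℕ) :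
    ∑ i ∈ range (k * N), F (i / k) ⟨i % k, Nat.mod_lt _ hk⟩ = ∑ n ∈ range N, ∑ q, F n q := by
  induction N with
  | zero => simp
  | succ N ih =>
    rw [mul_add, mul_one, sum_range_add, ih, sum_range_succ]
    congr 1
    rw [Finset.sum_range]
    apply sum_congr rfl
    intro q _
    have h1 : (k * N + q) / k = N := by
      rw [add_comm, Nat.add_mul_div_left _ _ hk, Nat.div_eq_of_lt q.2, zero_add]
    have h2 : (k * N + q) % k = q := by
      rw [add_comm, Nat.add_mul_mod_self_left, Nat.mod_eq_of_lt q.2]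
    simp [h1, h2]

/-- A walk of length `Q * k + r` that closes up, uses the edge `v` in all but `k - 1` rounds, and
uses each of the pivots `w l` in at most one round. -/
theorem exists_walk_through_pivots {k : ℕ} (hk : 0 < k) {R : Finset (Finset W)}
    (v : Fin k → W) (hv : Function.Injective v) (he : univ.image v ∈ R) (w : ℕ → W)
    (hw : ∀ (l : ℕ) (hl : l + 1 < k),
      insert (w l) ((univ.image v).erase (v ⟨l, by omega⟩)) ∈ R ∧
      insert (w l) ((univ.image v).erase (v ⟨l + 1, hl⟩)) ∈ R)
    (r Q : ℕ) (hQ : 2 * k ≤ Q) :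
    ∃ a : ℕ → W, (∀ i, ((range k).image fun q => a (i + q)) ∈ R) ∧
      (∀ p < k, a (k * Q + r + p) = a p) ∧
      ∀ y : W → ℝ, (∀ x, 0 ≤ y x) → ∑ i ∈ range (k * (Q + 1)), y (a i) ≤
        (Q + 1) * ∑ q, y (v q) + ∑ l ∈ range (k - 1), y (w l) := by
  obtain ⟨f, hf⟩ := exists_rotation_arrangement k r hk
  set h := k / k.gcd r
  let A : ℕ → Equiv.Perm (Fin k) := fun l => stepProd k h (min l (k - 1)) * f.symm
  have hg : ∀ l : ℕ, ∃ g : Fin k → W, RoundCompat k R (fun q => v (A l q)) g ∧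
      RoundCompat k R g (fun q => v (A (l + 1) q)) ∧
      (∀ y : W → ℝ, (∀ x, 0 ≤ y x) → ∑ q, y (g q) ≤
        (if l < k - 1 then y (w l) else 0) + ∑ q, y (v q)) ∧
      (k ≤ l + 1 → g = fun q => v (A l q)) := by
    intro l
    have htriv : A (l + 1) = A l → ∃ g : Fin k → W, RoundCompat k R (fun q => v (A l q)) g ∧
      RoundCompat k R g (fun q => v (A (l + 1) q)) ∧
      (∀ y : W → ℝ, (∀ x, 0 ≤ y x) → ∑ q, y (g q) ≤
        (if l < k - 1 then y (w l) else 0) + ∑ q, y (v q)) ∧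
      (k ≤ l + 1 → g = fun q => v (A l q)) := by
      intro hA
      refine ⟨fun q => v (A l q), roundCompat_self v he _, hA ▸ roundCompat_self v he _, ?_, fun _ => rfl⟩
      intro y hy
      rw [Equiv.sum_comp (A l) fun q => y (v q)]
      have : 0 ≤ (if l < k - 1 then y (w l) else 0) := by
        split_ifs
        · exact hy _
        · exact le_rfl
      linarith
    by_cases hl : l + 1 < k
    · have h1 : min l (k - 1) = l := by omega
      have h2 : min (l + 1) (k - 1) = l + 1 := by omega
      have hA : A (l + 1) = stepPerm k h l * A l := by
        simp only [A, h1, h2, stepProd, mul_assoc]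
      by_cases hd : h ∣ l + 1
      · exact htriv (by rw [hA]; simp [stepPerm, hd])
      · have hs : stepPerm k h l = Equiv.swap ⟨l, by omega⟩ ⟨l + 1, hl⟩ := by
          simp [stepPerm, hd, hl]
        obtain ⟨g, hg1, hg2, hg3⟩ :=
          exists_gadget_round v hv he (A l) _ _ (by simp) (w l) (hw l hl).1 (hw l hl).2
        rw [hA, hs]
        refine ⟨g, hg1, hg2, fun y hy => ?_, by omega⟩
        simpa [(by omega : l < k - 1)] using hg3 y hy
    · apply htriv
      simp only [A]
      congr 2
      omega
  choose g hg1 hg2 hg3 hg4 using hg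
  let π : ℕ → Fin k → W := fun n => if n % 2 = 0 then fun q => v (A (n / 2) q) else g (n / 2)
  have hπ : ∀ n, RoundCompat k R (π n) (π (n + 1)) := by
    intro n
    rcases Nat.even_or_odd' n with ⟨c, rfl | rfl⟩
    · have h1 : (2 * c + 1) / 2 = c := by omega
      have h2 : (2 * c + 1) % 2 = 1 := by omega
      simpa [π, h1, h2] using hg1 c
    · have h1 : (2 * c + 1) / 2 = c := by omega
      have h2 : (2 * c + 1) % 2 = 1 := by omega
      have h3 : (2 * c + 1 + 1) / 2 = c + 1 := by omega
      have h4 : (2 * c + 1 + 1) % 2 = 0 := by omega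
      simpa [π, h1, h2, h3, h4] using hg2 c
  have hsum : ∀ n, ∀ y : W → ℝ, (∀ x, 0 ≤ y x) → ∑ q, y (π n q) ≤
      ∑ q, y (v q) + if n % 2 = 1 ∧ n / 2 < k - 1 then y (w (n / 2)) else 0 := by
    intro n y hy
    rcases Nat.mod_two_eq_zero_or_one n with h0 | h0
    · simp only [π, h0, if_true]
      rw [Equiv.sum_comp (A (n / 2)) fun q => y (v q)]
      simp
    · have := hg3 (n / 2) y hy
      simp only [π, h0, one_ne_zero, if_false, true_and]
      linarith
  refine ⟨fun i => π (i / k) ⟨i % k, Nat.mod_lt _ hk⟩, ?_, ?_, ?_⟩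
  · exact window_mem_of_roundCompat hk π hπ
  · have hA : ∀ n, Q ≤ n → A (n / 2) = stepProd k h (k - 1) * f.symm := by
      intro n hn
      have : min (n / 2) (k - 1) = k - 1 := by omega
      simp only [A, this]
    have hend : ∀ n, Q ≤ n → π n = fun p => v (stepProd k h (k - 1) (f.symm p)) := by
      intro n hn
      have h1 := hg4 (n / 2) (by omega)
      have h2 := hA n hn
      simp only [π, h1, ite_self, h2, Equiv.Perm.mul_apply]
    intro p hp
    have h1 : Q ≤ (k * Q + r + p) / k := by
      rw [Nat.le_div_iff_mul_le hk, mul_comm]; omega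
    simp only [hend _ h1, Nat.div_eq_of_lt hp]
    have h2 := hf (f.symm ⟨p, hp⟩)
    simp only [Equiv.apply_symm_apply] at h2
    have h3 : (k * Q + r + p) % k = (p + r) % k := by
      rw [add_assoc, Nat.mul_add_mod, add_comm]
    simp only [h3, h2, π, Nat.mod_eq_of_lt hp, Nat.zero_mod, if_true, A, Nat.zero_div,
      Nat.zero_min, stepProd, one_mul]
  · intro y hy
    rw [sum_rounds hk (fun n q => y (π n q))]
    have h1 := sum_le_sum fun n (_ : n ∈ range (Q + 1)) => hsum n y hy
    refine h1.trans ?_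
    rw [sum_add_distrib, sum_const, card_range, nsmul_eq_mul]
    push_cast
    refine add_le_add le_rfl ?_
    rw [← sum_filter]
    have h2 : ((range (Q + 1)).filter fun n => n % 2 = 1 ∧ n / 2 < k - 1) ⊆
        (range (k - 1)).image fun l => 2 * l + 1 := by
      intro n hn
      simp only [mem_filter, mem_image, mem_range] at hn ⊢
      exact ⟨n / 2, hn.2.2, by omega⟩
    refine (sum_le_sum_of_subset_of_nonneg h2 fun n _ _ => hy _).trans ?_
    rw [sum_image fun a _ b _ hab => by simpa using hab]
    apply le_of_eq
    apply sum_congr rfl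
    intro l _
    congr 2; omega

end Walk

section LightWalk
variable {W : Type} [Fintype W] [DecidableEq W]

/-- `a` is a closed tight walk of length `s`: every `k` cyclically consecutive vertices form an
edge. -/
def IsClosedWalk (k s : ℕ) (hs : 0 < s) (R : Finset (Finset W)) (a : Fin s → W) : Prop :=
  ∀ i < s, ((range k).image fun q => a ⟨(i + q) % s, Nat.mod_lt _ hs⟩) ∈ R

theorem exists_light_transversal {ι : Type} [DecidableEq ι] (blk : W → ι) (s : ℕ)
    (hfib : ∀ j, (univ.filter fun v => blk v = j).card ≤ s) (x : W → ℝ) (n : ℕ)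
    (hn : s * n < Fintype.card W) :
    ∃ (L : Finset W) (c : ℝ), L.card = n + 1 ∧ Set.InjOn blk L ∧ (∀ v ∈ L, x v ≤ c) ∧
      (∃ v, c = x v) ∧ (univ.filter fun v => x v < c).card ≤ s * n := by
  induction n with
  | zero =>
    have : Nonempty W := Fintype.card_pos_iff.1 (by omega)
    obtain ⟨v, hv⟩ := Finite.exists_min x
    refine ⟨{v}, x v, by simp, by simp, by simp, ⟨v, rfl⟩, ?_⟩
    simp [hv]
  | succ n ih =>
    obtain ⟨L, c, hL, hinj, hc, hcx, hlt⟩ := ih (lt_of_le_of_lt (by gcongr; omega) hn)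
    let B := univ.filter fun v => blk v ∈ L.image blk
    have hB : B.card ≤ s * (n + 1) := by
      have h1 : B ⊆ (L.image blk).biUnion fun j => univ.filter fun v => blk v = j := by
        intro v hv
        simp only [B, mem_filter, mem_univ, true_and] at hv
        simp only [mem_biUnion, mem_filter, mem_univ, true_and]
        exact ⟨blk v, hv, rfl⟩
      refine (card_le_card h1).trans (card_biUnion_le.trans ?_)
      refine (sum_le_card_nsmul _ _ s fun j _ => hfib j).trans ?_
      rw [smul_eq_mul, mul_comm]
      exact Nat.mul_le_mul_left _ (card_image_le.trans hL.le)
    have hne : (univ.filter fun v => blk v ∉ L.image blk).Nonempty := by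
      by_contra hcon
      rw [not_nonempty_iff_eq_empty, filter_eq_empty_iff] at hcon
      have : B = univ := by
        ext v; simp only [B, mem_filter, mem_univ, true_and, iff_true]
        exact not_not.1 (hcon (mem_univ v))
      rw [this, card_univ] at hB
      omega
    obtain ⟨v, hv, hmin⟩ := exists_min_image _ x hne
    simp only [mem_filter, mem_univ, true_and] at hv hmin
    have hvL : v ∉ L := fun h => hv (mem_image_of_mem _ h)
    refine ⟨insert v L, max c (x v), by rw [card_insert_of_notMem hvL, hL], ?_, ?_, ?_, ?_⟩
    · rw [coe_insert, Set.injOn_insert (by simpa using hvL)]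
      refine ⟨hinj, ?_⟩
      rintro ⟨u, hu, huv⟩
      exact hv (huv ▸ mem_image_of_mem _ (by simpa using hu))
    · intro u hu
      rcases mem_insert.1 hu with rfl | hu
      · exact le_max_right _ _
      · exact (hc u hu).trans (le_max_left _ _)
    · rcases max_choice c (x v) with h | h
      · rw [h]; exact hcx
      · exact ⟨v, h⟩
    · rcases max_choice c (x v) with h | h
      · rw [h]; exact hlt.trans (by gcongr; omega)
      · rw [h]
        refine (card_le_card ?_).trans hB
        intro u hu
        simp only [B, mem_filter, mem_univ, true_and] at hu ⊢
        by_contra hcon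
        exact absurd (hmin u hcon) (not_le.2 hu)

omit [DecidableEq W] in
theorem exists_upper_quartile [Nonempty W] (y : W → ℝ) (hy : ∀ v, 0 ≤ y v) :
    ∃ β : ℝ, 0 ≤ β ∧ 3 * Fintype.card W < 4 * (univ.filter fun v => y v ≤ β).card ∧
      Fintype.card W ≤ 4 * (univ.filter fun v => β ≤ y v).card := by
  let P := univ.filter fun u => 3 * Fintype.card W < 4 * (univ.filter fun v => y v ≤ y u).card
  have hP : P.Nonempty := by
    obtain ⟨u, hu⟩ := Finite.exists_max y
    refine ⟨u, ?_⟩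
    simp only [P, mem_filter, mem_univ, true_and, hu, filter_true, card_univ]
    have : 0 < Fintype.card W := Fintype.card_pos
    omega
  obtain ⟨u, hu, hmin⟩ := exists_min_image P y hP
  refine ⟨y u, hy u, by simpa [P] using hu, ?_⟩
  have h1 := card_filter_add_card_filter_not (s := (univ : Finset W)) (fun v => y u ≤ y v)
  rw [card_univ] at h1
  suffices h : 4 * (univ.filter fun v => ¬ y u ≤ y v).card ≤ 3 * Fintype.card W by omega
  rcases (univ.filter fun v => ¬ y u ≤ y v).eq_empty_or_nonempty with h0 | h0
  · rw [h0]; simp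
  · obtain ⟨z, hz, hmax⟩ := exists_max_image _ y h0
    simp only [mem_filter, mem_univ, true_and, not_le] at hz hmax
    have hzP : z ∉ P := fun h => absurd (hmin z h) (not_le.2 hz)
    simp only [P, mem_filter, mem_univ, true_and, not_lt] at hzP
    refine le_trans ?_ hzP
    gcongr 4 * card ?_
    intro v hv
    simp only [mem_filter, mem_univ, true_and, not_le] at hv ⊢
    exact hmax v hv

omit [DecidableEq W] in
theorem layer_bound (y : W → ℝ) (b β q : ℝ) (hbβ : b ≤ β) (hβq : β ≤ q)
    (hy : ∀ v, 0 ≤ y v) :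
    b * (univ.filter fun v => b ≤ y v).card + (β - b) * (univ.filter fun v => β ≤ y v).card +
      (q - β) * (univ.filter fun v => q ≤ y v).card ≤ ∑ v, y v := by
  have h : ∀ (c d : ℝ), d * ((univ.filter fun v => c ≤ y v).card : ℝ) =
      ∑ v, if c ≤ y v then d else 0 := by
    intro c d
    rw [← sum_filter, sum_const, nsmul_eq_mul, mul_comm]
  rw [h, h, h, ← sum_add_distrib, ← sum_add_distrib]
  apply sum_le_sum
  intro v _
  have := hy v
  split_ifs <;> linarith

/-- Two subsets of an `n`-element set of total size more than `n` intersect. -/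
theorem exists_mem_of_card_lt_add (A B : Finset W) (h : Fintype.card W < A.card + B.card) :
    ∃ v, v ∈ A ∧ v ∈ B := by
  have h1 := card_union_add_card_inter A B
  have h2 := card_le_univ (A ∪ B)
  obtain ⟨v, hv⟩ := card_pos.1 (by omega : 0 < (A ∩ B).card)
  exact ⟨v, mem_inter.1 hv⟩

theorem exists_mem_two_of_three (A B C Z : Finset W) (n : ℕ) (hn : Fintype.card W = n)
    (hA : n < 2 * A.card) (hB : n < 2 * B.card) (hC : n < 2 * C.card) (hZ : 3 * n < 4 * Z.card) :
    (∃ v ∈ Z, v ∈ A ∧ v ∈ B) ∨ (∃ v ∈ Z, v ∈ B ∧ v ∈ C) ∨ (∃ v ∈ Z, v ∈ A ∧ v ∈ C) := by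
  by_contra! hcon
  obtain ⟨h1, h2, h3⟩ := hcon
  have key : ∑ v : W, ((if v ∈ A then 1 else 0) + (if v ∈ B then 1 else 0) +
      (if v ∈ C then 1 else 0) + 2 * (if v ∈ Z then 1 else 0)) ≤ ∑ v : W, 3 := by
    apply sum_le_sum
    intro v _
    have h1 := h1 v
    have h2 := h2 v
    have h3 := h3 v
    split_ifs <;> first | omega | (exfalso; tauto)
  simp only [sum_add_distrib, ← mul_sum, sum_boole, filter_mem_eq_inter, univ_inter, sum_const,
    card_univ, smul_eq_mul, Nat.cast_id] at key
  omega

end LightWalk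

section LightWalk
variable {W : Type} [Fintype W] [DecidableEq W]

/-- The combinatorial core: an edge whose codegree neighbourhoods are large can be traversed by a
closed walk of length `s` that is light for the weight `y`. -/
theorem exists_closed_walk_of_light_edge {k s : ℕ} (hk : 3 ≤ k) (hs : 5 * k ^ 2 ≤ s) (hs0 : 0 < s)
    {R : Finset (Finset W)} (e : Finset W) (he : e ∈ R) (hcard : e.card = k)
    (hdeg : ∀ u ∈ e, (1 / 2 + 1 / (2 * (s : ℝ))) * Fintype.card W ≤
      ((univ.filter fun v => insert v (e.erase u) ∈ R).card : ℝ))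
    (y : W → ℝ) (hy : ∀ v, 0 ≤ y v)
    (hb : ((1 : ℝ) / 2 + 1 / (2 * s)) * Fintype.card W ≤
      ((univ.filter fun v => ∑ u ∈ e, y u ≤ y v).card : ℝ)) :
    ∃ a : Fin s → W, IsClosedWalk k s hs0 R a ∧
      (∑ i, y (a i)) * Fintype.card W ≤ s * ∑ v, y v := by
  have hsR : (0 : ℝ) < s := by exact_mod_cast hs0
  obtain ⟨u₁, -⟩ := card_pos.1 (by omega : 0 < e.card)
  have : Nonempty W := ⟨u₁⟩
  set M := Fintype.card W with hM
  have hMpos : (0 : ℝ) < M := by exact_mod_cast (Fintype.card_pos : 0 < Fintype.card W)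
  set b := ∑ u ∈ e, y u with hbdef
  have hhalf : ∀ n : ℕ, ((1 : ℝ) / 2 + 1 / (2 * s)) * M ≤ n → M < 2 * n := by
    intro n hn
    have h1 : (0 : ℝ) < 1 / (2 * s) * M := by positivity
    have h2 : (M : ℝ) < 2 * n := by linarith
    exact_mod_cast h2
  obtain ⟨β, hβ0, hβ1, hβ2⟩ := exists_upper_quartile y hy
  have hbβ : b ≤ β := by
    obtain ⟨v, hv1, hv2⟩ := exists_mem_of_card_lt_add (univ.filter fun v => b ≤ y v)
      (univ.filter fun v => y v ≤ β) (by have := hhalf _ hb; omega)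
    simp only [mem_filter, mem_univ, true_and] at hv1 hv2
    exact hv1.trans hv2
  let v0 : Fin k → W := fun i => (e.equivFinOfCardEq hcard).symm i
  have hv0 : Function.Injective v0 :=
    Subtype.val_injective.comp (e.equivFinOfCardEq hcard).symm.injective
  have hv0e : ∀ i, v0 i ∈ e := fun i => ((e.equivFinOfCardEq hcard).symm i).2
  have himg : univ.image v0 = e := by
    apply eq_of_subset_of_card_le
    · intro x hx
      obtain ⟨i, -, rfl⟩ := mem_image.1 hx
      exact hv0e i
    · rw [card_image_of_injective _ hv0, card_univ, Fintype.card_fin, hcard]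
  let N : Fin k → Finset W := fun i => univ.filter fun v => insert v (e.erase (v0 i)) ∈ R
  have hN : ∀ i, ((1 : ℝ) / 2 + 1 / (2 * s)) * M ≤ (N i).card := fun i => hdeg _ (hv0e i)
  obtain ⟨u, i₀, hu⟩ := exists_ordering k (fun i j => ∃ w, y w ≤ β ∧ w ∈ N i ∧ w ∈ N j)
    (fun i j ⟨w, h1, h2, h3⟩ => ⟨w, h1, h3, h2⟩) (by
      intro i j l _ _ _
      have := exists_mem_two_of_three (N i) (N j) (N l) (univ.filter fun v => y v ≤ β) M rfl
        (hhalf _ (hN i)) (hhalf _ (hN j)) (hhalf _ (hN l)) hβ1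
      simpa using this)
  have hinter : ∀ i j, ((M : ℝ) / s) ≤ ((N i ∩ N j).card : ℝ) := by
    intro i j
    have h1 := card_union_add_card_inter (N i) (N j)
    have h2 : (N i ∪ N j).card ≤ M := card_le_univ _
    have h3 : ((N i).card : ℝ) + (N j).card ≤ M + (N i ∩ N j).card := by exact_mod_cast (by omega)
    have h4 := hN i
    have h5 := hN j
    have h6 : ((1 : ℝ) / 2 + 1 / (2 * s)) * M = M / 2 + M / s / 2 := by field_simp
    linarith
  have hpiv : ∃ (w : ℕ → W) (q : ℝ), β ≤ q ∧
      (M : ℝ) / s * (q - β) ≤ (univ.filter fun v => q ≤ y v).card * (q - β) ∧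
      (∀ l (hl : l + 1 < k), w l ∈ N (u ⟨l, by omega⟩) ∧ w l ∈ N (u ⟨l + 1, hl⟩)) ∧
      (∀ l, l + 1 < k → y (w l) ≤ if l = i₀ then q else β) := by
    have hw' : ∀ l, ∃ w, l ≠ i₀ → ∀ hl : l + 1 < k,
        y w ≤ β ∧ w ∈ N (u ⟨l, by omega⟩) ∧ w ∈ N (u ⟨l + 1, hl⟩) := by
      intro l
      by_cases h : l ≠ i₀ ∧ l + 1 < k
      · obtain ⟨w, hw⟩ := hu l h.2 h.1
        exact ⟨w, fun _ _ => hw⟩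
      · exact ⟨u₁, fun h1 h2 => absurd ⟨h1, h2⟩ h⟩
    choose w' hw' using hw'
    by_cases hi : i₀ + 1 < k
    · have hne : (N (u ⟨i₀, by omega⟩) ∩ N (u ⟨i₀ + 1, hi⟩)).Nonempty := by
        rw [← card_pos]
        have := hinter (u ⟨i₀, by omega⟩) (u ⟨i₀ + 1, hi⟩)
        have h2 : (0 : ℝ) < M / s := by positivity
        exact_mod_cast h2.trans_le this
      obtain ⟨z, hz, hmin⟩ := exists_min_image _ y hne
      refine ⟨Function.update w' i₀ z, max (y z) β, le_max_right _ _, ?_, ?_, ?_⟩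
      · rcases le_total (y z) β with h | h
        · rw [max_eq_right h]; simp
        · rw [max_eq_left h]
          refine mul_le_mul_of_nonneg_right ((hinter (u ⟨i₀, by omega⟩) (u ⟨i₀ + 1, hi⟩)).trans ?_)
            (by linarith)
          norm_cast
          apply card_le_card
          intro x hx
          simpa using hmin x hx
      · intro l hl
        by_cases h : l = i₀
        · subst h; simpa using hz
        · rw [Function.update_of_ne h]
          exact (hw' l h hl).2
      · intro l hl
        by_cases h : l = i₀
        · subst h; simp
        · rw [Function.update_of_ne h, if_neg h]
          exact (hw' l h hl).1
    · refine ⟨w', β, le_rfl, by simp, ?_, ?_⟩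
      · intro l hl
        exact (hw' l (by rintro rfl; exact hi hl) hl).2
      · intro l hl
        have h : l ≠ i₀ := by rintro rfl; exact hi hl
        rw [if_neg h]
        exact (hw' l h hl).1
  obtain ⟨w, q, hβq, hq, hwN, hwy⟩ := hpiv
  have hk0 : 0 < k := by omega
  have himg' : univ.image (fun i => v0 (u i)) = e := by rw [image_comp_perm, himg]
  have hQ : 5 * k ≤ s / k := by
    rw [Nat.le_div_iff_mul_le hk0]; nlinarith
  obtain ⟨a, ha1, ha2, ha3⟩ := exists_walk_through_pivots hk0 (R := R) (fun i => v0 (u i))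
    (hv0.comp u.injective) (by rw [himg']; exact he) w (by
      intro l hl
      rw [himg']
      have := hwN l hl
      simpa [N] using this) (s % k) (s / k) (by omega)
  rw [Nat.div_add_mod] at ha2
  refine ⟨fun i => a i, ?_, ?_⟩
  · intro i hi
    convert ha1 i using 1
    apply image_congr
    intro p hp
    simp only [coe_range, Set.mem_Iio] at hp
    rcases lt_or_ge (i + p) s with h | h
    · simp [Nat.mod_eq_of_lt h]
    · have h2 : i + p - s < k := by omega
      have h3 := ha2 _ h2
      have h4 : (i + p) % s = i + p - s := by
        have hks : k ≤ s := by nlinarith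
        rw [Nat.mod_eq_sub_mod h, Nat.mod_eq_of_lt (by omega)]
      simp only [h4]
      rw [← h3]
      congr 1; omega
  · have h1 := ha3 y hy
    have h2 : ∑ i : Fin s, y (a i) ≤ ∑ i ∈ range (k * (s / k + 1)), y (a i) := by
      rw [Fin.sum_univ_eq_sum_range (fun i => y (a i)) s]
      apply sum_le_sum_of_subset_of_nonneg
      · intro i hi
        rw [mem_range] at hi ⊢
        have h1 := Nat.div_add_mod s k
        have h2 := Nat.mod_lt s hk0
        rw [mul_add]; omega
      · intro i _ _; exact hy _
    have h3 : ∑ i, y (v0 (u i)) = b := by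
      rw [hbdef, ← himg', sum_image]
      exact fun x _ y _ h => u.injective (hv0 h)
    have h4 : ∑ l ∈ range (k - 1), y (w l) ≤ (q - β) + (k - 1) * β := by
      calc ∑ l ∈ range (k - 1), y (w l)
          ≤ ∑ l ∈ range (k - 1), ((if l = i₀ then q - β else 0) + β) := by
            apply sum_le_sum
            intro l hl
            rw [mem_range] at hl
            have := hwy l (by omega)
            split_ifs at this ⊢ <;> linarith
        _ ≤ _ := by
            rw [sum_add_distrib, sum_ite_eq', sum_const, card_range, nsmul_eq_mul,
              Nat.cast_sub (by omega), Nat.cast_one]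
            split_ifs <;> linarith
    rw [h3] at h1
    have h5 := layer_bound y b β q hbβ hβq hy
    have hb0 : 0 ≤ b := sum_nonneg fun i _ => hy i
    have hQs : ((s / k : ℕ) : ℝ) + k ≤ (s + 1) / 2 := by
      have h1 : s / k * 3 ≤ s := (Nat.mul_le_mul_left _ hk).trans (Nat.div_mul_le_self s k)
      have h2 : 15 * k ≤ s := by nlinarith
      have h3 : 2 * (s / k + k) ≤ s + 1 := by omega
      have h4 : (2 : ℝ) * ((s / k : ℕ) + k) ≤ s + 1 := by exact_mod_cast h3
      linarith
    have hks : (k : ℝ) - 1 ≤ s / 4 := by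
      have h2 : 15 * k ≤ s := by nlinarith
      have h2 : (15 : ℝ) * k ≤ s := by exact_mod_cast h2
      linarith
    have hβ2' : (M : ℝ) / 4 ≤ (univ.filter fun v => β ≤ y v).card := by
      have : (M : ℝ) ≤ 4 * (univ.filter fun v => β ≤ y v).card := by exact_mod_cast hβ2
      linarith
    have hS : ((s : ℝ) + 1) / (2 * s) * M * b + (M / 4) * (β - b) + M / s * (q - β) ≤ ∑ v, y v := by
      have e1 := mul_le_mul_of_nonneg_right hb hb0
      have e2 := mul_le_mul_of_nonneg_right hβ2' (sub_nonneg.2 hbβ)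
      have e3 : ((s : ℝ) + 1) / (2 * s) = 1 / 2 + 1 / (2 * s) := by field_simp
      rw [e3]
      linarith
    have hS2 : M * ((s + 1) / 2 * b + s / 4 * (β - b) + (q - β)) ≤ s * ∑ v, y v := by
      refine le_trans (le_of_eq ?_) (mul_le_mul_of_nonneg_left hS hsR.le)
      field_simp
    refine le_trans ?_ hS2
    rw [mul_comm]
    apply mul_le_mul_of_nonneg_left _ hMpos.le
    have f1 := mul_le_mul_of_nonneg_right hQs hb0
    have f2 := mul_le_mul_of_nonneg_right hks (sub_nonneg.2 hbβ)
    linarith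

theorem exists_light_closed_walk {ι : Type} [DecidableEq ι] {k s : ℕ} (hk : 3 ≤ k)
    (hs : 5 * k ^ 2 ≤ s) (hs0 : 0 < s) (blk : W → ι)
    (hfib : ∀ j, (univ.filter fun v => blk v = j).card ≤ s) {R : Finset (Finset W)}
    (hcard : ∀ e ∈ R, e.card = k) (hblk : ∀ e ∈ R, Set.InjOn blk e)
    (hdeg : ∀ S : Finset W, S.card = k - 1 → Set.InjOn blk S →
      (1 / 2 + 1 / (2 * (s : ℝ))) * Fintype.card W ≤
        ((univ.filter fun v => insert v S ∈ R).card : ℝ))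
    (hM : s * (k - 2) < Fintype.card W) (x : W → ℝ) (hx : ∀ v, 0 ≤ x v) :
    ∃ a : Fin s → W, IsClosedWalk k s hs0 R a ∧
      (∑ i, x (a i)) * (Fintype.card W - s * (k - 2)) ≤ s * ∑ v, x v := by
  obtain ⟨L, c, hL, hinj, hLc, ⟨v₁, hcv⟩, hlt⟩ := exists_light_transversal blk s hfib x (k - 2) hM
  have hc0 : 0 ≤ c := hcv ▸ hx v₁
  have hL' : L.card = k - 1 := by omega
  have hsR : (0 : ℝ) < s := by exact_mod_cast hs0
  have hMpos : (0 : ℝ) < Fintype.card W := by exact_mod_cast (by omega)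
  let y : W → ℝ := fun v => max (x v - c) 0
  have hy : ∀ v, 0 ≤ y v := fun v => le_max_right _ _
  have hyL : ∀ v ∈ L, y v = 0 := fun v hv => max_eq_right (by linarith [hLc v hv])
  have hdL := hdeg L hL' hinj
  have hne : (univ.filter fun v => insert v L ∈ R).Nonempty := by
    rw [← card_pos]
    have : (0 : ℝ) < (1 / 2 + 1 / (2 * (s : ℝ))) * Fintype.card W := by positivity
    exact_mod_cast this.trans_le hdL
  obtain ⟨v, hv, hmin⟩ := exists_min_image _ y hne
  simp only [mem_filter, mem_univ, true_and] at hv hmin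
  have hvL : v ∉ L := by
    intro h
    have := hcard _ hv
    rw [insert_eq_of_mem h] at this
    omega
  obtain ⟨a, ha, hay⟩ := exists_closed_walk_of_light_edge hk hs hs0 (insert v L) hv (hcard _ hv)
    (by
      intro u hu
      apply hdeg
      · rw [card_erase_of_mem hu, hcard _ hv]
      · exact (hblk _ hv).mono (by exact_mod_cast erase_subset _ _)) y hy (by
      refine hdL.trans ?_
      norm_cast
      apply card_le_card
      intro z hz
      simp only [mem_filter, mem_univ, true_and] at hz ⊢
      rw [sum_insert hvL, sum_eq_zero hyL, add_zero]
      exact hmin z hz)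
  refine ⟨a, ha, ?_⟩
  have hk2 : ((k - 2 : ℕ) : ℝ) = k - 2 := by rw [Nat.cast_sub (by omega)]; norm_num
  have hM' : (0 : ℝ) ≤ Fintype.card W - s * (k - 2) := by
    have : ((s * (k - 2) : ℕ) : ℝ) ≤ Fintype.card W := by exact_mod_cast hM.le
    rw [Nat.cast_mul, hk2] at this
    linarith
  have h1 : ∑ i, x (a i) ≤ s * c + ∑ i, y (a i) := by
    have : ∑ i : Fin s, (c + y (a i)) = s * c + ∑ i, y (a i) := by
      rw [sum_add_distrib, sum_const, card_univ, Fintype.card_fin, nsmul_eq_mul]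
    rw [← this]
    apply sum_le_sum
    intro i _
    have : x (a i) - c ≤ y (a i) := le_max_left _ _
    linarith
  have h2 : c * (Fintype.card W - s * (k - 2)) + ∑ v, y v ≤ ∑ v, x v := by
    have h3 : c * (Fintype.card W) - c * (univ.filter fun v => x v < c).card + ∑ v, y v
        ≤ ∑ v, x v := by
      have e1 : c * ((univ.filter fun v => x v < c).card : ℝ) = ∑ v, if x v < c then c else 0 := by
        rw [← sum_filter, sum_const, nsmul_eq_mul, mul_comm]
      have e2 : c * (Fintype.card W : ℝ) = ∑ v : W, c := by
        rw [sum_const, nsmul_eq_mul, mul_comm, card_univ]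
      rw [e1, e2, ← sum_sub_distrib, ← sum_add_distrib]
      apply sum_le_sum
      intro v _
      have := hx v
      simp only [y]
      split_ifs with h
      · rw [max_eq_right (by linarith)]; linarith
      · rw [max_eq_left (by linarith)]; linarith
    have h4 : ((univ.filter fun v => x v < c).card : ℝ) ≤ s * (k - 2) := by
      rw [← hk2]; exact_mod_cast hlt
    have := mul_le_mul_of_nonneg_left h4 hc0
    linarith
  have hy0 : 0 ≤ ∑ i, y (a i) := sum_nonneg fun i _ => hy _
  have hsk : (0 : ℝ) ≤ s * (k - 2) := by rw [← hk2]; positivity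
  calc (∑ i, x (a i)) * (Fintype.card W - s * (k - 2))
      ≤ (s * c + ∑ i, y (a i)) * (Fintype.card W - s * (k - 2)) := by gcongr
    _ ≤ s * (c * (Fintype.card W - s * (k - 2))) + (∑ i, y (a i)) * Fintype.card W := by
        nlinarith [mul_nonneg hy0 hsk]
    _ ≤ s * (c * (Fintype.card W - s * (k - 2)) + ∑ v, y v) := by rw [mul_add]; linarith
    _ ≤ _ := by gcongr

end LightWalk

section Packing
variable {W : Type} [Fintype W]

/-- Linear programming duality for fractional packings: if every nonnegative weight has a light
member of the family `cnt`, then some convex combination of the family is bounded by `ρ`. -/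
theorem exists_convex_combination_le {A : Type} [Fintype A] (cnt : A → W → ℝ) (ρ : ℝ)
    (h : ∀ x : W → ℝ, (∀ v, 0 ≤ x v) → ∃ a, ∑ v, cnt a v * x v ≤ ρ * ∑ v, x v) :
    ∃ ω : A → ℝ, (∀ a, 0 ≤ ω a) ∧ ∑ a, ω a = 1 ∧ ∀ v, ∑ a, ω a * cnt a v ≤ ρ := by
  classical
  let F := Fintype.linearCombination ℝ cnt
  let O : Set (W → ℝ) := {y | ∀ v, y v ≤ ρ}
  by_cases hd : Disjoint (F '' stdSimplex ℝ A) O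
  · exfalso
    have hO : O = ⋂ v, {y : W → ℝ | y v ≤ ρ} := by ext; simp [O]
    have hOc : Convex ℝ O := by
      intro y hy z hz a b ha hb hab v
      have h1 := mul_le_mul_of_nonneg_left (hy v) ha
      have h2 := mul_le_mul_of_nonneg_left (hz v) hb
      have h3 : a * ρ + b * ρ = ρ := by rw [← add_mul, hab, one_mul]
      simp only [Pi.add_apply, Pi.smul_apply, smul_eq_mul]
      linarith
    have hOcl : IsClosed O := by
      rw [hO]
      exact isClosed_iInter fun v => isClosed_le (continuous_apply v) continuous_const
    obtain ⟨f, u, u', hu, huu, hu'⟩ := geometric_hahn_banach_compact_closed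
      ((convex_stdSimplex ℝ A).linear_image F)
      ((isCompact_stdSimplex ℝ A).image F.continuous_of_finiteDimensional) hOc hOcl hd
    have hf : ∀ z : W → ℝ, f z = ∑ v, z v * f (Pi.single v 1) := by
      intro z
      conv_lhs => rw [pi_eq_sum_univ' z, map_sum]
      apply sum_congr rfl
      intro v _
      rw [map_smul, smul_eq_mul]
    have hneg : ∀ v, f (Pi.single v 1) ≤ 0 := by
      intro v
      by_contra hpos
      push Not at hpos
      obtain ⟨n, hn⟩ := exists_nat_gt ((f (fun _ => ρ) - u') / f (Pi.single v 1))
      have hmem : (fun _ => ρ) - (n : ℝ) • Pi.single v (1 : ℝ) ∈ O := by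
        intro j
        by_cases hj : j = v
        · subst hj; simp
        · simp [hj]
      have := hu' _ hmem
      rw [map_sub, map_smul, smul_eq_mul] at this
      rw [div_lt_iff₀ hpos] at hn
      linarith
    obtain ⟨a, ha⟩ := h (fun v => -f (Pi.single v 1)) (fun v => neg_nonneg.2 (hneg v))
    have h1 := hu (cnt a) ⟨Pi.single a 1, single_mem_stdSimplex ℝ a, by
      simp [F, Fintype.linearCombination_apply_single]⟩
    have h2 := hu' (fun _ => ρ) (fun _ => le_rfl)
    rw [hf] at h1 h2
    simp only [mul_neg, sum_neg_distrib, ← mul_sum] at ha h2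
    linarith
  · obtain ⟨_, ⟨ω, hω, rfl⟩, hy⟩ := Set.not_disjoint_iff.1 hd
    refine ⟨ω, hω.1, hω.2, fun v => ?_⟩
    simpa [F, Fintype.linearCombination_apply] using hy v

theorem exists_integer_packing {A : Type} [Fintype A] (cnt : A → W → ℕ) (ρ : ℝ) (hρ : 0 < ρ)
    (h : ∀ x : W → ℝ, (∀ v, 0 ≤ x v) → ∃ a, ∑ v, (cnt a v : ℝ) * x v ≤ ρ * ∑ v, x v) (t : ℕ) :
    ∃ n : A → ℕ, (∀ v, ∑ a, n a * cnt a v ≤ t) ∧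
      (t : ℝ) / ρ ≤ ((∑ a, n a : ℕ) : ℝ) + Fintype.card A := by
  obtain ⟨ω, hω0, hω1, hω⟩ := exists_convex_combination_le (fun a v => (cnt a v : ℝ)) ρ h
  have hp : ∀ a, 0 ≤ ω a * (t / ρ) := fun a => mul_nonneg (hω0 a) (by positivity)
  refine ⟨fun a => ⌊ω a * (t / ρ)⌋₊, fun v => ?_, ?_⟩
  · have : ((∑ a, ⌊ω a * (t / ρ)⌋₊ * cnt a v : ℕ) : ℝ) ≤ t := by
      push_cast
      calc ∑ a, (⌊ω a * (t / ρ)⌋₊ : ℝ) * cnt a v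
          ≤ ∑ a, (t / ρ) * (ω a * cnt a v) := by
            apply sum_le_sum
            intro a _
            have := mul_le_mul_of_nonneg_right (Nat.floor_le (hp a)) (Nat.cast_nonneg (cnt a v))
            linarith
        _ = (t / ρ) * ∑ a, ω a * cnt a v := by rw [mul_sum]
        _ ≤ (t / ρ) * ρ := by gcongr; exact hω v
        _ = t := by field_simp
    exact_mod_cast this
  · calc (t : ℝ) / ρ = ∑ a, ω a * (t / ρ) := by rw [← sum_mul, hω1, one_mul]
      _ ≤ ∑ a, ((⌊ω a * (t / ρ)⌋₊ : ℝ) + 1) := sum_le_sum fun a _ => (Nat.lt_floor_add_one _).le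
      _ = _ := by rw [sum_add_distrib]; simp

omit [Fintype W] in
/-- A map whose fibres have at most `t` elements lifts to an injection into `W × Fin t`. -/
theorem exists_injective_lift [DecidableEq W] {X : Type} [Fintype X] (f : X → W) (t : ℕ)
    (h : ∀ v, (univ.filter fun x => f x = v).card ≤ t) :
    ∃ c : X → Fin t, Function.Injective fun x => (f x, c x) := by
  have h1 : ∀ v, ∃ e : {x // f x = v} → Fin t, Function.Injective e := by
    intro v
    have : Fintype.card {x // f x = v} ≤ Fintype.card (Fin t) := by
      rw [Fintype.card_subtype, Fintype.card_fin]; exact h v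
    obtain ⟨e⟩ := Function.Embedding.nonempty_of_card_le this
    exact ⟨e, e.injective⟩
  choose e he using h1
  refine ⟨fun x => e (f x) ⟨x, rfl⟩, ?_⟩
  intro x y hxy
  obtain ⟨h1, h2⟩ := Prod.mk.inj hxy
  have h3 : ∀ v v' (hx : f x = v) (hy : f y = v'), v = v' → e v ⟨x, hx⟩ = e v' ⟨y, hy⟩ → x = y := by
    rintro v _ hx hy rfl h
    exact congrArg Subtype.val (he v h)
  exact h3 _ _ rfl rfl h1 h2

/-- If light closed walks exist, then the `t`-fold blow-up contains many disjoint cycles. -/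
theorem exists_blowup_packing [DecidableEq W] {ι : Type} [DecidableEq ι] {k s : ℕ} (hk : 3 ≤ k)
    (hs : 5 * k ^ 2 ≤ s) (hs0 : 0 < s) (blk : W → ι)
    (hfib : ∀ j, (univ.filter fun v => blk v = j).card ≤ s) {R : Finset (Finset W)}
    (hcard : ∀ e ∈ R, e.card = k) (hblk : ∀ e ∈ R, Set.InjOn blk e)
    (hdeg : ∀ S : Finset W, S.card = k - 1 → Set.InjOn blk S →
      (1 / 2 + 1 / (2 * (s : ℝ))) * Fintype.card W ≤
        ((univ.filter fun v => insert v S ∈ R).card : ℝ))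
    (hM : s * (k - 2) < Fintype.card W) (t : ℕ) :
    ∃ (I : Type) (_ : Fintype I) (g : I × Fin s → W × Fin t), Function.Injective g ∧
      (∀ i, IsClosedWalk k s hs0 R fun p => (g (i, p)).1) ∧
      (t : ℝ) * (Fintype.card W / s - (k - 2)) ≤ Fintype.card I + (Fintype.card W : ℝ) ^ s := by
  classical
  let A := {a : Fin s → W // IsClosedWalk k s hs0 R a}
  have hsR : (0 : ℝ) < s := by exact_mod_cast hs0
  have hM' : (0 : ℝ) < Fintype.card W - s * (k - 2) := by
    have : ((s * (k - 2) : ℕ) : ℝ) < Fintype.card W := by exact_mod_cast hM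
    rw [Nat.cast_mul, Nat.cast_sub (by omega)] at this
    push_cast at this
    linarith
  have hAcard : Fintype.card A ≤ Fintype.card W ^ s := by
    refine (Fintype.card_subtype_le _).trans ?_
    simp
  obtain ⟨n, hn, hnt⟩ := exists_integer_packing
    (fun (a : A) v => (univ.filter fun p => a.1 p = v).card)
    (s / (Fintype.card W - s * (k - 2))) (by positivity) (by
      intro x hx
      obtain ⟨a, ha, hax⟩ := exists_light_closed_walk hk hs hs0 blk hfib hcard hblk hdeg hM x hx
      refine ⟨⟨a, ha⟩, ?_⟩
      rw [div_mul_eq_mul_div, le_div_iff₀ hM']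
      refine le_trans (le_of_eq ?_) hax
      congr 1
      rw [← sum_fiberwise (univ : Finset (Fin s)) a]
      apply sum_congr rfl
      intro v _
      rw [sum_congr rfl (g := fun _ => x v) (by intro p hp; rw [(mem_filter.1 hp).2]),
        sum_const, nsmul_eq_mul]) t
  let I := Σ a : A, Fin (n a)
  let f : I × Fin s → W := fun z => z.1.1.1 z.2
  obtain ⟨c, hc⟩ := exists_injective_lift f t (by
    intro v
    refine le_trans (le_of_eq ?_) (hn v)
    rw [← Fintype.card_subtype]
    let E : {z : I × Fin s // f z = v} ≃ Σ a : A, Fin (n a) × {p : Fin s // a.1 p = v} :=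
      { toFun := fun z => ⟨z.1.1.1, z.1.1.2, z.1.2, z.2⟩
        invFun := fun z => ⟨(⟨z.1, z.2.1⟩, z.2.2.1), z.2.2.2⟩
        left_inv := fun z => rfl
        right_inv := fun z => rfl }
    rw [Fintype.card_congr E, Fintype.card_sigma]
    apply sum_congr rfl
    intro a _
    rw [Fintype.card_prod, Fintype.card_fin, Fintype.card_subtype])
  refine ⟨I, inferInstance, fun z => (f z, c z), hc, fun i => i.1.2, ?_⟩
  have h1 : (Fintype.card I : ℝ) = ((∑ a, n a : ℕ) : ℝ) := by
    rw [Fintype.card_sigma]; simp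
  have h2 : (Fintype.card A : ℝ) ≤ (Fintype.card W : ℝ) ^ s := by exact_mod_cast hAcard
  rw [h1]
  have h3 : (t : ℝ) * (Fintype.card W / s - (k - 2)) =
      t / (s / (Fintype.card W - s * (k - 2))) := by field_simp
  rw [h3]
  linarith

end Packing

section Box

theorem card_not_injective_mul_le (m : ℕ) (X : Type) [Fintype X] [DecidableEq X] :
    (univ.filter fun ω : Fin m → X => ¬ Function.Injective ω).card * Fintype.card X ≤
      m ^ 2 * Fintype.card X ^ m := by
  have h1 : ∀ i j : Fin m, i ≠ j →
      (univ.filter fun ω : Fin m → X => ω i = ω j).card * Fintype.card X ≤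
        Fintype.card X ^ m := by
    intro i j hij
    rw [← card_univ, ← card_product]
    refine le_trans (card_le_card_of_injOn (t := (univ : Finset (Fin m → X)))
      (fun z => Function.update z.1 i z.2) (fun _ _ => mem_univ _) ?_) (by simp)
    rintro ⟨ω, x⟩ h ⟨ω', x'⟩ h' heq
    simp only [coe_product, Set.mem_prod, coe_filter, mem_univ, true_and, Set.mem_ofPred_eq,
      coe_univ, Set.mem_univ, and_true] at h h'
    have hx : x = x' := by simpa using congrFun heq i
    refine Prod.ext ?_ hx
    have hne : ∀ l, l ≠ i → ω l = ω' l := by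
      intro l hl
      simpa [hl] using congrFun heq l
    funext l
    by_cases hl : l = i
    · subst hl
      exact h.trans ((hne j hij.symm).trans h'.symm)
    · exact hne l hl
  let B : Finset (Fin m × Fin m) := univ.filter fun p => p.1 ≠ p.2
  have h2 : (univ.filter fun ω : Fin m → X => ¬ Function.Injective ω) ⊆
      B.biUnion fun p => univ.filter fun ω => ω p.1 = ω p.2 := by
    intro ω hω
    simp only [mem_filter, mem_univ, true_and, Function.Injective, not_forall] at hω
    obtain ⟨i, j, h, hij⟩ := hω
    exact mem_biUnion.2 ⟨(i, j), by simp [B, hij], by simp [h]⟩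
  calc _ ≤ (∑ p ∈ B, (univ.filter fun ω : Fin m → X => ω p.1 = ω p.2).card) * Fintype.card X :=
        Nat.mul_le_mul_right _ ((card_le_card h2).trans card_biUnion_le)
    _ ≤ ∑ p ∈ B, Fintype.card X ^ m := by
        rw [sum_mul]
        exact sum_le_sum fun p hp => h1 _ _ (mem_filter.1 hp).2
    _ ≤ m ^ 2 * Fintype.card X ^ m := by
        rw [sum_const, smul_eq_mul]
        gcongr
        refine (card_le_univ _).trans ?_
        simp [sq]

/-- A theorem of Erdős: a dense `r`-ary relation contains a complete box with sides of size `t + 1`. -/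
theorem exists_box (t r : ℕ) : ∀ ε : ℝ, 0 < ε → ∃ N₀ : ℕ, ∀ (X : Type) [Fintype X]
    (P : Finset (Fin r → X)), N₀ ≤ Fintype.card X → ε * (Fintype.card X : ℝ) ^ r ≤ P.card →
      ∃ Y : Fin r → Finset X, (∀ i, (Y i).card = t + 1) ∧ ∀ f, (∀ i, f i ∈ Y i) → f ∈ P := by
  classical
  induction r with
  | zero =>
    intro ε hε
    refine ⟨0, fun X _ P _ hP => ⟨fun i => i.elim0, fun i => i.elim0, fun f _ => ?_⟩⟩
    have : 0 < P.card := by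
      have : (0 : ℝ) < P.card := by linarith [pow_zero (Fintype.card X : ℝ)]
      exact_mod_cast this
    obtain ⟨g, hg⟩ := card_pos.1 this
    rwa [Subsingleton.elim f g]
  | succ r ih =>
    intro ε hε
    have hε' : 0 < ε ^ (t + 1) / 2 := by positivity
    obtain ⟨N₁, hN₁⟩ := ih (ε ^ (t + 1) / 2) hε'
    obtain ⟨N₂, hN₂⟩ := exists_nat_gt ((t + 1) ^ 2 / (ε ^ (t + 1) / 2))
    refine ⟨max N₁ N₂, fun X _ P hX hP => ?_⟩
    set N := Fintype.card X with hN
    have hNN₂ : (N₂ : ℝ) ≤ N := by exact_mod_cast (le_max_right _ _).trans hX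
    have hNpos : (0 : ℝ) < N := lt_of_lt_of_le (lt_of_le_of_lt (by positivity) hN₂) hNN₂
    have hNbig : ((t : ℝ) + 1) ^ 2 < ε ^ (t + 1) / 2 * N := by
      rw [← div_lt_iff₀' hε']; linarith
    let D : (Fin r → X) → Finset X := fun y => univ.filter fun a => (Fin.cons a y : Fin (r + 1) → X) ∈ P
    have hD : ∑ y, (D y).card = P.card := by
      rw [card_eq_sum_card_fiberwise (s := P) (f := Fin.tail) (t := univ) (by simp)]
      apply sum_congr rfl
      intro y _
      apply card_nbij' (fun a => (Fin.cons a y : Fin (r + 1) → X)) (fun p => p 0)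
      · intro a ha
        simpa [D] using ha
      · intro p hp
        simp only [coe_filter, Set.mem_ofPred_eq] at hp
        simp only [D, coe_filter, mem_univ, true_and, Set.mem_ofPred_eq, ← hp.2, Fin.cons_self_tail]
        exact hp.1
      · intro a _; simp
      · intro p hp
        simp only [coe_filter, Set.mem_ofPred_eq] at hp
        simp only [← hp.2, Fin.cons_self_tail]
    let P' : (Fin (t + 1) → X) → Finset (Fin r → X) := fun τ =>
      univ.filter fun y => ∀ c, τ c ∈ D y
    have hsum : ∑ τ, (P' τ).card = ∑ y, (D y).card ^ (t + 1) := by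
      have h1 : ∀ τ, (P' τ).card = ∑ y, if ∀ c, τ c ∈ D y then 1 else 0 := fun τ => by
        rw [card_filter]
      simp_rw [h1]
      rw [sum_comm]
      apply sum_congr rfl
      intro y _
      rw [← card_filter, ← Fintype.card_piFinset_const (D y) (t + 1)]
      congr 1
      ext τ
      simp
    have hlow : ε ^ (t + 1) * (N : ℝ) ^ r * (N : ℝ) ^ (t + 1) ≤ ∑ τ, ((P' τ).card : ℝ) := by
      have h1 := pow_sum_div_card_le_sum_pow (s := (univ : Finset (Fin r → X)))
        (f := fun y => ((D y).card : ℝ)) (fun _ _ => Nat.cast_nonneg _) t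
      have h2 : ∑ y, ((D y).card : ℝ) = P.card := by exact_mod_cast hD
      have h3 : ∑ τ, ((P' τ).card : ℝ) = ∑ y, ((D y).card : ℝ) ^ (t + 1) := by exact_mod_cast hsum
      rw [h3]
      refine le_trans ?_ h1
      rw [h2, card_univ, Fintype.card_fun, Fintype.card_fin, Nat.cast_pow, ← hN,
        le_div_iff₀ (by positivity)]
      calc ε ^ (t + 1) * (N : ℝ) ^ r * (N : ℝ) ^ (t + 1) * ((N : ℝ) ^ r) ^ t
          = (ε * (N : ℝ) ^ (r + 1)) ^ (t + 1) := by
            rw [mul_pow, ← pow_mul, ← pow_mul, mul_assoc, mul_assoc, ← pow_add, ← pow_add]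
            ring_nf
        _ ≤ _ := by gcongr
    have hτ : ∃ τ : Fin (t + 1) → X, Function.Injective τ ∧
        ε ^ (t + 1) / 2 * (N : ℝ) ^ r ≤ (P' τ).card := by
      by_contra! hcon
      have h1 : ∑ τ, ((P' τ).card : ℝ) ≤ ∑ τ : Fin (t + 1) → X,
          (ε ^ (t + 1) / 2 * (N : ℝ) ^ r +
            if ¬ Function.Injective τ then (N : ℝ) ^ r else 0) := by
        apply sum_le_sum
        intro τ _
        by_cases h : Function.Injective τ
        · simpa [h] using (hcon τ h).le
        · have : ((P' τ).card : ℝ) ≤ (N : ℝ) ^ r := by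
            have : (P' τ).card ≤ N ^ r := (card_le_univ _).trans (by simp [hN])
            exact_mod_cast this
          simp only [h, not_false_eq_true, if_true]
          have : 0 ≤ ε ^ (t + 1) / 2 * (N : ℝ) ^ r := by positivity
          linarith
      rw [sum_add_distrib, sum_const, card_univ, Fintype.card_fun, Fintype.card_fin, ← sum_filter,
        sum_const, nsmul_eq_mul, nsmul_eq_mul, Nat.cast_pow, ← hN] at h1
      have h2 := card_not_injective_mul_le (t + 1) X
      have h3 : ((univ.filter fun ω : Fin (t + 1) → X => ¬ Function.Injective ω).card : ℝ) * N ≤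
        (t + 1) ^ 2 * (N : ℝ) ^ (t + 1) := by exact_mod_cast h2
      set nI := ((univ.filter fun ω : Fin (t + 1) → X => ¬ Function.Injective ω).card : ℝ)
      have h4 : ε ^ (t + 1) / 2 * (N : ℝ) ^ (t + 1) * (N : ℝ) ^ r ≤ nI * (N : ℝ) ^ r := by linarith
      have h5 : ε ^ (t + 1) / 2 * (N : ℝ) ^ (t + 1) ≤ nI := le_of_mul_le_mul_right h4 (by positivity)
      have h6 : ε ^ (t + 1) / 2 * (N : ℝ) ^ (t + 1) * N ≤ (t + 1) ^ 2 * (N : ℝ) ^ (t + 1) :=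
        (mul_le_mul_of_nonneg_right h5 hNpos.le).trans h3
      have h7 : 0 < (N : ℝ) ^ (t + 1) := by positivity
      have h8 : ε ^ (t + 1) / 2 * N ≤ (t + 1) ^ 2 := by
        refine le_of_mul_le_mul_right ?_ h7
        linarith
      linarith
    obtain ⟨τ, hτi, hτ⟩ := hτ
    obtain ⟨Y, hY, hYP⟩ := hN₁ X (P' τ) ((le_max_left _ _).trans hX) hτ
    refine ⟨Fin.cons (univ.image τ) Y, ?_, ?_⟩
    · intro i
      refine Fin.cases ?_ ?_ i
      · simp [card_image_of_injective _ hτi]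
      · intro j; simpa using hY j
    · intro f hf
      have h1 := hYP (Fin.tail f) (fun i => by have := hf i.succ; rwa [Fin.cons_succ] at this)
      have h2 := hf 0
      simp only [Fin.cons_zero, mem_image, mem_univ, true_and] at h2
      obtain ⟨c, hc⟩ := h2
      have h3 := (mem_filter.1 h1).2 c
      simpa [D, hc] using h3

theorem exists_monochromatic_box (m t : ℕ) (κ : Type) [Fintype κ] (ε : ℝ) (hε : 0 < ε) :
    ∃ N₀ : ℕ, ∀ (X : Type) [Fintype X] (P : Finset (Fin m → X)) (χ : (Fin m → X) → κ),
      N₀ ≤ Fintype.card X → ε * (Fintype.card X : ℝ) ^ m ≤ P.card →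
      ∃ (f : Fin m × Fin t → X) (c : κ), Function.Injective f ∧
        ∀ g : Fin m → Fin t, (fun j => f (j, g j)) ∈ P ∧ χ (fun j => f (j, g j)) = c := by
  classical
  obtain ⟨N₁, h⟩ := exists_box (m * t) m (ε / (Fintype.card κ + 1)) (by positivity)
  refine ⟨max N₁ 1, fun X _ P χ hX hP => ?_⟩
  have hXpos : 0 < Fintype.card X := lt_of_lt_of_le one_pos ((le_max_right _ _).trans hX)
  have hpos : (0 : ℝ) < Fintype.card X := by exact_mod_cast hXpos
  have hc : ∃ c, ε / (Fintype.card κ + 1) * (Fintype.card X : ℝ) ^ m ≤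
      (P.filter fun ω => χ ω = c).card := by
    by_contra! hcon
    have h1 := card_eq_sum_card_fiberwise (s := P) (f := χ) (t := univ) (by simp)
    have h2 : (P.card : ℝ) ≤ ∑ c : κ, ε / (Fintype.card κ + 1) * (Fintype.card X : ℝ) ^ m := by
      rw [h1, Nat.cast_sum]
      exact sum_le_sum fun c _ => (hcon c).le
    rw [sum_const, nsmul_eq_mul, card_univ] at h2
    have h3 : 0 < ε / (Fintype.card κ + 1) * (Fintype.card X : ℝ) ^ m := by positivity
    have h4 : ε * (Fintype.card X : ℝ) ^ m =
        Fintype.card κ * (ε / (Fintype.card κ + 1) * (Fintype.card X : ℝ) ^ m) +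
          ε / (Fintype.card κ + 1) * (Fintype.card X : ℝ) ^ m := by
      field_simp
    linarith
  obtain ⟨c, hc⟩ := hc
  obtain ⟨Y, hY, hYP⟩ := h X _ ((le_max_left _ _).trans hX) hc
  obtain ⟨f, hf, hfY⟩ := (Finset.all_card_le_biUnion_card_iff_exists_injective
    (fun z : Fin m × Fin t => Y z.1)).1 (by
      intro s
      rcases s.eq_empty_or_nonempty with rfl | ⟨z, hz⟩
      · simp
      · calc s.card ≤ m * t := (card_le_univ s).trans (by simp)
          _ ≤ (Y z.1).card := by rw [hY]; omega
          _ ≤ _ := card_le_card (subset_biUnion_of_mem (fun z : Fin m × Fin t => Y z.1) hz))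
  exact ⟨f, c, hf, fun g => mem_filter.1 (hYP _ fun i => hfY _)⟩

end Box

section Sampling

/-- An exponential lower tail bound for sums of independent samples. -/
theorem card_lower_tail_le {ι X : Type} [Fintype ι] [DecidableEq ι] [Fintype X] (z : X → ℝ)
    (hz0 : ∀ x, 0 ≤ z x) (hz1 : ∀ x, z x ≤ 1) (μ γ : ℝ) (hγ0 : 0 ≤ γ) (hγ4 : γ ≤ 4)
    (hμ : μ * Fintype.card X ≤ ∑ x, z x) :
    ((univ.filter fun ω : ι → X => ∑ j, z (ω j) < (μ - γ / 2) * Fintype.card ι).card : ℝ) ≤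
      Real.exp (-(γ ^ 2 / 16) * Fintype.card ι) * (Fintype.card X : ℝ) ^ Fintype.card ι := by
  classical
  set n := Fintype.card ι with hn
  set N := Fintype.card X with hN
  have h1 : ∀ ω : ι → X, (if ∑ j, z (ω j) < (μ - γ / 2) * n then (1 : ℝ) else 0) ≤
      Real.exp (γ / 4 * ((μ - γ / 2) * n)) * ∏ j, Real.exp (-(γ / 4 * z (ω j))) := by
    intro ω
    rw [← Real.exp_sum, ← Real.exp_add, sum_neg_distrib, ← mul_sum]
    split_ifs with h
    · rw [← Real.exp_zero]
      apply Real.exp_le_exp.2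
      have : 0 ≤ γ / 4 * ((μ - γ / 2) * n - ∑ j, z (ω j)) :=
        mul_nonneg (by positivity) (by linarith)
      linarith
    · positivity
  have h2 : ∑ x, Real.exp (-(γ / 4 * z x)) ≤ N * Real.exp (-(γ / 4 * μ) + γ ^ 2 / 16) := by
    have h3 : ∀ x, Real.exp (-(γ / 4 * z x)) ≤ 1 - γ / 4 * z x + γ ^ 2 / 16 := by
      intro x
      have h4 : 0 ≤ γ / 4 * z x := mul_nonneg (by positivity) (hz0 x)
      have h5 : γ / 4 * z x ≤ γ / 4 := mul_le_of_le_one_right (by positivity) (hz1 x)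
      have h6 := Real.abs_exp_sub_one_sub_id_le (x := -(γ / 4 * z x)) (by
        rw [abs_neg, abs_of_nonneg h4]; linarith)
      have h7 := (abs_le.1 h6).2
      nlinarith
    calc ∑ x, Real.exp (-(γ / 4 * z x)) ≤ ∑ x, (1 - γ / 4 * z x + γ ^ 2 / 16) :=
          sum_le_sum fun x _ => h3 x
      _ = N - γ / 4 * ∑ x, z x + N * (γ ^ 2 / 16) := by
          rw [sum_add_distrib, sum_sub_distrib, ← mul_sum]
          simp [hN]
      _ ≤ N * (-(γ / 4 * μ) + γ ^ 2 / 16 + 1) := by nlinarith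
      _ ≤ _ := by gcongr; exact Real.add_one_le_exp _
  calc ((univ.filter fun ω : ι → X => ∑ j, z (ω j) < (μ - γ / 2) * n).card : ℝ)
      = ∑ ω : ι → X, if ∑ j, z (ω j) < (μ - γ / 2) * n then (1 : ℝ) else 0 := by
        rw [sum_boole]
    _ ≤ ∑ ω : ι → X, Real.exp (γ / 4 * ((μ - γ / 2) * n)) * ∏ j, Real.exp (-(γ / 4 * z (ω j))) :=
        sum_le_sum fun ω _ => h1 ω
    _ = Real.exp (γ / 4 * ((μ - γ / 2) * n)) * (∑ x, Real.exp (-(γ / 4 * z x))) ^ n := by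
        rw [← mul_sum]
        congr 1
        have := Finset.prod_univ_sum (fun _ : ι => (univ : Finset X))
          (fun _ x => Real.exp (-(γ / 4 * z x)))
        rw [Fintype.piFinset_univ, prod_const, card_univ] at this
        exact this.symm
    _ ≤ Real.exp (γ / 4 * ((μ - γ / 2) * n)) *
          (N * Real.exp (-(γ / 4 * μ) + γ ^ 2 / 16)) ^ n := by
        gcongr
    _ = _ := by
        rw [mul_pow, ← Real.exp_nat_mul, mul_left_comm, ← Real.exp_add, mul_comm]
        congr 2
        ring

/-- Bounding the size of a set of functions fibrewise over the restriction to some coordinates. -/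
theorem card_le_of_fiber_le {ι X : Type} [Fintype ι] [DecidableEq ι] [Fintype X]
    (p : ι → Prop) [DecidablePred p] (bad : (ι → X) → Prop) [DecidablePred bad] (c : ℝ)
    (h : ∀ τ : {i // p i} → X,
      ((univ.filter fun σ : {i // ¬ p i} → X =>
        bad ((Equiv.piEquivPiSubtypeProd p fun _ => X).symm (τ, σ))).card : ℝ) ≤
        c * (Fintype.card X : ℝ) ^ Fintype.card {i // ¬ p i}) :
    ((univ.filter bad).card : ℝ) ≤ c * (Fintype.card X : ℝ) ^ Fintype.card ι := by
  classical
  have h1 : (univ.filter bad).card = ∑ τ : {i // p i} → X,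
      (univ.filter fun σ : {i // ¬ p i} → X =>
        bad ((Equiv.piEquivPiSubtypeProd p fun _ => X).symm (τ, σ))).card := by
    simp_rw [card_filter]
    rw [← Fintype.sum_prod_type']
    exact (Fintype.sum_equiv (Equiv.piEquivPiSubtypeProd p fun _ => X).symm _ _ fun _ => rfl).symm
  rw [h1, Nat.cast_sum]
  refine (sum_le_sum fun τ _ => h τ).trans (le_of_eq ?_)
  rw [sum_const, nsmul_eq_mul, card_univ, Fintype.card_fun, mul_left_comm, Nat.cast_pow, ← pow_add]
  congr 2
  have := Fintype.card_subtype_compl p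
  have := Fintype.card_subtype_le p
  omega

end Sampling

section SampleGraph
variable {V : Type} [Fintype V] [DecidableEq V]

omit [Fintype V] in
theorem degS_le_card_insert [Fintype V] {k : ℕ} (hk : 0 < k) {E : Finset (Finset V)}
    (hE : IsKGraph k E) (S : Finset V) (hS : S.card = k - 1) :
    degS E S ≤ (univ.filter fun v => insert v S ∈ E).card := by
  have h : (E.filter fun e => S ⊆ e) ⊆
      (univ.filter fun v => insert v S ∈ E).image fun v => insert v S := by
    intro e he
    obtain ⟨he, hSe⟩ := mem_filter.1 he
    have h1 : (e \ S).card = 1 := by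
      rw [card_sdiff_of_subset hSe, hE e he, hS]; omega
    obtain ⟨v, hv⟩ := card_eq_one.1 h1
    have h2 : insert v S = e := by
      rw [insert_eq, ← hv, sdiff_union_of_subset hSe]
    exact mem_image.2 ⟨v, by simpa [h2] using he, h2⟩
  exact (card_le_card h).trans card_image_le

open Classical in
/-- The pullback of the `k`-graph `E` along `b`, restricted to edges meeting each block
`{j} × Fin s` at most once. -/
noncomputable def sampleGraph (k : ℕ) {m s : ℕ} (E : Finset (Finset V)) (b : Fin m × Fin s → V) :
    Finset (Finset (Fin m × Fin s)) :=
  univ.filter fun e => e.card = k ∧ Set.InjOn Prod.fst (e : Set (Fin m × Fin s)) ∧ e.image b ∈ E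

omit [Fintype V] in
theorem sum_le_card_sampleGraph {k m s : ℕ} (hk : 0 < k) (E : Finset (Finset V))
    (b : Fin m × Fin s → V) (S : Finset (Fin m × Fin s)) (hS : S.card = k - 1)
    (hinj : Set.InjOn Prod.fst (S : Set (Fin m × Fin s))) :
    ∑ j : {j // j ∉ S.image Prod.fst}, (univ.filter fun i => insert (b (j.1, i)) (S.image b) ∈ E).card
      ≤ (univ.filter fun v => insert v S ∈ sampleGraph k E b).card := by
  rw [← card_sigma]
  apply card_le_card_of_injOn (fun z => (z.1.1, z.2))
  · rintro ⟨⟨j, hj⟩, i⟩ h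
    simp only [coe_sigma, coe_univ, Set.mem_sigma_iff, Set.mem_univ, true_and, coe_filter, mem_univ,
      Set.mem_ofPred_eq] at h
    simp only [coe_filter, mem_univ, true_and, Set.mem_ofPred_eq, sampleGraph, mem_filter]
    have hjS : (j, i) ∉ S := fun hmem => hj (mem_image_of_mem Prod.fst hmem)
    refine ⟨by rw [card_insert_of_notMem hjS]; omega, ?_, by rwa [image_insert]⟩
    rw [coe_insert, Set.injOn_insert (by simpa using hjS)]
    refine ⟨hinj, ?_⟩
    rintro ⟨z, hz, hzj⟩
    exact hj (mem_image.2 ⟨z, hz, hzj⟩)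
  · rintro ⟨⟨j, hj⟩, i⟩ _ ⟨⟨j', hj'⟩, i'⟩ _ h
    simp only [Prod.mk.injEq] at h
    obtain ⟨rfl, rfl⟩ := h
    rfl

theorem degree_le_sum_blocks {X : Type} [Fintype X] {k s : ℕ} (hk : 0 < k) {E : Finset (Finset V)}
    (hE : IsKGraph k E) (B : X → Fin s → V) (hB : Function.Injective fun z : X × Fin s => B z.1 z.2)
    (hV : Fintype.card V ≤ s * Fintype.card X + s) (S : Finset V) (hS : S.card = k - 1) :
    degS E S ≤ ∑ x, (univ.filter fun i => insert (B x i) S ∈ E).card + s := by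
  refine (degS_le_card_insert hk hE S hS).trans ?_
  let I : Finset V := univ.image fun z : X × Fin s => B z.1 z.2
  have hI : I.card = s * Fintype.card X := by
    rw [card_image_of_injective _ hB, card_univ, Fintype.card_prod, Fintype.card_fin, mul_comm]
  have h1 : (univ.filter fun v => insert v S ∈ E) ⊆
      ((univ.sigma fun x => univ.filter fun i => insert (B x i) S ∈ E).image
        fun z => B z.1 z.2) ∪ Iᶜ := by
    intro v hv
    by_cases hvI : v ∈ I
    · obtain ⟨⟨x, i⟩, -, rfl⟩ := mem_image.1 hvI
      exact mem_union_left _ (mem_image.2 ⟨⟨x, i⟩, by simpa using hv, rfl⟩)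
    · exact mem_union_right _ (mem_compl.2 hvI)
  refine (card_le_card h1).trans ((card_union_le _ _).trans ?_)
  refine add_le_add (card_image_le.trans (card_sigma _ _).le) ?_
  rw [card_compl, hI]; omega

/-- For a fixed index set `S`, few samples `ω` have small degree at `S`. -/
theorem card_small_degree_le {X : Type} [Fintype X] [DecidableEq X] {k m s : ℕ} (hk : 0 < k)
    (hs : 0 < s) {E : Finset (Finset V)} (hE : IsKGraph k E) {γ : ℝ} (hγ0 : 0 < γ) (hγ1 : γ ≤ 1)
    (hdeg : ∀ S : Finset V, S.card = k - 1 →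
      ((1 : ℝ) / 2 + 1 / (2 * (s : ℝ)) + γ) * (Fintype.card V : ℝ) ≤ (degS E S : ℝ))
    (hm : 2 * k ≤ m) (hmγ : k ≤ γ / 4 * (m - k))
    (B : X → Fin s → V) (hB : Function.Injective fun z : X × Fin s => B z.1 z.2)
    (hV : s * Fintype.card X ≤ Fintype.card V) (hV' : Fintype.card V ≤ s * Fintype.card X + s)
    (hX : 4 / γ ≤ Fintype.card X) (S : Finset (Fin m × Fin s)) (hS : S.card = k - 1)
    (hinj : Set.InjOn Prod.fst (S : Set (Fin m × Fin s))) :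
    ((univ.filter fun ω : Fin m → X => Function.Injective ω ∧
      ((univ.filter fun v => insert v S ∈ sampleGraph k E fun z => B (ω z.1) z.2).card : ℝ) <
        (1 / 2 + 1 / (2 * (s : ℝ))) * (m * s)).card : ℝ) ≤
      Real.exp (-(γ ^ 2 / 32) * m) * (Fintype.card X : ℝ) ^ m := by
  classical
  have hsR : (0 : ℝ) < s := by exact_mod_cast hs
  set δ : ℝ := (1 : ℝ) / 2 + 1 / (2 * (s : ℝ)) with hδ
  have hδ0 : 0 < δ := by positivity
  have hδ1 : δ ≤ 1 := by
    have : (1 : ℝ) ≤ s := by exact_mod_cast hs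
    have : 1 / (2 * (s : ℝ)) ≤ 1 / 2 := by
      rw [div_le_div_iff₀ (by positivity) (by positivity)]; linarith
    linarith
  set J := S.image Prod.fst with hJ
  have hJc : J.card = k - 1 := by rw [hJ, card_image_of_injOn hinj, hS]
  have hJ' : Fintype.card {j // j ∉ J} = m - (k - 1) := by
    rw [Fintype.card_subtype_compl, Fintype.card_fin, Fintype.card_coe, hJc]
  have hJR : (Fintype.card {j // j ∉ J} : ℝ) = m - (k - 1) := by
    rw [hJ', Nat.cast_sub (by omega), Nat.cast_sub (by omega), Nat.cast_one]
  have key := card_le_of_fiber_le (ι := Fin m) (X := X) (fun j => j ∈ J)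
    (fun ω : Fin m → X => Function.Injective ω ∧
      ((univ.filter fun v => insert v S ∈ sampleGraph k E fun z => B (ω z.1) z.2).card : ℝ) <
        δ * (m * s)) (Real.exp (-(γ ^ 2 / 32) * m)) (by
    intro τ
    set ω : ({j // j ∉ J} → X) → Fin m → X := fun σ =>
      (Equiv.piEquivPiSubtypeProd (fun j => j ∈ J) fun _ => X).symm (τ, σ) with hω
    have hωJ : ∀ σ j (hj : j ∈ J), ω σ j = τ ⟨j, hj⟩ := by
      intro σ j hj; simp [ω, Equiv.piEquivPiSubtypeProd, hj]
    have hωJ' : ∀ σ j (hj : j ∉ J), ω σ j = σ ⟨j, hj⟩ := by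
      intro σ j hj; simp [ω, Equiv.piEquivPiSubtypeProd, hj]
    by_cases hτ : Function.Injective τ
    swap
    · rw [filter_eq_empty_iff.2, card_empty]
      · rw [Nat.cast_zero]; positivity
      · rintro σ - ⟨h, -⟩
        replace h : Function.Injective (ω σ) := h
        apply hτ
        intro a b hab
        apply Subtype.ext
        apply h
        rw [hωJ σ _ a.2, hωJ σ _ b.2]; exact hab
    let Sτ : Finset V := S.attach.image fun z =>
      B (τ ⟨z.1.1, mem_image_of_mem Prod.fst z.2⟩) z.1.2
    have hSω : ∀ σ, S.image (fun z => B (ω σ z.1) z.2) = Sτ := by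
      intro σ
      ext v
      simp only [Sτ, mem_image, mem_attach, true_and, Subtype.exists]
      constructor
      · rintro ⟨z, hz, rfl⟩
        exact ⟨z, hz, by rw [hωJ σ _ (mem_image_of_mem Prod.fst hz)]⟩
      · rintro ⟨z, hz, rfl⟩
        exact ⟨z, hz, by rw [hωJ σ _ (mem_image_of_mem Prod.fst hz)]⟩
    have hSτ : Sτ.card = k - 1 := by
      rw [← hS, ← card_attach (s := S)]
      apply card_image_of_injective
      intro z z' h
      have h1 := hB (a₁ := (τ ⟨z.1.1, mem_image_of_mem Prod.fst z.2⟩, z.1.2))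
        (a₂ := (τ ⟨z'.1.1, mem_image_of_mem Prod.fst z'.2⟩, z'.1.2)) h
      obtain ⟨h2, h3⟩ := Prod.mk.inj h1
      exact Subtype.ext (Prod.ext (congrArg Subtype.val (hτ h2)) h3)
    let z : X → ℝ := fun x => ((univ.filter fun i => insert (B x i) Sτ ∈ E).card : ℝ) / s
    have hz0 : ∀ x, 0 ≤ z x := fun x => by positivity
    have hz1 : ∀ x, z x ≤ 1 := fun x => by
      rw [div_le_one hsR]
      have : (univ.filter fun i => insert (B x i) Sτ ∈ E).card ≤ s := (card_le_univ _).trans (by simp)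
      exact_mod_cast this
    have hmean : (δ + 3 / 4 * γ) * Fintype.card X ≤ ∑ x, z x := by
      have h1 : (degS E Sτ : ℝ) ≤
          ∑ x, ((univ.filter fun i => insert (B x i) Sτ ∈ E).card : ℝ) + s := by
        exact_mod_cast degree_le_sum_blocks hk hE B hB hV' Sτ hSτ
      have h2 := hdeg Sτ hSτ
      have h3 : (s : ℝ) * Fintype.card X ≤ Fintype.card V := by exact_mod_cast hV
      have h4 : (δ + γ) * (s * Fintype.card X) ≤ (δ + γ) * Fintype.card V := by gcongr
      rw [← sum_div, le_div_iff₀ hsR]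
      rw [div_le_iff₀ hγ0] at hX
      nlinarith
    have htail := card_lower_tail_le (ι := {j // j ∉ J}) z hz0 hz1 _ γ hγ0.le (by linarith) hmean
    refine le_trans ?_ (htail.trans ?_)
    · refine Nat.cast_le.2 (card_le_card ?_)
      intro σ hσ
      simp only [mem_filter, mem_univ, true_and] at hσ ⊢
      have h1 := sum_le_card_sampleGraph hk E (fun z => B (ω σ z.1) z.2) S hS hinj
      have h2 : ∑ j : {j // j ∉ J}, z (σ j) * s ≤
          ((univ.filter fun v => insert v S ∈ sampleGraph k E fun z => B (ω σ z.1) z.2).card : ℝ) := by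
        refine le_trans (le_of_eq ?_) (Nat.cast_le.2 h1)
        rw [Nat.cast_sum]
        apply sum_congr rfl
        intro j _
        simp only [z]
        rw [div_mul_cancel₀ _ hsR.ne', hSω, hωJ' σ j.1 j.2]
      rw [← sum_mul] at h2
      have h3 := h2.trans_lt hσ.2
      rw [← mul_assoc] at h3
      have h4 : ∑ j : {j // j ∉ J}, z (σ j) < δ * m := lt_of_mul_lt_mul_right h3 hsR.le
      refine h4.trans_le ?_
      rw [hJR]
      have hk' : (0 : ℝ) ≤ k := by positivity
      nlinarith
    · refine mul_le_mul_of_nonneg_right (Real.exp_le_exp.2 ?_) (by positivity)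
      rw [hJR]
      have : (2 : ℝ) * k ≤ m := by exact_mod_cast hm
      have h5 : 0 ≤ γ ^ 2 := sq_nonneg γ
      nlinarith)
  rw [Fintype.card_fin] at key
  convert key

end SampleGraph

section GoodSamples
open Filter in
theorem exists_sample_size (k s : ℕ) {γ η : ℝ} (hγ : 0 < γ) (hη : 0 < η) :
    ∃ m : ℕ, 2 * k ≤ m ∧ (k : ℝ) ≤ γ / 4 * (m - k) ∧
      ((m : ℝ) * s) ^ (k - 1) * Real.exp (-(γ ^ 2 / 32) * m) ≤ 1 / 6 ∧
      Real.exp (-η ^ 2 * m) ≤ 1 / 6 ∧ (k : ℝ) ≤ η * m := by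
  have hlin : ∀ c d : ℝ, 0 < c → ∀ᶠ m : ℕ in atTop, d ≤ c * m := fun c d hc =>
    (tendsto_natCast_atTop_atTop.const_mul_atTop hc).eventually_ge_atTop d
  have hr : ∀ c : ℝ, 0 < c → ‖Real.exp (-c)‖ < 1 := by
    intro c hc
    rw [Real.norm_eq_abs, Real.abs_exp]
    simpa using hc
  have hexp : ∀ c : ℝ, ∀ m : ℕ, Real.exp (-c * m) = Real.exp (-c) ^ m := by
    intro c m
    rw [← Real.exp_nat_mul, mul_comm]
  have h3 := ((tendsto_pow_const_mul_const_pow_of_abs_lt_one (k - 1)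
    (hr (γ ^ 2 / 32) (by positivity))).const_mul ((s : ℝ) ^ (k - 1)))
  have h4 := tendsto_pow_atTop_nhds_zero_of_norm_lt_one (hr (η ^ 2) (by positivity))
  rw [mul_zero] at h3
  have e3 := h3.eventually_le_const (by norm_num : (0 : ℝ) < 1 / 6)
  have e4 := h4.eventually_le_const (by norm_num : (0 : ℝ) < 1 / 6)
  obtain ⟨m, h1, h2, h3, h4, h5⟩ := ((eventually_ge_atTop (2 * k)).and
    ((hlin (γ / 4) (k + γ / 4 * k) (by positivity)).and (e3.and (e4.and (hlin η k hη))))).exists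
  refine ⟨m, h1, by linarith, ?_, ?_, h5⟩
  · rw [hexp, mul_pow]
    refine le_trans (le_of_eq ?_) h3
    ring
  · rw [hexp]; exact h4

variable {V : Type} [Fintype V] [DecidableEq V]

theorem card_good_samples_ge {X : Type} [Fintype X] [DecidableEq X] {k m s : ℕ} (hk : 0 < k)
    (hs : 0 < s) {E : Finset (Finset V)} (hE : IsKGraph k E) {γ η : ℝ} (hγ0 : 0 < γ) (hγ1 : γ ≤ 1)
    (hη0 : 0 < η) (hη1 : η ≤ 1)
    (hdeg : ∀ S : Finset V, S.card = k - 1 →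
      ((1 : ℝ) / 2 + 1 / (2 * (s : ℝ)) + γ) * (Fintype.card V : ℝ) ≤ (degS E S : ℝ))
    (hm : 2 * k ≤ m) (hmγ : (k : ℝ) ≤ γ / 4 * (m - k))
    (hmS : ((m : ℝ) * s) ^ (k - 1) * Real.exp (-(γ ^ 2 / 32) * m) ≤ 1 / 6)
    (hmη : Real.exp (-η ^ 2 * m) ≤ 1 / 6)
    (B : X → Fin s → V) (hB : Function.Injective fun z : X × Fin s => B z.1 z.2)
    (hV : s * Fintype.card X ≤ Fintype.card V) (hV' : Fintype.card V ≤ s * Fintype.card X + s)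
    (hX : 4 / γ ≤ Fintype.card X) (hXm : 6 * m ^ 2 ≤ Fintype.card X)
    (G : Finset X) (hG : 3 * η * Fintype.card X ≤ Gᶜ.card) :
    1 / 2 * (Fintype.card X : ℝ) ^ m ≤ ((univ.filter fun ω : Fin m → X => Function.Injective ω ∧
      (∀ S : Finset (Fin m × Fin s), S.card = k - 1 →
        Set.InjOn Prod.fst (S : Set (Fin m × Fin s)) →
        (1 / 2 + 1 / (2 * (s : ℝ))) * (m * s) ≤
          ((univ.filter fun v => insert v S ∈ sampleGraph k E fun z => B (ω z.1) z.2).card : ℝ)) ∧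
      η * m ≤ (univ.filter fun j => ω j ∉ G).card).card : ℝ) := by
  classical
  set N := Fintype.card X with hN
  set good := univ.filter fun ω : Fin m → X => Function.Injective ω ∧
      (∀ S : Finset (Fin m × Fin s), S.card = k - 1 →
        Set.InjOn Prod.fst (S : Set (Fin m × Fin s)) →
        (1 / 2 + 1 / (2 * (s : ℝ))) * (m * s) ≤
          ((univ.filter fun v => insert v S ∈ sampleGraph k E fun z => B (ω z.1) z.2).card : ℝ)) ∧
      η * m ≤ (univ.filter fun j => ω j ∉ G).card with hgood
  let bad₁ := univ.filter fun ω : Fin m → X => ¬ Function.Injective ω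
  let bad₂ : Finset (Fin m × Fin s) → Finset (Fin m → X) := fun S =>
    univ.filter fun ω => Function.Injective ω ∧
      ((univ.filter fun v => insert v S ∈ sampleGraph k E fun z => B (ω z.1) z.2).card : ℝ) <
        (1 / 2 + 1 / (2 * (s : ℝ))) * (m * s)
  let bad₃ := univ.filter fun ω : Fin m → X =>
    ∑ j, (if ω j ∉ G then (1 : ℝ) else 0) < (3 * η - 4 * η / 2) * Fintype.card (Fin m)
  let 𝒮 : Finset (Finset (Fin m × Fin s)) := (powersetCard (k - 1) univ).filter fun S =>
    Set.InjOn Prod.fst (S : Set (Fin m × Fin s))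
  have hcover : (univ : Finset (Fin m → X)) ⊆ good ∪ (bad₁ ∪ (𝒮.biUnion bad₂ ∪ bad₃)) := by
    intro ω _
    by_contra hcon
    simp only [mem_union, not_or] at hcon
    obtain ⟨h0, h1, h2, h3⟩ := hcon
    apply h0
    simp only [bad₁, mem_filter, mem_univ, true_and, not_not] at h1
    simp only [hgood, mem_filter, mem_univ, true_and]
    refine ⟨h1, ?_, ?_⟩
    · intro S hS hinj
      by_contra hlt
      apply h2
      refine mem_biUnion.2 ⟨S, ?_, ?_⟩
      · exact mem_filter.2 ⟨mem_powersetCard.2 ⟨subset_univ _, hS⟩, hinj⟩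
      · simp only [bad₂, mem_filter, mem_univ, true_and]
        exact ⟨h1, not_le.1 hlt⟩
    · simp only [bad₃, mem_filter, mem_univ, true_and, not_lt, Fintype.card_fin, sum_boole] at h3
      linarith
  have hm0 : 0 < m := by omega
  have hNpos : (0 : ℝ) < N := by
    have : 0 < 6 * m ^ 2 := by positivity
    exact_mod_cast this.trans_le hXm
  have hb1 : (bad₁.card : ℝ) ≤ 1 / 6 * (N : ℝ) ^ m := by
    have h1 : (bad₁.card : ℝ) * N ≤ m ^ 2 * (N : ℝ) ^ m := by
      exact_mod_cast card_not_injective_mul_le m X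
    have h2 : (6 : ℝ) * m ^ 2 ≤ N := by exact_mod_cast hXm
    have h3 : (bad₁.card : ℝ) * N ≤ (1 / 6 * (N : ℝ) ^ m) * N := by
      refine h1.trans ?_
      have : 0 < (N : ℝ) ^ m := by positivity
      nlinarith
    exact le_of_mul_le_mul_right h3 hNpos
  have hb2 : ((𝒮.biUnion bad₂).card : ℝ) ≤ 1 / 6 * (N : ℝ) ^ m := by
    have h1 : ∀ S ∈ 𝒮, ((bad₂ S).card : ℝ) ≤ Real.exp (-(γ ^ 2 / 32) * m) * (N : ℝ) ^ m := by
      intro S hS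
      obtain ⟨hS, hinj⟩ := mem_filter.1 hS
      convert card_small_degree_le hk hs hE hγ0 hγ1 hdeg hm hmγ B hB hV hV' hX S
        (mem_powersetCard.1 hS).2 hinj
    have h2 : (𝒮.card : ℝ) ≤ ((m : ℝ) * s) ^ (k - 1) := by
      have : 𝒮.card ≤ (m * s) ^ (k - 1) := by
        refine (card_filter_le _ _).trans ?_
        rw [card_powersetCard, card_univ, Fintype.card_prod, Fintype.card_fin, Fintype.card_fin]
        exact Nat.choose_le_pow _ _
      exact_mod_cast this
    calc ((𝒮.biUnion bad₂).card : ℝ) ≤ ∑ S ∈ 𝒮, ((bad₂ S).card : ℝ) := by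
          exact_mod_cast card_biUnion_le
      _ ≤ 𝒮.card * (Real.exp (-(γ ^ 2 / 32) * m) * (N : ℝ) ^ m) := by
          refine (sum_le_sum h1).trans ?_
          rw [sum_const, nsmul_eq_mul]
      _ ≤ ((m : ℝ) * s) ^ (k - 1) * (Real.exp (-(γ ^ 2 / 32) * m) * (N : ℝ) ^ m) := by gcongr
      _ ≤ _ := by rw [← mul_assoc]; gcongr
  have hb3 : (bad₃.card : ℝ) ≤ 1 / 6 * (N : ℝ) ^ m := by
    have h1 := card_lower_tail_le (ι := Fin m) (fun x => if x ∉ G then (1 : ℝ) else 0)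
      (fun x => by split_ifs <;> simp) (fun x => by split_ifs <;> simp) (3 * η) (4 * η)
      (by positivity) (by linarith) (by
        rw [sum_boole]
        rw [show (univ.filter fun x => x ∉ G) = Gᶜ by ext; simp]
        exact hG)
    rw [Fintype.card_fin] at h1
    simp only [bad₃, Fintype.card_fin]
    refine h1.trans ?_
    gcongr
    refine le_trans (le_of_eq ?_) hmη
    congr 1; ring
  have htot : (N : ℝ) ^ m ≤ good.card + (bad₁.card + ((𝒮.biUnion bad₂).card + bad₃.card)) := by
    have h1 := card_le_card hcover
    rw [card_univ, Fintype.card_fun, Fintype.card_fin, ← hN] at h1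
    have h2 := card_union_le good (bad₁ ∪ (𝒮.biUnion bad₂ ∪ bad₃))
    have h3 := card_union_le bad₁ (𝒮.biUnion bad₂ ∪ bad₃)
    have h4 := card_union_le (𝒮.biUnion bad₂) bad₃
    have : N ^ m ≤ good.card + (bad₁.card + ((𝒮.biUnion bad₂).card + bad₃.card)) := by omega
    exact_mod_cast this
  linarith

end GoodSamples

section Assembly
variable {V : Type} [Fintype V] [DecidableEq V]

omit [Fintype V] in
theorem spansCs_image_of_isClosedWalk {k s : ℕ} (hs : 0 < s) (hks : k ≤ s) {E : Finset (Finset V)}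
    (a : Fin s → V) (ha : Function.Injective a) (hE : IsClosedWalk k s hs E a) :
    SpansCs k s E (univ.image a) := by
  refine ⟨List.ofFn a, by simp, ⟨List.nodup_ofFn.2 ha, ?_⟩, ?_⟩
  · intro i hi
    rw [List.length_ofFn] at hi
    convert hE i hi using 1
    have hget : ∀ q, i + q < s + s → (List.ofFn a ++ List.ofFn a)[i + q]? =
        some (a ⟨(i + q) % s, Nat.mod_lt _ hs⟩) := by
      intro q hq
      rcases lt_or_ge (i + q) s with h | h
      · rw [List.getElem?_append_left (by simpa using h), List.getElem?_ofFn, dif_pos h]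
        simp [Nat.mod_eq_of_lt h]
      · rw [List.getElem?_append_right (by simpa using h), List.getElem?_ofFn, List.length_ofFn,
          dif_pos (by omega)]
        simp [Nat.mod_eq_sub_mod h, Nat.mod_eq_of_lt (by omega : i + q - s < s)]
    ext x
    simp only [List.mem_toFinset, mem_image, mem_range, List.mem_iff_getElem?]
    constructor
    · rintro ⟨q, hq⟩
      rw [List.getElem?_take] at hq
      split_ifs at hq with hqk
      rw [List.getElem?_drop, hget q (by omega)] at hq
      exact ⟨q, hqk, Option.some.inj hq⟩
    · rintro ⟨q, hqk, rfl⟩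
      refine ⟨q, ?_⟩
      rw [List.getElem?_take, if_pos hqk, List.getElem?_drop, hget q (by omega)]
  · ext x; simp

omit [Fintype V] in
theorem card_eq_of_spansCs {k s : ℕ} {E : Finset (Finset V)} {A : Finset V}
    (h : SpansCs k s E A) : A.card = s := by
  obtain ⟨C, hC, hT, rfl⟩ := h
  rw [List.toFinset_card_of_nodup hT.1, hC]

omit [Fintype V] in
theorem card_biUnion_of_isCsTiling {k s : ℕ} {E : Finset (Finset V)} {T : Finset (Finset V)}
    (hT : IsCsTiling k s E T) : (T.biUnion id).card = s * T.card := by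
  rw [card_biUnion fun A hA B hB hAB => hT.1 hA hB hAB,
    sum_congr rfl fun A hA => card_eq_of_spansCs (A := id A) (hT.2 A hA), sum_const, smul_eq_mul,
    mul_comm]

/-- The tiles of a tiling, together with blocks of uncovered vertices, partition almost all
vertices into blocks of size `s`. -/
theorem exists_blocks {k s : ℕ} (hs : 0 < s) {E : Finset (Finset V)} {T : Finset (Finset V)}
    (hT : IsCsTiling k s E T) :
    ∃ (q : ℕ) (B : {A // A ∈ T} ⊕ Fin q → Fin s → V),
      (Function.Injective fun z : ({A // A ∈ T} ⊕ Fin q) × Fin s => B z.1 z.2) ∧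
      (∀ A, univ.image (B (Sum.inl A)) = A.1) ∧
      s * (T.card + q) ≤ Fintype.card V ∧ Fintype.card V < s * (T.card + q) + s := by
  let U := (T.biUnion id)ᶜ
  have hU : U.card + s * T.card = Fintype.card V := by
    rw [← card_biUnion_of_isCsTiling hT, card_compl_add_card]
  let q := U.card / s
  have hq1 : q * s ≤ U.card := Nat.div_mul_le_self _ _
  have hq2 : U.card < s * (q + 1) := Nat.lt_mul_div_succ _ hs
  obtain ⟨e⟩ : Nonempty (Fin q × Fin s ↪ U) :=
    Function.Embedding.nonempty_of_card_le (by simpa using hq1)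
  let F : ∀ A : {A // A ∈ T}, Fin s ≃ A.1 := fun A =>
    (A.1.equivFinOfCardEq (card_eq_of_spansCs (hT.2 A.1 A.2))).symm
  have hmem : ∀ A i, (F A i : V) ∈ T.biUnion id := fun A i =>
    mem_biUnion.2 ⟨A.1, A.2, (F A i).2⟩
  have hmem' : ∀ z, (e z : V) ∉ T.biUnion id := fun z => mem_compl.1 (e z).2
  refine ⟨q, Sum.elim (fun A i => (F A i : V)) (fun c i => (e (c, i) : V)), ?_, ?_, ?_, ?_⟩
  · rintro ⟨A | c, i⟩ ⟨A' | c', i'⟩ h <;> simp only [Sum.elim_inl, Sum.elim_inr] at h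
    · have hA : A = A' := by
        by_contra hne
        have hd : Disjoint A.1 A'.1 := hT.1 A.2 A'.2 fun h => hne (Subtype.ext h)
        exact disjoint_left.1 hd (F A i).2 (h ▸ (F A' i').2)
      subst hA
      rw [(F A).injective (Subtype.ext h)]
    · exact absurd (h ▸ hmem A i) (hmem' _)
    · exact absurd (h.symm ▸ hmem A' i') (hmem' _)
    · have := e.injective (Subtype.ext h)
      simp only [Prod.mk.injEq] at this
      rw [this.1, this.2]
  · intro A
    ext v
    simp only [Sum.elim_inl, mem_image, mem_univ, true_and]
    constructor
    · rintro ⟨i, rfl⟩; exact (F A i).2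
    · intro hv; exact ⟨(F A).symm ⟨v, hv⟩, by simp⟩
  · rw [mul_add, mul_comm s q]; omega
  · rw [mul_add, mul_comm s q]
    rw [mul_add, mul_one, mul_comm s q] at hq2
    omega

omit [Fintype V] in
theorem exists_larger_tiling {k s m t q : ℕ} (hs : 0 < s) (hks : k ≤ s) {E T : Finset (Finset V)}
    (hT : IsCsTiling k s E T) (B : {A // A ∈ T} ⊕ Fin q → Fin s → V)
    (hB : Function.Injective fun z : ({A // A ∈ T} ⊕ Fin q) × Fin s => B z.1 z.2)
    (hBT : ∀ A, univ.image (B (Sum.inl A)) = A.1) (ht : 0 < t)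
    (f : Fin m × Fin t → {A // A ∈ T} ⊕ Fin q) (hf : Function.Injective f)
    (R : Finset (Finset (Fin m × Fin s)))
    (hR : ∀ g : Fin m → Fin t, sampleGraph k E (fun z => B (f (z.1, g z.1)) z.2) = R)
    (J : Finset (Fin m)) (hJ : ∀ z A, f z = Sum.inl A → z.1 ∉ J)
    {I : Type} [Fintype I] (g : I × Fin s → (Fin m × Fin s) × Fin t) (hg : Function.Injective g)
    (hwalk : ∀ x, IsClosedWalk k s hs R fun p => (g (x, p)).1) (hI : (m - J.card) * t < Fintype.card I) :
    ∃ T' : Finset (Finset V), IsCsTiling k s E T' ∧ T.card < T'.card := by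
  classical
  let φ : I × Fin s → V := fun z => B (f ((g z).1.1, (g z).2)) (g z).1.2
  have hφ : Function.Injective φ := by
    intro z z' h
    have h1 := hB (a₁ := (f ((g z).1.1, (g z).2), (g z).1.2))
      (a₂ := (f ((g z').1.1, (g z').2), (g z').1.2)) h
    obtain ⟨h2, h3⟩ := Prod.mk.inj h1
    obtain ⟨h4, h5⟩ := Prod.mk.inj (hf h2)
    exact hg (Prod.ext (Prod.ext h4 h3) h5)
  have hφw : ∀ x, IsClosedWalk k s hs E fun p => φ (x, p) := by
    intro x i hi
    let pos : ℕ → Fin s := fun p => ⟨(i + p) % s, Nat.mod_lt _ hs⟩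
    have he : ((range k).image fun p => (g (x, pos p)).1) ∈ R := hwalk x i hi
    have he' := he
    rw [← hR fun _ => ⟨0, ht⟩] at he'
    obtain ⟨hcard, hinj, -⟩ := (mem_filter.1 he').2
    have hinj1 : Set.InjOn (fun p => (g (x, pos p)).1) (range k : Set ℕ) := by
      apply card_image_iff.1
      rw [hcard, card_range]
    let h : Fin k → Fin m := fun p => (g (x, pos p)).1.1
    have hh : Function.Injective h := by
      intro p p' hp
      have hp1 : (p : ℕ) ∈ range k := mem_range.2 p.2
      have hp2 : (p' : ℕ) ∈ range k := mem_range.2 p'.2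
      have := hinj (mem_coe.2 (mem_image_of_mem (fun p => (g (x, pos p)).1) hp1))
        (mem_coe.2 (mem_image_of_mem (fun p => (g (x, pos p)).1) hp2)) hp
      exact Fin.ext (hinj1 (mem_coe.2 hp1) (mem_coe.2 hp2) this)
    let lab : Fin m → Fin t := Function.extend h (fun p => (g (x, pos p)).2) fun _ => ⟨0, ht⟩
    have hlab : ∀ p (_ : p < k), lab (g (x, pos p)).1.1 = (g (x, pos p)).2 := fun p hp =>
      hh.extend_apply (fun p : Fin k => (g (x, pos p)).2) (fun _ => ⟨0, ht⟩) ⟨p, hp⟩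
    rw [← hR lab] at he
    have := (mem_filter.1 he).2.2.2
    rw [image_image] at this
    convert this using 1
    apply image_congr
    intro p hp
    simp only [Function.comp_apply, φ]
    rw [hlab p (mem_range.1 (mem_coe.1 hp))]
  let D : I → Finset V := fun x => univ.image fun p => φ (x, p)
  have hDspan : ∀ x, SpansCs k s E (D x) := fun x =>
    spansCs_image_of_isClosedWalk hs hks _ (fun p p' h => (Prod.mk.inj (hφ h)).2) (hφw x)
  have hDdisj : ∀ x x', x ≠ x' → Disjoint (D x) (D x') := by
    intro x x' hne
    rw [disjoint_left]
    intro v hv hv'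
    obtain ⟨p, -, rfl⟩ := mem_image.1 hv
    obtain ⟨p', -, h⟩ := mem_image.1 hv'
    exact hne (Prod.mk.inj (hφ h)).1.symm
  have hne : ∀ A : Finset V, SpansCs k s E A → A.Nonempty := fun A hA => by
    rw [← card_pos, card_eq_of_spansCs hA]; exact hs
  have hDinj : Function.Injective D := by
    intro x x' h
    by_contra hxx
    have h1 := hDdisj x x' hxx
    rw [h, disjoint_self, bot_eq_empty] at h1
    exact (hne _ (hDspan x')).ne_empty h1
  let rem : Finset (Finset V) := T.filter fun A => ∃ z, ∃ hA : A ∈ T, f z = Sum.inl ⟨A, hA⟩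
  have hrem : rem.card ≤ (m - J.card) * t := by
    have hsub : rem ⊆ (Jᶜ ×ˢ (univ : Finset (Fin t))).image
        fun z => Sum.elim (fun A => A.1) (fun _ => ∅) (f z) := by
      intro A hA
      obtain ⟨hA, z, hA', hz⟩ := mem_filter.1 hA
      refine mem_image.2 ⟨z, ?_, by rw [hz]; rfl⟩
      simpa using hJ z _ hz
    refine (card_le_card hsub).trans (card_image_le.trans ?_)
    rw [card_product, card_compl, card_univ, Fintype.card_fin, Fintype.card_fin]
  have hDT : ∀ x, ∀ A ∈ T \ rem, Disjoint (D x) A := by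
    intro x A hA
    obtain ⟨hAT, hAr⟩ := mem_sdiff.1 hA
    rw [disjoint_left]
    intro v hv hvA
    obtain ⟨p, -, rfl⟩ := mem_image.1 hv
    have hvB : φ (x, p) ∈ univ.image (B (Sum.inl ⟨A, hAT⟩)) := by rw [hBT]; exact hvA
    obtain ⟨i, -, hi⟩ := mem_image.1 hvB
    have h1 := hB (a₁ := (Sum.inl ⟨A, hAT⟩, i))
      (a₂ := (f ((g (x, p)).1.1, (g (x, p)).2), (g (x, p)).1.2)) hi
    exact hAr (mem_filter.2 ⟨hAT, _, hAT, (Prod.mk.inj h1).1.symm⟩)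
  refine ⟨(T \ rem) ∪ univ.image D, ⟨?_, ?_⟩, ?_⟩
  · intro A hA A' hA' hAA
    rcases mem_union.1 (mem_coe.1 hA) with h | h <;>
      rcases mem_union.1 (mem_coe.1 hA') with h' | h'
    · exact hT.1 (mem_sdiff.1 h).1 (mem_sdiff.1 h').1 hAA
    · obtain ⟨x, -, rfl⟩ := mem_image.1 h'
      exact (hDT x A h).symm
    · obtain ⟨x, -, rfl⟩ := mem_image.1 h
      exact hDT x A' h'
    · obtain ⟨x, -, rfl⟩ := mem_image.1 h
      obtain ⟨x', -, rfl⟩ := mem_image.1 h'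
      exact hDdisj x x' fun h => hAA (by rw [h])
  · intro A hA
    rcases mem_union.1 hA with h | h
    · exact hT.2 A (mem_sdiff.1 h).1
    · obtain ⟨x, -, rfl⟩ := mem_image.1 h
      exact hDspan x
  · have hd : Disjoint (T \ rem) (univ.image D) := by
      rw [disjoint_left]
      intro A hA hA'
      obtain ⟨x, -, rfl⟩ := mem_image.1 hA'
      have h1 := hDT x _ hA
      rw [disjoint_self, bot_eq_empty] at h1
      exact (hne _ (hDspan x)).ne_empty h1
    rw [card_union_of_disjoint hd, card_image_of_injective _ hDinj, card_univ,
      card_sdiff_of_subset (filter_subset _ _)]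
    have := card_filter_le T fun A => ∃ z, ∃ hA : A ∈ T, f z = Sum.inl ⟨A, hA⟩
    change rem.card ≤ T.card at this
    change T.card < T.card - rem.card + Fintype.card I
    omega

end Assembly

theorem exists_tiling_card_lt {k s : ℕ} (hk : 3 ≤ k) (hs : 5 * k ^ 2 ≤ s) {α γ : ℝ} (hα : 0 < α)
    (hα1 : α ≤ 1) (hγ : 0 < γ) (hγ1 : γ ≤ 1) :
    ∃ n₀ : ℕ, ∀ (V : Type) [Fintype V] [DecidableEq V] (E : Finset (Finset V)),
      IsKGraph k E → n₀ ≤ Fintype.card V →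
      (∀ S : Finset V, S.card = k - 1 →
        ((1 : ℝ) / 2 + 1 / (2 * (s : ℝ)) + γ) * (Fintype.card V : ℝ) ≤ (degS E S : ℝ)) →
      ∀ T : Finset (Finset V), IsCsTiling k s E T →
        ((T.biUnion id).card : ℝ) < (1 - α) * (Fintype.card V : ℝ) →
        ∃ T' : Finset (Finset V), IsCsTiling k s E T' ∧ T.card < T'.card := by
  classical
  have hks : k ≤ s := by nlinarith
  have hs0 : 0 < s := by omega
  have hsR : (0 : ℝ) < s := by exact_mod_cast hs0
  obtain ⟨m, hm, hmγ, hmS, hmη, hmk⟩ := exists_sample_size k s hγ (η := α / 4) (by positivity)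
  let t := (m * s) ^ s + 1
  have ht : 0 < t := Nat.succ_pos _
  obtain ⟨N₁, hbox⟩ := exists_monochromatic_box m t
    (Finset (Finset (Fin m × Fin s)) × Finset (Fin m)) (1 / 2) (by norm_num)
  let N := N₁ + ⌈4 / γ⌉₊ + 6 * m ^ 2 + ⌈4 / α⌉₊
  refine ⟨s * (N + 1), fun V _ _ E hE hn hdeg T hT hcov => ?_⟩
  obtain ⟨q, B, hB, hBT, hV, hV'⟩ := exists_blocks hs0 hT
  have hX : Fintype.card ({A // A ∈ T} ⊕ Fin q) = T.card + q := by simp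
  rw [← hX] at hV hV'
  have hXN : N ≤ Fintype.card ({A // A ∈ T} ⊕ Fin q) := by
    have : s * (N + 1) < s * (Fintype.card ({A // A ∈ T} ⊕ Fin q) + 1) := by
      rw [mul_add s (Fintype.card _), mul_one]; omega
    have := Nat.lt_of_mul_lt_mul_left this
    omega
  have hXγ : 4 / γ ≤ Fintype.card ({A // A ∈ T} ⊕ Fin q) :=
    (Nat.le_ceil _).trans (by exact_mod_cast (by omega : ⌈4 / γ⌉₊ ≤ N).trans hXN)
  have hXα : 4 / α ≤ Fintype.card ({A // A ∈ T} ⊕ Fin q) :=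
    (Nat.le_ceil _).trans (by exact_mod_cast (by omega : ⌈4 / α⌉₊ ≤ N).trans hXN)
  let G : Finset ({A // A ∈ T} ⊕ Fin q) := univ.filter fun x => x.isLeft
  have hGc : Gᶜ.card = q := by
    have : Gᶜ = univ.map (Function.Embedding.inr : Fin q ↪ {A // A ∈ T} ⊕ Fin q) := by
      ext x; rcases x with x | x <;> simp [G]
    rw [this, card_map, card_univ, Fintype.card_fin]
  have hG : 3 * (α / 4) * Fintype.card ({A // A ∈ T} ⊕ Fin q) ≤ Gᶜ.card := by
    rw [hGc]
    rw [card_biUnion_of_isCsTiling hT] at hcov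
    rw [div_le_iff₀ hα] at hXα
    have h1 : (Fintype.card V : ℝ) < s * Fintype.card ({A // A ∈ T} ⊕ Fin q) + s := by
      exact_mod_cast hV'
    have h2 : (s : ℝ) * Fintype.card ({A // A ∈ T} ⊕ Fin q) ≤ Fintype.card V := by
      exact_mod_cast hV
    have h3 : (Fintype.card ({A // A ∈ T} ⊕ Fin q) : ℝ) = T.card + q := by exact_mod_cast hX
    push_cast at hcov
    have h4 : (s : ℝ) * T.card < (1 - α) * (s * Fintype.card ({A // A ∈ T} ⊕ Fin q) + s) :=
      hcov.trans_le (mul_le_mul_of_nonneg_left h1.le (by linarith))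
    have h5 : (T.card : ℝ) < (1 - α) * (Fintype.card ({A // A ∈ T} ⊕ Fin q) + 1) := by
      refine lt_of_mul_lt_mul_left (h4.trans_eq ?_) hsR.le
      ring
    linarith
  obtain ⟨f, ⟨R, J⟩, hf, hfg⟩ := hbox _ _
    (fun ω => (sampleGraph k E (fun z => B (ω z.1) z.2), univ.filter fun j => ω j ∉ G))
    ((by omega : N₁ ≤ N).trans hXN)
    (card_good_samples_ge (by omega) hs0 hE hγ hγ1 (by positivity) (by linarith) hdeg hm hmγ hmS
      hmη B hB hV hV'.le hXγ ((by omega : 6 * m ^ 2 ≤ N).trans hXN) G hG)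
  have hR : ∀ g : Fin m → Fin t, sampleGraph k E (fun z => B (f (z.1, g z.1)) z.2) = R :=
    fun g => (Prod.mk.inj (hfg g).2).1
  have hJ : ∀ g : Fin m → Fin t, (univ.filter fun j => f (j, g j) ∉ G) = J :=
    fun g => (Prod.mk.inj (hfg g).2).2
  let g₀ : Fin m → Fin t := fun _ => ⟨0, ht⟩
  obtain ⟨-, hRdeg, hJm⟩ := (mem_filter.1 (hfg g₀).1).2
  rw [hJ g₀] at hJm
  have hRmem : ∀ e ∈ R, e.card = k ∧ Set.InjOn Prod.fst (e : Set (Fin m × Fin s)) := by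
    intro e he
    rw [← hR g₀] at he
    have := (mem_filter.1 he).2
    exact ⟨this.1, this.2.1⟩
  have hcardW : Fintype.card (Fin m × Fin s) = m * s := by simp
  obtain ⟨I, _, g, hg, hwalk, hI⟩ := exists_blowup_packing hk hs hs0
    (Prod.fst : Fin m × Fin s → Fin m) (fun j => by
      calc _ ≤ ((univ : Finset (Fin s)).image fun i => (j, i)).card := card_le_card fun v hv => by
            simpa using ⟨v.2, Prod.ext (mem_filter.1 hv).2.symm rfl⟩
        _ ≤ s := card_image_le.trans (by simp))
    (fun e he => (hRmem e he).1) (fun e he => (hRmem e he).2)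
    (fun S hS hSi => by
      have := hRdeg S hS hSi
      rw [hR g₀] at this
      rw [hcardW]
      push_cast
      exact this)
    (by rw [hcardW, mul_comm m]; exact Nat.mul_lt_mul_of_pos_left (by omega) hs0) t
  refine exists_larger_tiling hs0 hks hT B hB hBT ht f hf R hR J ?_ g hg hwalk ?_
  · intro z A hz hzJ
    rw [← hJ fun _ => z.2] at hzJ
    exact (mem_filter.1 hzJ).2 (mem_filter.2 ⟨mem_univ _, by rw [hz]; rfl⟩)
  · have hJle : J.card ≤ m := by simpa using card_le_univ J
    have htR : (t : ℝ) = ((m : ℝ) * s) ^ s + 1 := by simp [t]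
    rw [hcardW] at hI
    push_cast at hI
    rw [mul_div_cancel_right₀ _ hsR.ne'] at hI
    have h0 : (0 : ℝ) ≤ ((m : ℝ) * s) ^ s := by positivity
    have h1 : (t : ℝ) * k ≤ t * J.card :=
      mul_le_mul_of_nonneg_left (hmk.trans hJm) (Nat.cast_nonneg _)
    have : (((m - J.card : ℕ) : ℝ)) * t < Fintype.card I := by
      rw [Nat.cast_sub hJle]
      linarith
    exact_mod_cast this

/-- the almost-perfect-tiling lemma: for `k ≥ 3`, `s ≥ 5k²` with `k ∤ s`, every
`k`-graph on `n ≥ n₀` vertices with minimum codegree at least `(1/2 + 1/(2s) + γ)n` has a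
`C_s^k`-tiling covering at least `(1 - α)n` vertices. -/
theorem almost_perfect_tiling (k s : ℕ) (hk : 3 ≤ k) (hs : 5 * k ^ 2 ≤ s) (hnd : ¬ k ∣ s)
    (α γ : ℝ) (hα : 0 < α) (hγ : 0 < γ) :
    ∃ n₀ : ℕ, ∀ (V : Type) [Fintype V] [DecidableEq V] (E : Finset (Finset V)),
      IsKGraph k E → n₀ ≤ Fintype.card V →
      (∀ S : Finset V, S.card = k - 1 →
        ((1 : ℝ) / 2 + 1 / (2 * (s : ℝ)) + γ) * (Fintype.card V : ℝ) ≤ (degS E S : ℝ)) →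
      ∃ T : Finset (Finset V), IsCsTiling k s E T ∧
        (1 - α) * (Fintype.card V : ℝ) ≤ ((T.biUnion id).card : ℝ) := by
  classical
  obtain ⟨n₀, h⟩ := exists_tiling_card_lt hk hs (lt_min hα one_pos) (min_le_right α 1)
    (lt_min hγ one_pos) (min_le_right γ 1)
  refine ⟨n₀, fun V _ _ E hE hn hdeg => ?_⟩
  have hdeg' : ∀ S : Finset V, S.card = k - 1 →
      ((1 : ℝ) / 2 + 1 / (2 * (s : ℝ)) + min γ 1) * (Fintype.card V : ℝ) ≤ (degS E S : ℝ) :=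
    fun S hS => le_trans (by gcongr; exact min_le_left _ _) (hdeg S hS)
  obtain ⟨T, hT, hmax⟩ := exists_max_image
    (univ.filter fun T : Finset (Finset V) => IsCsTiling k s E T) card
    ⟨∅, mem_filter.2 ⟨mem_univ _, by simp [IsCsTiling]⟩⟩
  have hT := (mem_filter.1 hT).2
  refine ⟨T, hT, ?_⟩
  by_contra! hcov
  obtain ⟨T', hT', hlt⟩ := h V E hE hn hdeg' T hT (hcov.trans_le (by gcongr; exact min_le_left _ _))
  exact (hmax T' (mem_filter.2 ⟨mem_univ _, hT'⟩)).not_gt hlt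
end

section
/- Let k ≥ 2 and n ≥ 2k be integers and let 0 < μ, θ < 1. Suppose that H is a k-graph on n vertices that is (μ, θ)-dense. Then there exists a k-graph H' on the vertex set V(H) with E(H') ⊆ E(H) that is strongly (μ − 2^k·θ^{1/(2k−2)}, θ + θ^{1/(2k−2)})-dense. -/
set_option autoImplicit false

open Finset

/-- Double counting pairs `T ⊆ B` with `T` from a family of `j`-sets and `B` from a family of
`(j + 1)`-sets. -/
lemma sum_degS_le {V : Type} [DecidableEq V] (j : ℕ) (𝒯 ℬ : Finset (Finset V))
    (hT : ∀ T ∈ 𝒯, T.card = j) (hB : ∀ B ∈ ℬ, B.card = j + 1) :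
    ∑ T ∈ 𝒯, degS ℬ T ≤ (j + 1) * ℬ.card := by
  have h := sum_card_bipartiteAbove_eq_sum_card_bipartiteBelow (s := 𝒯) (t := ℬ)
    (fun T B : Finset V => T ⊆ B)
  calc ∑ T ∈ 𝒯, degS ℬ T = ∑ B ∈ ℬ, (𝒯.filter fun T => T ⊆ B).card := h
    _ ≤ ∑ B ∈ ℬ, (j + 1) := by
        refine sum_le_sum fun B hBm => ?_
        calc (𝒯.filter fun T => T ⊆ B).card ≤ (powersetCard j B).card := by
              refine card_le_card fun T h => ?_
              rw [mem_filter] at h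
              exact mem_powersetCard.2 ⟨h.2, hT T h.1⟩
          _ = j + 1 := by rw [card_powersetCard, hB B hBm, Nat.choose_succ_self_right]
    _ = (j + 1) * ℬ.card := by rw [sum_const, smul_eq_mul, mul_comm]

section HeavySets

variable {V : Type} [Fintype V] [DecidableEq V]

/-- A `j`-set has at most `(n - j).choose (r - j)` supersets of size `r`. -/
lemma card_powersetCard_filter_superset_le (r : ℕ) (B : Finset V) :
    ((powersetCard r univ).filter fun X => B ⊆ X).card ≤
      (Fintype.card V - B.card).choose (r - B.card) := by
  have h : (powersetCard (r - B.card) (univ \ B)).card =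
      (Fintype.card V - B.card).choose (r - B.card) := by
    rw [card_powersetCard, card_sdiff_of_subset (subset_univ _), card_univ]
  rw [← h]
  refine card_le_card_of_injOn (fun X => X \ B) ?_ ?_
  · intro X hX
    simp only [coe_filter, mem_powersetCard, Set.mem_ofPred_eq] at hX
    simp only [mem_coe, mem_powersetCard]
    refine ⟨sdiff_subset_sdiff (subset_univ _) subset_rfl, ?_⟩
    rw [card_sdiff_of_subset hX.2, hX.1.2]
  · intro X hX Y hY hXY
    simp only [coe_filter, mem_powersetCard, Set.mem_ofPred_eq] at hX hY
    rw [← sdiff_union_of_subset hX.2, ← sdiff_union_of_subset hY.2]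
    exact congrArg (· ∪ B) hXY

open Classical in
/-- Starting from a family `𝒮` of `r`-sets, `heavySets 𝒮 β r i` is a family of `(r - i)`-sets:
a set is heavy if at least a `β` proportion of its one-vertex extensions are heavy. -/
noncomputable def heavySets (𝒮 : Finset (Finset V)) (β : ℝ) (r : ℕ) : ℕ → Finset (Finset V)
  | 0 => 𝒮
  | i + 1 => univ.filter fun T => T.card = r - (i + 1) ∧
      β * ((Fintype.card V : ℝ) - T.card) ≤ (degS (heavySets 𝒮 β r i) T : ℝ)

lemma mem_heavySets_succ {𝒮 : Finset (Finset V)} {β : ℝ} {r i : ℕ} {T : Finset V} :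
    T ∈ heavySets 𝒮 β r (i + 1) ↔ T.card = r - (i + 1) ∧
      β * ((Fintype.card V : ℝ) - T.card) ≤ (degS (heavySets 𝒮 β r i) T : ℝ) := by
  simp [heavySets]

lemma card_of_mem_heavySets {𝒮 : Finset (Finset V)} {β : ℝ} {r : ℕ}
    (h𝒮 : ∀ S ∈ 𝒮, S.card = r) {i : ℕ} {T : Finset V} (hT : T ∈ heavySets 𝒮 β r i) :
    T.card = r - i := by
  cases i with
  | zero => exact h𝒮 T hT
  | succ i => exact (mem_heavySets_succ.1 hT).1

/-- The density of the heavy sets grows by a factor of at most `β⁻¹` at each level. -/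
lemma card_heavySets_mul_pow_le {𝒮 : Finset (Finset V)} {β θ : ℝ} {r : ℕ} (hβ : 0 ≤ β)
    (h𝒮 : ∀ S ∈ 𝒮, S.card = r) (hcard : (𝒮.card : ℝ) ≤ θ * (Fintype.card V).choose r)
    (hr : r ≤ Fintype.card V) {i : ℕ} (hi : i ≤ r) :
    ((heavySets 𝒮 β r i).card : ℝ) * β ^ i ≤ θ * (Fintype.card V).choose (r - i) := by
  induction i with
  | zero => simpa [heavySets] using hcard
  | succ i ih =>
    specialize ih (by omega)
    obtain ⟨j, hj⟩ : ∃ j, r - i = j + 1 := ⟨r - i - 1, by omega⟩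
    have hj' : r - (i + 1) = j := by omega
    rw [hj] at ih
    rw [hj']
    have hjn : j < Fintype.card V := by omega
    have hpos : (0 : ℝ) < (Fintype.card V : ℝ) - j := by
      have : (j : ℝ) < Fintype.card V := by exact_mod_cast hjn
      linarith
    have hsum := sum_degS_le j (heavySets 𝒮 β r (i + 1)) (heavySets 𝒮 β r i)
      (fun T hT => (card_of_mem_heavySets h𝒮 hT).trans hj')
      (fun B hB => (card_of_mem_heavySets h𝒮 hB).trans hj)
    have hsumR : (∑ T ∈ heavySets 𝒮 β r (i + 1), (degS (heavySets 𝒮 β r i) T : ℝ)) ≤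
        ((j : ℝ) + 1) * (heavySets 𝒮 β r i).card := by exact_mod_cast hsum
    have hlow : ((heavySets 𝒮 β r (i + 1)).card : ℝ) * (β * ((Fintype.card V : ℝ) - j)) ≤
        ∑ T ∈ heavySets 𝒮 β r (i + 1), (degS (heavySets 𝒮 β r i) T : ℝ) := by
      rw [← nsmul_eq_mul]
      refine card_nsmul_le_sum _ _ _ fun T hT => ?_
      have h := mem_heavySets_succ.1 hT
      rw [hj'] at h
      simpa [h.1] using h.2
    have hch : ((Fintype.card V).choose (j + 1) : ℝ) * ((j : ℝ) + 1) =
        (Fintype.card V).choose j * ((Fintype.card V : ℝ) - j) := by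
      rw [← Nat.cast_sub hjn.le]
      exact_mod_cast Nat.choose_succ_right_eq (Fintype.card V) j
    refine le_of_mul_le_mul_right ?_ hpos
    calc ((heavySets 𝒮 β r (i + 1)).card : ℝ) * β ^ (i + 1) * ((Fintype.card V : ℝ) - j)
        = ((heavySets 𝒮 β r (i + 1)).card : ℝ) * (β * ((Fintype.card V : ℝ) - j)) * β ^ i := by
          ring
      _ ≤ ((j : ℝ) + 1) * (heavySets 𝒮 β r i).card * β ^ i :=
          mul_le_mul_of_nonneg_right (hlow.trans hsumR) (by positivity)
      _ = ((j : ℝ) + 1) * ((heavySets 𝒮 β r i).card * β ^ i) := by ring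
      _ ≤ ((j : ℝ) + 1) * (θ * (Fintype.card V).choose (j + 1)) := by gcongr
      _ = θ * (Fintype.card V).choose j * ((Fintype.card V : ℝ) - j) := by
          rw [mul_assoc, ← hch]; ring

/-- When `θ = β ^ (2 * r)` with `β < 1`, the empty set is not heavy. -/
lemma heavySets_self_eq_empty {𝒮 : Finset (Finset V)} {β : ℝ} {r : ℕ} (hβ : 0 < β) (hβ1 : β < 1)
    (hr0 : r ≠ 0) (h𝒮 : ∀ S ∈ 𝒮, S.card = r)
    (hcard : (𝒮.card : ℝ) ≤ β ^ (2 * r) * (Fintype.card V).choose r)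
    (hr : r ≤ Fintype.card V) : heavySets 𝒮 β r r = ∅ := by
  have h := card_heavySets_mul_pow_le hβ.le h𝒮 hcard hr le_rfl
  rw [Nat.sub_self, Nat.choose_zero_right, Nat.cast_one, mul_one, two_mul, pow_add] at h
  have h1 := le_of_mul_le_mul_right h (pow_pos hβ r)
  have h2 : ((heavySets 𝒮 β r r).card : ℝ) < 1 := h1.trans_lt (pow_lt_one₀ hβ.le hβ1 hr0)
  exact card_eq_zero.1 (Nat.lt_one_iff.1 (by exact_mod_cast h2))

/-- `X` contains no heavy set of any level. -/
def IsLight (𝒮 : Finset (Finset V)) (β : ℝ) (r : ℕ) (X : Finset V) : Prop :=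
  ∀ i ≤ r, ∀ B ∈ heavySets 𝒮 β r i, ¬ B ⊆ X

lemma IsLight.mono {𝒮 : Finset (Finset V)} {β : ℝ} {r : ℕ} {X Y : Finset V}
    (hY : IsLight 𝒮 β r Y) (hXY : X ⊆ Y) : IsLight 𝒮 β r X :=
  fun i hi B hB hBX => hY i hi B hB (hBX.trans hXY)

open Classical in
/-- Few `r`-sets fail to be light. -/
lemma card_not_isLight_le {𝒮 : Finset (Finset V)} {β : ℝ} {r : ℕ} (hβ : 0 < β) (hβ1 : β < 1)
    (hr0 : r ≠ 0) (h𝒮 : ∀ S ∈ 𝒮, S.card = r)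
    (hcard : (𝒮.card : ℝ) ≤ β ^ (2 * r) * (Fintype.card V).choose r)
    (hr : r ≤ Fintype.card V) :
    (((powersetCard r univ).filter fun X => ¬ IsLight 𝒮 β r X).card : ℝ) ≤
      (β ^ (2 * r) + β ^ (r + 1) * 2 ^ r) * (Fintype.card V).choose r := by
  set N : ℝ := ((Fintype.card V).choose r : ℝ) with hN
  let up : ℕ → Finset (Finset V) := fun i => (heavySets 𝒮 β r i).biUnion fun B =>
    (powersetCard r univ).filter fun X => B ⊆ X
  have hup : ∀ i < r, ((up (i + 1)).card : ℝ) ≤ β ^ (r + 1) * N * r.choose (i + 1) := by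
    intro i hi
    rcases (show i + 1 = r ∨ i + 1 < r by omega) with hir | hir
    · have h0 : up (i + 1) = ∅ := by
        simp only [up, hir, heavySets_self_eq_empty hβ hβ1 hr0 h𝒮 hcard hr, biUnion_empty]
      rw [h0, card_empty, Nat.cast_zero]
      positivity
    · have h1 : (up (i + 1)).card ≤ (heavySets 𝒮 β r (i + 1)).card *
          (Fintype.card V - (r - (i + 1))).choose (i + 1) := by
        refine card_biUnion_le_card_mul _ _ _ fun B hB => ?_
        have h := card_powersetCard_filter_superset_le r B
        rwa [card_of_mem_heavySets h𝒮 hB, Nat.sub_sub_self hi] at h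
      have h2 := card_heavySets_mul_pow_le hβ.le h𝒮 hcard hr (show i + 1 ≤ r by omega)
      have h3 : N * r.choose (i + 1) = (Fintype.card V).choose (r - (i + 1)) *
          (Fintype.card V - (r - (i + 1))).choose (i + 1) := by
        have h := Nat.choose_mul (n := Fintype.card V) (Nat.sub_le r (i + 1))
        rw [Nat.choose_symm hi, Nat.sub_sub_self hi] at h
        rw [hN]; exact_mod_cast h
      have hpow : β ^ (2 * r) = β ^ (2 * r - (i + 1)) * β ^ (i + 1) := by
        rw [← pow_add]; congr 1; omega
      have h4 : ((heavySets 𝒮 β r (i + 1)).card : ℝ) ≤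
          β ^ (2 * r - (i + 1)) * (Fintype.card V).choose (r - (i + 1)) := by
        refine le_of_mul_le_mul_right ?_ (pow_pos hβ (i + 1))
        rw [hpow] at h2
        linarith
      calc ((up (i + 1)).card : ℝ) ≤ (heavySets 𝒮 β r (i + 1)).card *
            (Fintype.card V - (r - (i + 1))).choose (i + 1) := by exact_mod_cast h1
        _ ≤ β ^ (2 * r - (i + 1)) * (Fintype.card V).choose (r - (i + 1)) *
            (Fintype.card V - (r - (i + 1))).choose (i + 1) := by gcongr
        _ = β ^ (2 * r - (i + 1)) * (N * r.choose (i + 1)) := by rw [h3]; ring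
        _ ≤ β ^ (r + 1) * (N * r.choose (i + 1)) := by
            refine mul_le_mul_of_nonneg_right ?_ (by positivity)
            exact pow_le_pow_of_le_one hβ.le hβ1.le (by omega)
        _ = β ^ (r + 1) * N * r.choose (i + 1) := by ring
  have hsub : ((powersetCard r univ).filter fun X => ¬ IsLight 𝒮 β r X) ⊆
      𝒮 ∪ (range r).biUnion fun i => up (i + 1) := by
    intro X hX
    simp only [mem_filter, IsLight, not_forall, not_not] at hX
    obtain ⟨hXr, i, hi, B, hB, hBX⟩ := hX
    cases i with
    | zero =>
      have hBX' : B = X := eq_of_subset_of_card_le hBX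
        (by rw [h𝒮 B hB, (mem_powersetCard.1 hXr).2])
      exact mem_union_left _ (hBX' ▸ hB)
    | succ i =>
      refine mem_union_right _ (mem_biUnion.2 ⟨i, mem_range.2 hi, mem_biUnion.2 ⟨B, hB, ?_⟩⟩)
      exact mem_filter.2 ⟨hXr, hBX⟩
  have hc : (((powersetCard r univ).filter fun X => ¬ IsLight 𝒮 β r X).card : ℝ) ≤
      𝒮.card + ∑ i ∈ range r, ((up (i + 1)).card : ℝ) := by
    have := (card_le_card hsub).trans ((card_union_le _ _).trans
      (Nat.add_le_add_left card_biUnion_le _))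
    exact_mod_cast this
  have hchoose : (∑ i ∈ range r, (r.choose (i + 1) : ℝ)) ≤ 2 ^ r := by
    have h := Nat.sum_range_choose r
    rw [sum_range_succ'] at h
    have h' : ∑ i ∈ range r, r.choose (i + 1) ≤ 2 ^ r := by omega
    exact_mod_cast h'
  calc (((powersetCard r univ).filter fun X => ¬ IsLight 𝒮 β r X).card : ℝ)
      ≤ 𝒮.card + ∑ i ∈ range r, ((up (i + 1)).card : ℝ) := hc
    _ ≤ β ^ (2 * r) * N + ∑ i ∈ range r, β ^ (r + 1) * N * r.choose (i + 1) :=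
        add_le_add hcard (sum_le_sum fun i hi => hup i (mem_range.1 hi))
    _ = β ^ (2 * r) * N + β ^ (r + 1) * N * ∑ i ∈ range r, (r.choose (i + 1) : ℝ) := by
        rw [mul_sum]
    _ ≤ β ^ (2 * r) * N + β ^ (r + 1) * N * 2 ^ r := by gcongr
    _ = (β ^ (2 * r) + β ^ (r + 1) * 2 ^ r) * N := by ring

open Classical in
/-- A light `r`-set lies in few edges that are not light. -/
lemma degS_not_isLight_le {𝒮 : Finset (Finset V)} {β : ℝ} {r : ℕ} (hβ : 0 ≤ β)
    (h𝒮 : ∀ S ∈ 𝒮, S.card = r) (hempty : heavySets 𝒮 β r r = ∅)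
    {E : Finset (Finset V)} (hE : IsKGraph (r + 1) E) {X : Finset V} (hXr : X.card = r)
    (hX : IsLight 𝒮 β r X) :
    (degS (E.filter fun e => ¬ IsLight 𝒮 β r e) X : ℝ) ≤ 2 ^ r * (β * Fintype.card V) := by
  let ext : Finset V → Finset (Finset V) := fun T => univ.filter fun e =>
    X ⊆ e ∧ T ⊆ T ∪ (e \ X) ∧ T ∪ (e \ X) ∈ heavySets 𝒮 β r (r - T.card - 1)
  have hsub : ((E.filter fun e => ¬ IsLight 𝒮 β r e).filter fun e => X ⊆ e) ⊆
      X.ssubsets.biUnion ext := by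
    intro e he
    simp only [mem_filter, IsLight, not_forall, not_not] at he
    obtain ⟨⟨heE, i, hi, B, hB, hBe⟩, hXe⟩ := he
    have hir : i ≠ r := by
      rintro rfl
      simp [hempty] at hB
    have hBX : ¬ B ⊆ X := hX i hi B hB
    have hdiff : (e \ X).card = 1 := by
      rw [card_sdiff_of_subset hXe, hE e heE, hXr]; omega
    obtain ⟨v, hv⟩ := card_eq_one.1 hdiff
    have hvB : v ∈ B := by
      obtain ⟨w, hwB, hwX⟩ := not_subset.1 hBX
      have hw : w ∈ e \ X := mem_sdiff.2 ⟨hBe hwB, hwX⟩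
      rw [hv, mem_singleton] at hw
      exact hw ▸ hwB
    have hBT : B.erase v ∪ (e \ X) = B := by
      rw [hv, union_comm, ← insert_eq, insert_erase hvB]
    have hTc : (B.erase v).card = r - i - 1 := by
      rw [card_erase_of_mem hvB, card_of_mem_heavySets h𝒮 hB]
    have hTX : B.erase v ⊆ X := by
      intro w hw
      by_contra hwX
      have hw' : w ∈ e \ X := mem_sdiff.2 ⟨hBe (mem_of_mem_erase hw), hwX⟩
      rw [hv, mem_singleton] at hw'
      exact ne_of_mem_erase hw hw'
    have hTne : B.erase v ≠ X := by
      intro h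
      rw [h, hXr] at hTc
      omega
    refine mem_biUnion.2 ⟨B.erase v, mem_ssubsets.2 (hTX.ssubset_of_ne hTne), ?_⟩
    refine mem_filter.2 ⟨mem_univ _, hXe, subset_union_left, ?_⟩
    rw [hBT, hTc, show r - (r - i - 1) - 1 = i by omega]
    exact hB
  have hext : ∀ T ∈ X.ssubsets, ((ext T).card : ℝ) ≤ β * Fintype.card V := by
    intro T hT
    have hTX := mem_ssubsets.1 hT
    have hlt : T.card < r := hXr ▸ card_lt_card hTX
    have hle : (ext T).card ≤ degS (heavySets 𝒮 β r (r - T.card - 1)) T := by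
      refine card_le_card_of_injOn (fun e => T ∪ (e \ X)) ?_ ?_
      · intro e he
        simp only [ext, coe_filter, mem_univ, true_and, Set.mem_ofPred_eq] at he
        simp only [coe_filter, Set.mem_ofPred_eq]
        exact ⟨he.2.2, he.2.1⟩
      · intro e he f hf hef
        simp only [ext, coe_filter, mem_univ, true_and, Set.mem_ofPred_eq] at he hf
        have key : ∀ g : Finset V, (T ∪ (g \ X)) \ X = g \ X := by
          intro g
          rw [union_sdiff_distrib, sdiff_eq_empty_iff_subset.2 hTX.subset, empty_union,
            Finset.sdiff_idem]
        have h : e \ X = f \ X := by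
          rw [← key e, ← key f]
          exact congrArg (· \ X) hef
        rw [← sdiff_union_of_subset he.1, ← sdiff_union_of_subset hf.1, h]
    have hnot : T ∉ heavySets 𝒮 β r (r - T.card - 1 + 1) :=
      fun h => hX _ (by omega) T h hTX.subset
    rw [mem_heavySets_succ, not_and, not_le] at hnot
    have h1 := hnot (by omega)
    have h2 : ((ext T).card : ℝ) ≤ degS (heavySets 𝒮 β r (r - T.card - 1)) T := by
      exact_mod_cast hle
    have h3 : 0 ≤ β * (T.card : ℝ) := by positivity
    linarith
  have hc : (degS (E.filter fun e => ¬ IsLight 𝒮 β r e) X : ℝ) ≤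
      ∑ T ∈ X.ssubsets, ((ext T).card : ℝ) := by
    exact_mod_cast (card_le_card hsub).trans card_biUnion_le
  calc (degS (E.filter fun e => ¬ IsLight 𝒮 β r e) X : ℝ)
      ≤ ∑ T ∈ X.ssubsets, ((ext T).card : ℝ) := hc
    _ ≤ X.ssubsets.card • (β * Fintype.card V) := sum_le_card_nsmul _ _ _ hext
    _ ≤ 2 ^ r * (β * Fintype.card V) := by
        rw [nsmul_eq_mul]
        refine mul_le_mul_of_nonneg_right ?_ (by positivity)
        have h : X.ssubsets.card ≤ 2 ^ r := by
          rw [← hXr, ← card_powerset]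
          exact card_le_card (erase_subset _ _)
        exact_mod_cast h

/-- If `θ = β ^ (2 * r)` with `β` small, the light edges of a `(μ, θ)`-dense `(r + 1)`-graph form a
strongly dense subgraph. -/
lemma exists_isStronglyDense_of_small {r : ℕ} (hr0 : r ≠ 0) (hr : 2 * r ≤ Fintype.card V)
    {μ β : ℝ} (hβ : 0 < β) (hβ2 : 2 * β ≤ 1) {E : Finset (Finset V)}
    (hE : IsKGraph (r + 1) E) (hdense : IsDense (r + 1) μ (β ^ (2 * r)) E) :
    ∃ E' ⊆ E, IsStronglyDense (r + 1) (μ - 2 ^ (r + 1) * β) (β ^ (2 * r) + β) E' := by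
  classical
  obtain ⟨𝒮, h𝒮, hcard, hdeg⟩ := hdense
  simp only [Nat.add_sub_cancel] at h𝒮 hcard hdeg
  have hrn : r ≤ Fintype.card V := by omega
  have hβ1 : β < 1 := by linarith
  have hempty := heavySets_self_eq_empty hβ hβ1 hr0 h𝒮 hcard hrn
  have hn : (Fintype.card V : ℝ) ≤ 2 * ((Fintype.card V : ℝ) - r) := by
    have : (2 * r : ℝ) ≤ Fintype.card V := by exact_mod_cast hr
    linarith
  have hlight : ∀ X : Finset V, X.card = r → IsLight 𝒮 β r X →
      (μ - 2 ^ (r + 1) * β) * ((Fintype.card V : ℝ) - (r + 1 : ℕ) + 1) ≤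
        (degS (E.filter fun e => IsLight 𝒮 β r e) X : ℝ) := by
    intro X hXr hX
    have h1 := hdeg X hXr fun h => hX 0 (Nat.zero_le _) X h subset_rfl
    have h2 := degS_not_isLight_le hβ.le h𝒮 hempty hE hXr hX
    have h3 : degS E X = degS (E.filter fun e => IsLight 𝒮 β r e) X +
        degS (E.filter fun e => ¬ IsLight 𝒮 β r e) X := by
      simp only [degS]
      rw [filter_comm, filter_comm (fun e => ¬ IsLight 𝒮 β r e),
        card_filter_add_card_filter_not]
    have h3' : (degS E X : ℝ) = degS (E.filter fun e => IsLight 𝒮 β r e) X +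
        degS (E.filter fun e => ¬ IsLight 𝒮 β r e) X := by exact_mod_cast h3
    have h4 : 2 ^ r * (β * Fintype.card V) ≤
        2 ^ r * (β * (2 * ((Fintype.card V : ℝ) - r))) := by gcongr
    push_cast at h1 ⊢
    rw [pow_succ]
    linarith
  refine ⟨E.filter fun e => IsLight 𝒮 β r e, filter_subset _ _,
    ⟨(powersetCard r univ).filter fun X => ¬ IsLight 𝒮 β r X, ?_, ?_, ?_⟩, ?_⟩
  · intro S hS
    exact (mem_powersetCard.1 (mem_filter.1 hS).1).2
  · refine (card_not_isLight_le hβ hβ1 hr0 h𝒮 hcard hrn).trans ?_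
    rw [Nat.add_sub_cancel]
    have h : β ^ (r + 1) * 2 ^ r ≤ β := by
      have h1 : (2 * β) ^ r ≤ 1 := pow_le_one₀ (by positivity) hβ2
      calc β ^ (r + 1) * 2 ^ r = β * (2 * β) ^ r := by rw [mul_pow]; ring
        _ ≤ β * 1 := by gcongr
        _ = β := mul_one β
    gcongr
  · intro S hSr hS
    rw [Nat.add_sub_cancel] at hSr
    refine hlight S hSr ?_
    by_contra h
    exact hS (mem_filter.2 ⟨mem_powersetCard.2 ⟨subset_univ _, hSr⟩, h⟩)
  · intro e he X hXe hXr
    rw [Nat.add_sub_cancel] at hXr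
    exact hlight X hXr ((mem_filter.1 he).2.mono hXe)

/-- The empty hypergraph is strongly dense with a nonpositive degree parameter. -/
lemma isStronglyDense_empty {k : ℕ} {μ θ : ℝ} (hμ : μ ≤ 0) (hθ : 0 ≤ θ)
    (hk : k ≤ Fintype.card V) : IsStronglyDense k μ θ (∅ : Finset (Finset V)) := by
  refine ⟨⟨∅, by simp, by simpa using by positivity, fun S _ _ => ?_⟩, by simp⟩
  have hk' : (k : ℝ) ≤ Fintype.card V := by exact_mod_cast hk
  have h : μ * ((Fintype.card V : ℝ) - k + 1) ≤ 0 :=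
    mul_nonpos_of_nonpos_of_nonneg hμ (by linarith)
  exact h.trans (Nat.cast_nonneg _)

end HeavySets

/-- every `(μ, θ)`-dense `k`-graph on `n ≥ 2k` vertices has a subgraph on the
same vertex set that is strongly `(μ - 2^k θ^(1/(2k-2)), θ + θ^(1/(2k-2)))`-dense. -/
theorem strongly_dense_subgraph (k n : ℕ) (hk : 2 ≤ k) (hn : 2 * k ≤ n) (μ θ : ℝ)
    (hμ0 : 0 < μ) (hμ1 : μ < 1) (hθ0 : 0 < θ) (hθ1 : θ < 1)
    (V : Type) [Fintype V] [DecidableEq V] (hV : Fintype.card V = n)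
    (E : Finset (Finset V)) (hE : IsKGraph k E) (hdense : IsDense k μ θ E) :
    ∃ E' : Finset (Finset V), E' ⊆ E ∧
      IsStronglyDense k (μ - 2 ^ k * θ ^ ((1 : ℝ) / (2 * (k : ℝ) - 2)))
        (θ + θ ^ ((1 : ℝ) / (2 * (k : ℝ) - 2))) E' := by
  obtain ⟨r, rfl⟩ : ∃ r, k = r + 1 := ⟨k - 1, by omega⟩
  set β : ℝ := θ ^ ((1 : ℝ) / (2 * ((r + 1 : ℕ) : ℝ) - 2)) with hβdef
  have hβ : 0 < β := Real.rpow_pos_of_pos hθ0 _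
  have hθβ : θ = β ^ (2 * r) := by
    have hr : (r : ℝ) ≠ 0 := by
      have : r ≠ 0 := by omega
      exact_mod_cast this
    rw [hβdef, ← Real.rpow_natCast, ← Real.rpow_mul hθ0.le]
    have h1 : (1 : ℝ) / (2 * ((r + 1 : ℕ) : ℝ) - 2) * ((2 * r : ℕ) : ℝ) = 1 := by
      push_cast
      rw [show (2 : ℝ) * (r + 1) - 2 = 2 * r by ring]
      field_simp
    rw [h1, Real.rpow_one]
  by_cases hsmall : μ ≤ 2 ^ (r + 1) * β
  · exact ⟨∅, empty_subset _, isStronglyDense_empty (by linarith) (by positivity) (by omega)⟩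
  · have h2 : 2 * β ≤ 1 := by
      have h : (2 : ℝ) ^ 1 * β ≤ 2 ^ (r + 1) * β := by
        gcongr
        · norm_num
        · omega
      rw [pow_one] at h
      linarith
    rw [hθβ] at hdense ⊢
    exact exists_isStronglyDense_of_small (by omega) (by omega) hβ h2 hE hdense
end

section
/- Let k ≥ 3 and s ≥ 5k² be integers with s not divisible by k, and fix F_s, E_s, φ and Φ as in the context. Let γ > 0 and μ, θ ≥ 0 be such that μ + γ/3 ≤ 2/3, and let n be a positive integer such that γn is a positive integer. Then Φ(n, μ, θ) ≤ Φ((1 + γ)n, μ + γ/3, θ) + sγ. -/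
set_option autoImplicit false

open Finset

section Padding

variable {V W : Type}

/-- The `k`-graph obtained from `E` by adding the vertices outside the range of `c` and all
`k`-sets meeting them; `r` is a left inverse of `c`. -/
def padEdges [Fintype V] [DecidableEq V] [Fintype W] [DecidableEq W] (k : ℕ) (c : V ↪ W)
    (r : W → V) (E : Finset (Finset V)) : Finset (Finset W) :=
  (univ.powersetCard k).filter fun e => ¬ e ⊆ univ.map c ∨ e.image r ∈ E

lemma isKGraph_padEdges [Fintype V] [DecidableEq V] [Fintype W] [DecidableEq W] (k : ℕ)
    (c : V ↪ W) (r : W → V) (E : Finset (Finset V)) :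
    IsKGraph k (padEdges k c r E) := by
  intro e he
  simp only [padEdges, mem_filter, mem_powersetCard] at he
  exact he.1.2

lemma map_image_leftInverse [Fintype V] [DecidableEq V]
    {c : V ↪ W} {r : W → V} (hr : Function.LeftInverse r c)
    {S : Finset W} (hS : S ⊆ univ.map c) : (S.image r).map c = S := by
  ext w
  simp only [mem_map, mem_image]
  constructor
  · rintro ⟨v, ⟨x, hx, rfl⟩, rfl⟩
    obtain ⟨y, -, rfl⟩ := mem_map.1 (hS hx)
    rwa [hr y]
  · intro hw
    obtain ⟨y, -, rfl⟩ := mem_map.1 (hS hw)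
    exact ⟨y, ⟨c y, hw, hr y⟩, rfl⟩

lemma image_map_leftInverse [DecidableEq V] [DecidableEq W]
    {c : V ↪ W} {r : W → V} (hr : Function.LeftInverse r c)
    (S : Finset V) : (S.map c).image r = S := by
  rw [map_eq_image, image_image, hr.comp_eq_id, image_id]

lemma insert_injOn_of_disjoint [DecidableEq W] {T S : Finset W} (hTS : Disjoint T S) :
    Set.InjOn (fun w => insert w S) (T : Set W) := by
  intro x hx y hy hxy
  have hxS : x ∉ S := disjoint_left.1 hTS hx
  have : x ∈ insert y S := by
    have h : insert x S = insert y S := hxy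
    rw [← h]; exact mem_insert_self _ _
  exact (mem_insert.1 this).resolve_right hxS

lemma card_le_degS [DecidableEq W] {E : Finset (Finset W)} {T S : Finset W} (hTS : Disjoint T S)
    (h : ∀ w ∈ T, insert w S ∈ E) : T.card ≤ degS E S := by
  rw [← card_image_of_injOn (insert_injOn_of_disjoint hTS)]
  refine card_le_card fun e he => ?_
  obtain ⟨w, hw, rfl⟩ := mem_image.1 he
  exact mem_filter.2 ⟨h w hw, subset_insert _ _⟩

lemma insert_mem_padEdges [Fintype V] [DecidableEq V] [Fintype W] [DecidableEq W]
    {k : ℕ} (hk : 1 ≤ k) {c : V ↪ W} {r : W → V}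
    {E : Finset (Finset V)} {S : Finset W} (hS : S.card = k - 1) {w : W} (hw : w ∉ S)
    (h : ¬ insert w S ⊆ univ.map c) : insert w S ∈ padEdges k c r E := by
  refine mem_filter.2 ⟨mem_powersetCard.2 ⟨subset_univ _, ?_⟩, Or.inl h⟩
  rw [card_insert_of_notMem hw, hS]
  omega

lemma card_le_degS_padEdges [Fintype V] [DecidableEq V] [Fintype W] [DecidableEq W]
    {k : ℕ} (hk : 1 ≤ k) {c : V ↪ W} {r : W → V}
    {E : Finset (Finset V)} {S : Finset W} (hS : S.card = k - 1) (h : ¬ S ⊆ univ.map c) :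
    Fintype.card W ≤ degS (padEdges k c r E) S + (k - 1) := by
  have h1 : Sᶜ.card ≤ degS (padEdges k c r E) S :=
    card_le_degS disjoint_compl_left fun w hw =>
      insert_mem_padEdges hk hS (mem_compl.1 hw) fun h' => h ((subset_insert _ _).trans h')
  rw [card_compl, hS] at h1
  omega

lemma degS_add_le_degS_padEdges [Fintype V] [DecidableEq V] [Fintype W] [DecidableEq W]
    {k : ℕ} (hk : 1 ≤ k) {c : V ↪ W} {r : W → V}
    (hr : Function.LeftInverse r c) {E : Finset (Finset V)} (hE : IsKGraph k E)
    {S : Finset V} (hS : S.card = k - 1) :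
    degS E S + ((univ.map c)ᶜ : Finset W).card ≤ degS (padEdges k c r E) (S.map c) := by
  have hdis : Disjoint (univ.map c)ᶜ (S.map c) :=
    disjoint_compl_left.mono_right (map_subset_map.2 (subset_univ _))
  rw [← card_image_of_injOn (insert_injOn_of_disjoint hdis), degS,
    ← card_map (mapEmbedding c).toEmbedding, ← card_union_of_disjoint]
  · refine card_le_card fun e he => ?_
    rcases mem_union.1 he with he | he
    · obtain ⟨e, he₀, rfl⟩ := mem_map.1 he
      obtain ⟨heE, hSe⟩ := mem_filter.1 he₀
      refine mem_filter.2 ⟨mem_filter.2 ⟨mem_powersetCard.2 ⟨subset_univ _, ?_⟩, Or.inr ?_⟩, ?_⟩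
      · exact (card_map c).trans (hE e heE)
      · exact (image_map_leftInverse hr e).symm ▸ heE
      · exact map_subset_map.2 hSe
    · obtain ⟨w, hw, rfl⟩ := mem_image.1 he
      refine mem_filter.2 ⟨insert_mem_padEdges hk ((card_map c).trans hS)
        (disjoint_left.1 hdis hw) fun h => ?_, subset_insert _ _⟩
      exact mem_compl.1 hw (h (mem_insert_self _ _))
  · refine disjoint_left.2 fun e he he' => ?_
    obtain ⟨e, -, rfl⟩ := mem_map.1 he
    obtain ⟨w, hw, h⟩ := mem_image.1 he'
    refine mem_compl.1 hw ?_
    have hwe : w ∈ e.map c := by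
      have h' : insert w (S.map c) = e.map c := h
      rw [← h']; exact mem_insert_self _ _
    exact map_subset_map.2 (subset_univ _) hwe

lemma isDense_padEdges [Fintype V] [DecidableEq V] [Fintype W] [DecidableEq W]
    {k : ℕ} (hk : 1 ≤ k) {c : V ↪ W} {r : W → V}
    (hr : Function.LeftInverse r c) {E : Finset (Finset V)} (hE : IsKGraph k E)
    {γ μ θ : ℝ} (hγ : 0 ≤ γ) (hθ : 0 ≤ θ) (hμγ : μ + γ / 3 ≤ 2 / 3)
    (hcard : (Fintype.card W : ℝ) = Fintype.card V + γ * Fintype.card V)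
    (hd : IsDense k μ θ E) : IsDense k (μ + γ / 3) θ (padEdges k c r E) := by
  obtain ⟨𝒮, h𝒮, h𝒮c, hdeg⟩ := hd
  have hk1 : (1 : ℝ) ≤ k := by exact_mod_cast hk
  have hkc : ((k - 1 : ℕ) : ℝ) = k - 1 := by rw [Nat.cast_sub hk, Nat.cast_one]
  have hVW : Fintype.card V ≤ Fintype.card W := Fintype.card_le_of_embedding c
  refine ⟨𝒮.map (mapEmbedding c).toEmbedding, ?_, ?_, ?_⟩
  · intro S hS
    obtain ⟨S, hS₀, rfl⟩ := mem_map.1 hS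
    exact (card_map c).trans (h𝒮 S hS₀)
  · rw [card_map]
    refine h𝒮c.trans (mul_le_mul_of_nonneg_left ?_ hθ)
    exact_mod_cast Nat.choose_le_choose _ hVW
  · intro S hS hS𝒮
    by_cases hSc : S ⊆ univ.map c
    · have hmap := map_image_leftInverse hr hSc
      have hS0 : (S.image r).card = k - 1 := by rw [← card_map c, hmap, hS]
      have h1 := hdeg (S.image r) hS0 fun h =>
        hS𝒮 (mem_map.2 ⟨_, h, hmap⟩)
      have h2 := degS_add_le_degS_padEdges (r := r) hk hr hE hS0
      rw [hmap, card_compl, card_map, card_univ] at h2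
      have h3 : (degS E (S.image r) : ℝ) + (Fintype.card W - Fintype.card V) ≤
          degS (padEdges k c r E) S := by
        rw [← Nat.cast_sub hVW]; exact_mod_cast h2
      have hn0 : (0 : ℝ) ≤ Fintype.card V := Nat.cast_nonneg _
      rw [hcard] at h3 ⊢
      nlinarith [mul_nonneg (mul_nonneg hγ hn0) (sub_nonneg.2 hμγ),
        mul_nonneg hγ (sub_nonneg.2 hk1)]
    · have h1 : (Fintype.card W : ℝ) ≤ degS (padEdges k c r E) S + (k - 1 : ℕ) := by
        exact_mod_cast card_le_degS_padEdges (r := r) (E := E) hk hS hSc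
      have h2 : ((k - 1 : ℕ) : ℝ) ≤ Fintype.card W := by
        exact_mod_cast hS ▸ card_le_univ S
      rw [hkc] at h1 h2
      nlinarith

lemma image_mem_of_mem_padEdges [Fintype V] [DecidableEq V] [Fintype W] [DecidableEq W]
    {k : ℕ} {c : V ↪ W} {r : W → V} {E : Finset (Finset V)}
    {e : Finset W} (he : e ∈ padEdges k c r E) (hec : e ⊆ univ.map c) : e.image r ∈ E :=
  (mem_filter.1 he).2.resolve_left (not_not.2 hec)

lemma leftInverse_injOn {c : V ↪ W} {r : W → V} (hr : Function.LeftInverse r c) :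
    Set.InjOn r (Set.range c) := by
  rintro _ ⟨x, rfl⟩ _ ⟨y, rfl⟩ h
  rw [hr, hr] at h
  rw [h]

lemma subset_FsVertexSet {k : ℕ} {a : Fin k → ℕ} {G : SimpleGraph (Fin k)}
    {e : Finset ((Σ i : Fin k, Fin (a i)) ⊕ Sym2 (Fin k))} (he : e ∈ FKGedges k a G) :
    (e : Set _) ⊆ FsVertexSet k a G := by
  intro x hx
  rcases he with ⟨g, rfl⟩ | ⟨i, j, hij, g, rfl⟩
  · obtain ⟨i, -, rfl⟩ := mem_image.1 (mem_coe.1 hx)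
    exact Or.inl ⟨_, rfl⟩
  · rcases mem_insert.1 (mem_coe.1 hx) with rfl | hx
    · exact Or.inr ⟨_, hij, rfl⟩
    · obtain ⟨i, -, rfl⟩ := mem_image.1 hx
      exact Or.inl ⟨_, rfl⟩

lemma SpansFsCopy.image_of_padEdges [Fintype V] [DecidableEq V] [Fintype W] [DecidableEq W]
    {k : ℕ} {a : Fin k → ℕ} {G : SimpleGraph (Fin k)}
    {c : V ↪ W} {r : W → V} (hr : Function.LeftInverse r c) {E : Finset (Finset V)}
    {A : Finset W} (hA : SpansFsCopy k a G (padEdges k c r E) A) (hAc : A ⊆ univ.map c) :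
    SpansFsCopy k a G E (A.image r) := by
  obtain ⟨f, hf, hfA, hfE⟩ := hA
  have hmem : ∀ x ∈ FsVertexSet k a G, f x ∈ univ.map c := fun x hx =>
    hAc (mem_coe.1 (hfA ▸ Set.mem_image_of_mem f hx))
  refine ⟨r ∘ f, ?_, ?_, fun e he => ?_⟩
  · refine (leftInverse_injOn hr).comp hf fun x hx => ?_
    simpa using hmem x hx
  · rw [Set.image_comp, hfA, coe_image]
  · rw [← image_image]
    refine image_mem_of_mem_padEdges (hfE e he) fun w hw => ?_
    obtain ⟨x, hx, rfl⟩ := mem_image.1 hw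
    exact hmem x (subset_FsVertexSet he hx)

lemma SpansEsCopy.image_of_padEdges [Fintype V] [DecidableEq V] [Fintype W] [DecidableEq W]
    {k t : ℕ} {c : V ↪ W} {r : W → V}
    (hr : Function.LeftInverse r c) {E : Finset (Finset V)} {A : Finset W}
    (hA : SpansEsCopy k t (padEdges k c r E) A) (hAc : A ⊆ univ.map c) :
    SpansEsCopy k t E (A.image r) := by
  obtain ⟨f, hf, rfl, hfE⟩ := hA
  have hmem : ∀ x, f x ∈ univ.map c := fun x => hAc (mem_image_of_mem f (mem_univ x))
  refine ⟨r ∘ f, fun x y hxy => hf (leftInverse_injOn hr ?_ ?_ hxy), ?_, fun g => ?_⟩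
  · simpa using hmem x
  · simpa using hmem y
  · rw [image_image]
  · have h := image_mem_of_mem_padEdges (hfE g) fun w hw => by
      obtain ⟨x, -, rfl⟩ := mem_image.1 hw
      exact hmem _
    rw [image_image] at h
    exact h

lemma SpansFsCopy.card_eq [DecidableEq W] {k : ℕ} {a : Fin k → ℕ} {G : SimpleGraph (Fin k)}
    {E : Finset (Finset W)} {A : Finset W} (hA : SpansFsCopy k a G E A) :
    A.card = G.edgeSet.ncard + ∑ i, a i := by
  obtain ⟨f, hf, hfA, -⟩ := hA
  rw [← Set.ncard_coe_finset, ← hfA, hf.ncard_image, FsVertexSet,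
    Set.ncard_union_eq _ (Set.toFinite _) (Set.toFinite _),
    Set.ncard_image_of_injective _ Sum.inr_injective, ← Set.image_univ,
    Set.ncard_image_of_injective _ Sum.inl_injective, Set.ncard_univ, add_comm]
  · simp
  · refine Set.disjoint_left.2 ?_
    rintro _ ⟨x, rfl⟩ ⟨y, -, h⟩
    cases h

lemma SpansEsCopy.card_eq [DecidableEq W] {k t : ℕ} {E : Finset (Finset W)} {A : Finset W}
    (hA : SpansEsCopy k t E A) : A.card = k * t := by
  obtain ⟨f, hf, rfl, -⟩ := hA
  rw [card_image_of_injective _ hf]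
  simp

lemma card_filter_not_subset_le [Fintype W] [DecidableEq W]
    {T : Finset (Finset W)} {U : Finset W}
    (hT : (T : Set (Finset W)).PairwiseDisjoint id) :
    (T.filter fun A => ¬ A ⊆ U).card ≤ Uᶜ.card := by
  have h : ∀ A ∈ T.filter fun A => ¬ A ⊆ U, ∃ w ∈ Uᶜ, w ∈ A := by
    intro A hA
    obtain ⟨w, hw, hwU⟩ := not_subset.1 (mem_filter.1 hA).2
    exact ⟨w, mem_compl.2 hwU, hw⟩
  refine card_le_card_of_forall_subsingleton (fun A w => w ∈ A) h ?_
  rintro w - A ⟨hA, hwA⟩ B ⟨hB, hwB⟩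
  by_contra hAB
  exact disjoint_left.1 (hT (mem_filter.1 hA).1 (mem_filter.1 hB).1 hAB) hwA hwB

lemma phiTiling_le_one [Fintype W] (s : ℕ) (TF TE : Finset (Finset W))
    : phiTiling s TF TE ≤ 1 := by
  refine div_le_one_of_le₀ ?_ (Nat.cast_nonneg _)
  have : (0 : ℝ) ≤ s * ((TF.card : ℝ) + (3 / 5) * (TE.card : ℝ)) := by positivity
  linarith

lemma bddBelow_phiTiling [Fintype W] [DecidableEq W] (k s : ℕ) (a : Fin k → ℕ)
    (G : SimpleGraph (Fin k))
    (E : Finset (Finset W)) :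
    BddBelow {x | ∃ TF TE : Finset (Finset W), IsFETiling k a G E TF TE ∧
      x = phiTiling s TF TE} := by
  refine Set.Finite.bddBelow ((Set.finite_range fun p : Finset (Finset W) × Finset (Finset W) =>
    phiTiling s p.1 p.2).subset ?_)
  rintro _ ⟨TF, TE, -, rfl⟩
  exact ⟨(TF, TE), rfl⟩

/-- Deleting the tiles that meet the new vertices. -/
lemma IsFETiling.exists_of_padEdges [Fintype V] [DecidableEq V] [Fintype W] [DecidableEq W]
    {k : ℕ} {a : Fin k → ℕ} {G : SimpleGraph (Fin k)}
    (hnd : ¬ k ∣ G.edgeSet.ncard + ∑ i, a i) {c : V ↪ W} {r : W → V}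
    (hr : Function.LeftInverse r c) {E : Finset (Finset V)} {TF TE : Finset (Finset W)}
    (hT : IsFETiling k a G (padEdges k c r E) TF TE) :
    ∃ TF' TE' : Finset (Finset V), IsFETiling k a G E TF' TE' ∧
      TF.card + TE.card ≤ TF'.card + TE'.card + ((univ.map c)ᶜ : Finset W).card ∧
      TE'.card ≤ TE.card := by
  obtain ⟨hdis, hF, hE⟩ := hT
  have hinj : ∀ T : Finset (Finset W), Set.InjOn (image r)
      ((T.filter (· ⊆ univ.map c) : Finset (Finset W)) : Set (Finset W)) := by
    intro T A hA B hB hAB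
    rw [← map_image_leftInverse hr (mem_filter.1 hA).2,
      ← map_image_leftInverse hr (mem_filter.1 hB).2, hAB]
  refine ⟨(TF.filter (· ⊆ univ.map c)).image (image r),
    (TE.filter (· ⊆ univ.map c)).image (image r), ⟨?_, ?_, ?_⟩, ?_, ?_⟩
  · rw [← image_union, ← filter_union]
    intro A hA B hB hAB
    obtain ⟨A, hA₀, rfl⟩ := mem_image.1 (mem_coe.1 hA)
    obtain ⟨B, hB₀, rfl⟩ := mem_image.1 (mem_coe.1 hB)
    rw [mem_filter] at hA₀ hB₀
    have h := hdis hA₀.1 hB₀.1 fun h => hAB (h ▸ rfl)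
    rw [Function.onFun, id, id, ← map_image_leftInverse hr hA₀.2,
      ← map_image_leftInverse hr hB₀.2, disjoint_map] at h
    exact h
  · intro A hA
    obtain ⟨A, hA₀, rfl⟩ := mem_image.1 hA
    exact (hF A (mem_filter.1 hA₀).1).image_of_padEdges hr (mem_filter.1 hA₀).2
  · intro A hA
    obtain ⟨A, hA₀, rfl⟩ := mem_image.1 hA
    exact (hE A (mem_filter.1 hA₀).1).image_of_padEdges hr (mem_filter.1 hA₀).2
  · have hFE : Disjoint TF TE := disjoint_left.2 fun A hAF hAE =>
      hnd ⟨_, (hF A hAF).card_eq.symm.trans (hE A hAE).card_eq⟩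
    rw [card_image_of_injOn (hinj TF), card_image_of_injOn (hinj TE),
      ← card_union_of_disjoint hFE,
      ← card_union_of_disjoint (hFE.mono (filter_subset _ _) (filter_subset _ _)),
      ← filter_union, ← card_filter_add_card_filter_not (s := TF ∪ TE) (· ⊆ univ.map c)]
    exact Nat.add_le_add_left (card_filter_not_subset_le hdis) _
  · exact card_image_le.trans (card_filter_le _ _)

lemma isDense_powersetCard [Fintype W] [DecidableEq W]
    {k : ℕ} (hk : 1 ≤ k) {μ θ : ℝ} (hμ : μ ≤ 1) (hθ : 0 ≤ θ) :
    IsDense k μ θ ((univ : Finset W).powersetCard k) := by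
  refine ⟨∅, by simp, by simpa using by positivity, fun S hS _ => ?_⟩
  have h : Sᶜ.card ≤ degS ((univ : Finset W).powersetCard k) S :=
    card_le_degS disjoint_compl_left fun w hw => by
      rw [mem_powersetCard, card_insert_of_notMem (mem_compl.1 hw), hS]
      exact ⟨subset_univ _, by omega⟩
  have h1 : k ≤ Fintype.card W + 1 := by
    have := card_le_univ S
    omega
  have h2 : Fintype.card W + 1 ≤ degS ((univ : Finset W).powersetCard k) S + k := by
    rw [card_compl, hS] at h
    omega
  have h3 : (k : ℝ) ≤ Fintype.card W + 1 := by exact_mod_cast h1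
  have h4 : (Fintype.card W : ℝ) + 1 ≤ degS ((univ : Finset W).powersetCard k) S + k := by
    exact_mod_cast h2
  nlinarith

lemma phiMin_le_phiMin_padEdges [Fintype V] [DecidableEq V] [Fintype W] [DecidableEq W]
    [Nonempty V] {k s : ℕ} {a : Fin k → ℕ}
    {G : SimpleGraph (Fin k)} (hnd : ¬ k ∣ G.edgeSet.ncard + ∑ i, a i) {c : V ↪ W} {r : W → V}
    (hr : Function.LeftInverse r c) (E : Finset (Finset V)) {γ : ℝ} (hγ : 0 ≤ γ)
    (hcard : (Fintype.card W : ℝ) = Fintype.card V + γ * Fintype.card V) :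
    phiMin k s a G E ≤ phiMin k s a G (padEdges k c r E) + s * γ := by
  rw [← sub_le_iff_le_add]
  refine le_csInf ⟨_, ∅, ∅, ⟨by simp, by simp, by simp⟩, rfl⟩ ?_
  rintro _ ⟨TF, TE, hT, rfl⟩
  obtain ⟨TF', TE', hT', hle, hTE⟩ := hT.exists_of_padEdges hnd hr
  rw [sub_le_iff_le_add]
  refine (csInf_le (bddBelow_phiTiling k s a G E) ⟨TF', TE', hT', rfl⟩).trans ?_
  have hone := phiTiling_le_one s TF TE
  have hn : (0 : ℝ) < Fintype.card V := by exact_mod_cast Fintype.card_pos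
  have hW : (0 : ℝ) < Fintype.card W := by rw [hcard]; positivity
  have hs : (0 : ℝ) ≤ s := Nat.cast_nonneg _
  have hφ : phiTiling s TF TE * Fintype.card W =
      Fintype.card W - s * ((TF.card : ℝ) + (3 / 5) * (TE.card : ℝ)) :=
    div_mul_cancel₀ _ hW.ne'
  have hle' : (TF.card : ℝ) + TE.card ≤ TF'.card + TE'.card + γ * Fintype.card V := by
    rw [card_compl, card_map, card_univ] at hle
    have h : (TF.card : ℝ) + TE.card ≤ TF'.card + TE'.card +
        ((Fintype.card W - Fintype.card V : ℕ) : ℝ) := by exact_mod_cast hle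
    rw [Nat.cast_sub (Fintype.card_le_of_embedding c), hcard] at h
    linarith
  have hTE' : (TE'.card : ℝ) ≤ TE.card := by exact_mod_cast hTE
  generalize phiTiling s TF TE = x at hone hφ ⊢
  rw [phiTiling, div_le_iff₀ hn]
  rw [hcard] at hφ
  have hw : s * ((TF.card : ℝ) + (3 / 5) * TE.card) ≤
      s * (TF'.card + (3 / 5) * TE'.card + γ * Fintype.card V) :=
    mul_le_mul_of_nonneg_left (by linarith) hs
  nlinarith [mul_nonneg (mul_nonneg hγ hn.le) (sub_nonneg.2 hone)]

end Padding

/-- `Φ(n, μ, θ) ≤ Φ((1+γ)n, μ + γ/3, θ) + sγ`, where the data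
`(G_s, a, ℓ)` defining `F_s` and `E_s` is fixed as in the paper and `γn = g` is a
positive integer. -/
theorem Phi_padding (k s : ℕ) (hk : 3 ≤ k) (hs : 5 * k ^ 2 ≤ s) (hnd : ¬ k ∣ s)
    (G : SimpleGraph (Fin k)) (a : Fin k → ℕ) (ℓ : ℕ)
    (hG : IsUnionOfPaths k G) (hEG : G.edgeSet.ncard = ℓ) (hℓk : ℓ ≤ k - 1)
    (ha : ∀ i, 1 ≤ a i) (hab : ∀ i j, |(a i : ℤ) - (a j : ℤ)| ≤ 1)
    (hsum : ℓ + ∑ i, a i = s) (hFs : FsHasSpanningCs k s a G)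
    (γ μ θ : ℝ) (hγ : 0 < γ) (hμ : 0 ≤ μ) (hθ : 0 ≤ θ) (hμγ : μ + γ / 3 ≤ 2 / 3)
    (n g : ℕ) (hn : 0 < n) (hg : 1 ≤ g) (hgn : (g : ℝ) = γ * (n : ℝ)) :
    PhiMax k s a G n μ θ ≤ PhiMax k s a G (n + g) (μ + γ / 3) θ + (s : ℝ) * γ := by
  have : Nonempty (Fin n) := ⟨⟨0, hn⟩⟩
  have hk1 : 1 ≤ k := by omega
  have hcard : (Fintype.card (Fin (n + g)) : ℝ) =
      Fintype.card (Fin n) + γ * Fintype.card (Fin n) := by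
    simp [hgn]
  have hr : Function.LeftInverse (Function.invFun (Fin.castAddEmb (n := n) g))
      (Fin.castAddEmb g) := Function.leftInverse_invFun (Fin.castAddEmb g).injective
  refine csSup_le ⟨_, univ.powersetCard k, fun e he => (mem_powersetCard.1 he).2,
    isDense_powersetCard hk1 (by linarith) hθ, rfl⟩ ?_
  rintro _ ⟨E, hE, hd, rfl⟩
  refine (phiMin_le_phiMin_padEdges (by rwa [hEG, hsum]) hr E hγ.le hcard).trans ?_
  gcongr
  refine le_csSup ((Set.finite_range (phiMin (V := Fin (n + g)) k s a G)).subset ?_).bddAbove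
    ⟨_, isKGraph_padEdges _ _ _ E, isDense_padEdges hk1 hr hE hγ.le hθ hμγ hcard hd, rfl⟩
  rintro _ ⟨F, -, -, rfl⟩
  exact ⟨F, rfl⟩
end
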